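/- There exists a one-dimensional cellular automaton with von Neumann neighborhood of radius 1 (a finite state set Q containing the input alphabet A, a quiescent state q, and a local rule f, none depending on n or k) that solves the sorting problem in exactly k + nk steps: for all n ≥ 1 and k ≥ 2 and every input word w of n blocks of k bits placed in cells 0,…,nk−1 of an otherwise quiescent configuration c, the configuration F^{k+nk} c is stable and its restriction to cells 0,…,nk−1 is the sorted output word w_{σ(1)}⋯w_{σ(n)}. -/

import Mathlib

/-- The input alphabet `A = {0, 1, ⟨0, ⟨1, 0|, 1|}`:
a bit can be plain, marked as most significant (`⟨b`) or as least
significant (`b|`). -/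
inductive CASym : Type
  | plain : Bool → CASym
  | msb : Bool → CASym
  | lsb : Bool → CASym
  deriving DecidableEq

/-- The symbol at position `j` of the block encoding the `k`-bit number with
bits `b` (most significant bit first): the most significant bit is marked `⟨`,
the least significant bit is marked `|`. -/
def blockSym (k : ℕ) (b : Fin k → Bool) (j : Fin k) : CASym :=
  if j.val = 0 then CASym.msb (b j)
  else if j.val = k - 1 then CASym.lsb (b j)
  else CASym.plain (b j)

/-- The value of a `k`-bit block, most significant bit first. -/
def blockValue (k : ℕ) (b : Fin k → Bool) : ℕ :=
  ∑ j : Fin k, if b j then 2 ^ (k - 1 - j.val) else 0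

/-- The symbol at position `p` (for `p < n * k`) of the input word
`w₁ ⋯ wₙ` consisting of `n` blocks of `k` bits each. -/
def wordSym (n k : ℕ) (w : Fin n → Fin k → Bool) (p : ℕ) : CASym :=
  if h : p / k < n ∧ p % k < k then
    blockSym k (w ⟨p / k, h.1⟩) ⟨p % k, h.2⟩
  else CASym.plain false

/-- The global map of a one-dimensional radius-1 cellular automaton with
local rule `f`. -/
def glob {Q : Type*} (f : Q → Q → Q → Q) (c : ℤ → Q) : ℤ → Q :=
  fun i => f (c (i - 1)) (c i) (c (i + 1))

/-- The initial configuration: the input word (embedded into the state set via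
`embed`) placed in cells `0, …, n*k - 1`, all other cells quiescent (`q`). -/
def initConfig {Q : Type*} (embed : CASym → Q) (q : Q) (n k : ℕ)
    (w : Fin n → Fin k → Bool) : ℤ → Q :=
  fun i => if 0 ≤ i ∧ i < (n * k : ℕ) then embed (wordSym n k w i.toNat) else q

/-- The restriction of the configuration `c` to cells `0, …, n*k - 1` is the
required sorted output word `w_{σ(1)} ⋯ w_{σ(n)}`: a permutation of the input
blocks whose values are in nondecreasing order. -/
def IsSortedOutput {Q : Type*} (embed : CASym → Q) (n k : ℕ)
    (w : Fin n → Fin k → Bool) (c : ℤ → Q) : Prop :=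
  ∃ σ : Equiv.Perm (Fin n),
    (∀ i j : Fin n, i ≤ j → blockValue k (w (σ i)) ≤ blockValue k (w (σ j))) ∧
    ∀ p : ℕ, p < n * k → c (p : ℤ) = embed (wordSym n k (fun i => w (σ i)) p)

/-- The CA given by local rule `f`, quiescent state `q` and embedding `embed`
of the input alphabet solves the sorting problem: for every input, after some
number of steps a stable configuration is reached whose restriction to the
input cells is the sorted output word. -/
def SolvesSorting {Q : Type*} (f : Q → Q → Q → Q) (q : Q) (embed : CASym → Q) : Prop :=
  ∀ n k : ℕ, 1 ≤ n → 2 ≤ k → ∀ w : Fin n → Fin k → Bool,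
    ∃ t : ℕ,
      glob f ((glob f)^[t] (initConfig embed q n k w)) =
        (glob f)^[t] (initConfig embed q n k w) ∧
      IsSortedOutput embed n k w ((glob f)^[t] (initConfig embed q n k w))


set_option linter.unusedVariables false

/-! ### Word level sorting network -/

/-- Word-level stage at which slots `s < s'` cross. -/
def Zw (n s s' : ℤ) : ℤ :=
  if s + 3 * s' + 2 ≤ 2 * n then 6 * (s + s') + 2
  else if 2 * n ≤ 3 * s + s' + 1 then 6 * (2 * n - 1 - s - s')
  else 3 * (2 * n - 1 + s - s') + 1

def Zb (n k j s s' : ℤ) : ℤ :=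
  if s + 3 * s' + 2 ≤ 2 * n then 4 * ((s + s') * k) + 8 * j
  else if 2 * n ≤ 3 * s + s' + 1 then 4 * ((2 * n - 1 - s - s') * k) - 2 + 4 * j
  else 2 * ((2 * n - 1 + s - s') * k) + 6 * j - 1

theorem Zw_between {n s1 s2 s3 : ℤ} (h12 : s1 < s2) (h23 : s2 < s3)
    (h1 : 0 ≤ s1) (h3 : s3 < n) :
    (Zw n s1 s2 < Zw n s1 s3 ∧ Zw n s1 s3 < Zw n s2 s3) ∨
    (Zw n s2 s3 < Zw n s1 s3 ∧ Zw n s1 s3 < Zw n s1 s2) := by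
  unfold Zw
  split_ifs <;> omega

theorem Zw_nonneg {n s s' : ℤ} (h : s < s') (h1 : 0 ≤ s) (h3 : s' < n) : 0 ≤ Zw n s s' := by
  unfold Zw
  split_ifs <;> omega

theorem Zw_lt {n s s' : ℤ} (h : s < s') (h1 : 0 ≤ s) (h3 : s' < n) : Zw n s s' < 12 * n := by
  unfold Zw
  split_ifs <;> omega

theorem Zb_mono {n k j s s' u u' : ℤ} (hj : 0 ≤ j) (hjk : j < k)
    (h : Zw n s s' ≤ Zw n u u') : Zb n k j s s' ≤ Zb n k j u u' := by
  unfold Zw at h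
  unfold Zb
  split_ifs at h ⊢
  · nlinarith [show s + s' ≤ u + u' by omega]
  · nlinarith [show s + s' + 1 ≤ 2 * n - 1 - u - u' by omega]
  · nlinarith [show 2 * (s + s') + 1 ≤ 2 * n - 1 + u - u' by omega]
  · nlinarith [show 2 * n - 1 - s - s' ≤ u + u' by omega]
  · nlinarith [show 2 * n - 1 - s - s' ≤ 2 * n - 1 - u - u' by omega]
  · nlinarith [show 2 * (2 * n - 1 - s - s') ≤ 2 * n - 1 + u - u' by omega]
  · nlinarith [show (2 * n - 1 + s - s') ≤ 2 * (u + u') by omega]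
  · nlinarith [show (2 * n - 1 + s - s') + 1 ≤ 2 * (2 * n - 1 - u - u') by omega]
  · nlinarith [show (2 * n - 1 + s - s') ≤ 2 * n - 1 + u - u' by omega]

theorem Zb_smono {n k j s s' u u' : ℤ} (hj : 0 ≤ j) (hjk : j < k)
    (h : Zw n s s' < Zw n u u') : Zb n k j s s' < Zb n k j u u' := by
  unfold Zw at h
  unfold Zb
  split_ifs at h ⊢
  · nlinarith [show s + s' + 1 ≤ u + u' by omega]
  · nlinarith [show s + s' + 1 ≤ 2 * n - 1 - u - u' by omega]
  · nlinarith [show 2 * (s + s') + 1 ≤ 2 * n - 1 + u - u' by omega]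
  · nlinarith [show 2 * n - 1 - s - s' ≤ u + u' by omega]
  · nlinarith [show 2 * n - 1 - s - s' + 1 ≤ 2 * n - 1 - u - u' by omega]
  · nlinarith [show 2 * (2 * n - 1 - s - s') ≤ 2 * n - 1 + u - u' by omega]
  · nlinarith [show (2 * n - 1 + s - s') ≤ 2 * (u + u') by omega]
  · nlinarith [show (2 * n - 1 + s - s') + 1 ≤ 2 * (2 * n - 1 - u - u') by omega]
  · nlinarith [show (2 * n - 1 + s - s') + 1 ≤ 2 * n - 1 + u - u' by omega]

def Prt (n z s u : ℤ) : Prop :=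
  0 ≤ s ∧ s < n ∧ 0 ≤ u ∧ u < n ∧
    ((s < u ∧ Zw n s u = z) ∨ (u < s ∧ Zw n u s = z))

theorem Prt.symm {n z s u : ℤ} (h : Prt n z s u) : Prt n z u s := by
  unfold Prt at *; tauto

theorem Prt.unique {n z s u u' : ℤ} (h : Prt n z s u) (h' : Prt n z s u') : u = u' := by
  obtain ⟨a1, a2, a3, a4, a5⟩ := h
  obtain ⟨b1, b2, b3, b4, b5⟩ := h'
  by_contra hne
  rcases a5 with ⟨c1, c2⟩ | ⟨c1, c2⟩ <;> rcases b5 with ⟨d1, d2⟩ | ⟨d1, d2⟩ <;>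
  rcases lt_or_gt_of_ne hne with e | e
  · have := Zw_between c1 e a1 b4; omega
  · have := Zw_between d1 e a1 a4; omega
  · omega
  · have := Zw_between d1 c1 b3 a4; omega
  · have := Zw_between c1 d1 a3 b4; omega
  · omega
  · have := Zw_between e d1 a3 a2; omega
  · have := Zw_between e c1 b3 a2; omega

open Classical in
/-- Values in the slots before stage `z`. -/
noncomputable def VV (n : ℤ) (v : ℤ → ℕ) : ℕ → ℤ → ℕ
  | 0 => v
  | z + 1 => fun s =>
    if h : ∃ u, Prt n z s u then
      if s < h.choose then max (VV n v z s) (VV n v z h.choose)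
      else min (VV n v z s) (VV n v z h.choose)
    else VV n v z s

theorem VV_none {n : ℤ} {v : ℤ → ℕ} {z : ℕ} {s : ℤ} (h : ∀ u, ¬ Prt n z s u) :
    VV n v (z + 1) s = VV n v z s := by
  rw [VV]; simp [h]

theorem VV_part {n : ℤ} {v : ℤ → ℕ} {z : ℕ} {s u : ℤ} (h : Prt n z s u) :
    VV n v (z + 1) s = if s < u then max (VV n v z s) (VV n v z u)
      else min (VV n v z s) (VV n v z u) := by
  have hex : ∃ u, Prt n z s u := ⟨u, h⟩
  have : hex.choose = u := hex.choose_spec.unique h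
  rw [VV]
  simp only [hex, dite_true]
  rw [this]

theorem VV_cross {n : ℤ} {v : ℤ → ℕ} {z : ℕ} {s u : ℤ} (hs : 0 ≤ s) (hsu : s < u) (hu : u < n)
    (hz : Zw n s u = z) :
    VV n v (z + 1) s = max (VV n v z s) (VV n v z u) ∧
    VV n v (z + 1) u = min (VV n v z s) (VV n v z u) := by
  have h : Prt n z s u := ⟨hs, by omega, by omega, hu, Or.inl ⟨hsu, hz⟩⟩
  rw [VV_part h, VV_part h.symm, if_pos hsu, if_neg (by omega), min_comm]
  exact ⟨rfl, rfl⟩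

theorem VV_const {n : ℤ} {v : ℤ → ℕ} {z z' : ℕ} {s : ℤ} (hz : z ≤ z')
    (h : ∀ (y : ℕ) u, z ≤ y → y < z' → ¬ Prt n y s u) :
    VV n v z' s = VV n v z s := by
  induction z', hz using Nat.le_induction with
  | base => rfl
  | succ m hm ih =>
    rw [VV_none (fun u => h m u hm (by omega)), ih (fun y u h1 h2 => h y u h1 (by omega))]

theorem VV_sorted {n : ℤ} {v : ℤ → ℕ} (z : ℕ) : ∀ s s' : ℤ, 0 ≤ s → s < s' → s' < n →
    Zw n s s' < z → VV n v z s' ≤ VV n v z s := by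
  induction z with
  | zero =>
    intro s s' h1 h2 h3 h4
    have := Zw_nonneg h2 h1 h3
    simp at h4; omega
  | succ z ih =>
    intro s s' h1 h2 h3 h4
    by_cases hz : Zw n s s' = z
    · obtain ⟨e1, e2⟩ := VV_cross (v := v) h1 h2 h3 hz
      rw [e1, e2]; exact min_le_max
    have hlt : Zw n s s' < z := by push_cast at h4; omega
    have base := ih s s' h1 h2 h3 hlt
    -- bound below for s
    have hs : ∃ u, 0 ≤ u ∧ u ≤ s ∧ (u = s ∨ Zw n u s = z) ∧
        min (VV n v z s) (VV n v z u) ≤ VV n v (z + 1) s := by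
      by_cases hp : ∃ u, Prt n z s u
      · obtain ⟨u, hu⟩ := hp
        rw [VV_part hu]
        by_cases hsu : s < u
        · exact ⟨s, h1, le_rfl, Or.inl rfl, by rw [if_pos hsu]; simp⟩
        · refine ⟨u, hu.2.2.1, by omega, Or.inr ?_, by rw [if_neg hsu]⟩
          rcases hu.2.2.2.2 with h | h
          · omega
          · exact h.2
      · push Not at hp
        exact ⟨s, h1, le_rfl, Or.inl rfl, by rw [VV_none hp]; simp⟩
    have hs' : ∃ u, u < n ∧ s' ≤ u ∧ (u = s' ∨ Zw n s' u = z) ∧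
        VV n v (z + 1) s' ≤ max (VV n v z s') (VV n v z u) := by
      by_cases hp : ∃ u, Prt n z s' u
      · obtain ⟨u, hu⟩ := hp
        rw [VV_part hu]
        by_cases hsu : s' < u
        · refine ⟨u, hu.2.2.2.1, by omega, Or.inr ?_, by rw [if_pos hsu]⟩
          rcases hu.2.2.2.2 with h | h
          · exact h.2
          · omega
        · exact ⟨s', h3, le_rfl, Or.inl rfl, by rw [if_neg hsu]; simp⟩
      · push Not at hp
        exact ⟨s', h3, le_rfl, Or.inl rfl, by rw [VV_none hp]; simp⟩
    obtain ⟨u, u0, us, hu, hle⟩ := hs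
    obtain ⟨w, wn, ws, hw, hle'⟩ := hs'
    have A : VV n v z s' ≤ VV n v z u := by
      rcases hu with rfl | hu
      · exact base
      · rcases us.lt_or_eq with us | rfl
        · apply ih u s' u0 (by omega) h3
          have := Zw_between us h2 u0 h3; omega
        · exact base
    have B : VV n v z w ≤ VV n v z s := by
      rcases hw with rfl | hw
      · exact base
      · rcases ws.lt_or_eq with ws | rfl
        · apply ih s w h1 (by omega) wn
          have := Zw_between h2 ws h1 wn; omega
        · exact base
    have C : VV n v z w ≤ VV n v z u := by
      rcases us.eq_or_lt with rfl | us
      · exact B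
      rcases ws.eq_or_lt with rfl | ws
      · exact A
      have hu : Zw n u s = z := by rcases hu with h | h <;> [omega; exact h]
      have hw : Zw n s' w = z := by rcases hw with h | h <;> [omega; exact h]
      apply ih u w u0 (by omega) wn
      have h1 := Zw_between us h2 u0 h3
      have h2 := Zw_between (show u < s' by omega) ws u0 wn
      omega
    refine hle'.trans (le_trans ?_ hle)
    exact max_le (le_min base A) (le_min B C)

theorem VV_perm (n : ℕ) (v : ℤ → ℕ) (z : ℕ) :
    ∃ σ : Equiv.Perm (Fin n), ∀ i : Fin n, VV n v z (i : ℤ) = v ((σ i : ℕ) : ℤ) := by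
  classical
  induction z with
  | zero => exact ⟨1, fun i => rfl⟩
  | succ z ih =>
    obtain ⟨σ, hσ⟩ := ih
    -- the exchange map
    let ex : Fin n → Fin n := fun i =>
      if h : ∃ u : Fin n, Prt n z i u ∧
        ((i < u ∧ VV n v z i < VV n v z u) ∨ (u < i ∧ VV n v z u < VV n v z i)) then h.choose else i
    have ex_part : ∀ i u : Fin n, Prt n z i u →
        ((i < u ∧ VV n v z i < VV n v z u) ∨ (u < i ∧ VV n v z u < VV n v z i)) → ex i = u := by
      intro i u h1 h2
      have hex : ∃ u : Fin n, Prt n z i u ∧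
        ((i < u ∧ VV n v z i < VV n v z u) ∨ (u < i ∧ VV n v z u < VV n v z i)) := ⟨u, h1, h2⟩
      have := hex.choose_spec.1.unique h1
      simp only [ex, hex, dite_true]
      apply Fin.ext
      exact_mod_cast this
    have ex_none : ∀ i : Fin n, (¬ ∃ u : Fin n, Prt n z i u ∧
        ((i < u ∧ VV n v z i < VV n v z u) ∨ (u < i ∧ VV n v z u < VV n v z i))) → ex i = i := by
      intro i h
      simp only [ex, h, dite_false]
    have inv : Function.Involutive ex := by
      intro i
      by_cases h : ∃ u : Fin n, Prt n z i u ∧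
        ((i < u ∧ VV n v z i < VV n v z u) ∨ (u < i ∧ VV n v z u < VV n v z i))
      · obtain ⟨u, h1, h2⟩ := h
        rw [ex_part i u h1 h2]
        exact ex_part u i h1.symm (by tauto)
      · rw [ex_none i h, ex_none i h]
    refine ⟨(inv.toPerm).trans σ, fun i => ?_⟩
    have hval : VV n v (z + 1) (i : ℤ) = VV n v z ((ex i : ℕ) : ℤ) := by
      by_cases hp : ∃ u, Prt n z i u
      · obtain ⟨u, hu⟩ := hp
        obtain ⟨u, rfl⟩ : ∃ w : Fin n, u = ((w : ℕ) : ℤ) :=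
          ⟨⟨u.toNat, by have := hu.2.2; omega⟩, by simp [hu.2.2.1]⟩
        have hne : (i : ℕ) ≠ u := by
          intro h
          have := hu.2.2.2.2
          omega
        rw [VV_part hu]
        by_cases hc : ((i < u ∧ VV n v z i < VV n v z u) ∨ (u < i ∧ VV n v z u < VV n v z i))
        · rw [ex_part i u hu hc]
          rcases hc with ⟨h1, h2⟩ | ⟨h1, h2⟩
          · rw [if_pos (by exact_mod_cast h1), max_eq_right h2.le]
          · rw [if_neg (by have : (u : ℕ) < i := h1
                           omega), min_eq_right h2.le]
        · rw [ex_none]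
          · push Not at hc
            split_ifs with h
            · exact max_eq_left (hc.1 (by exact_mod_cast h))
            · exact min_eq_left (hc.2 (by
                have : (u : ℕ) < i := by omega
                exact this))
          · rintro ⟨w, hw, hw'⟩
            have : w = u := by
              apply Fin.ext
              exact_mod_cast hw.unique hu
            subst this
            exact hc hw'
      · push Not at hp
        rw [VV_none hp, ex_none]
        rintro ⟨w, hw, -⟩
        exact hp _ hw
    rw [hval]
    simpa using hσ (ex i)

/-- Threshold stage at quarter-time `τ` for bit `j`. -/
noncomputable def th (n k j τ : ℤ) : ℕ :=
  ((Finset.Ico 0 n ×ˢ Finset.Ico 0 n).filter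
    (fun p : ℤ × ℤ => p.1 < p.2 ∧ Zb n k j p.1 p.2 < τ)).sup (fun p => (Zw n p.1 p.2 + 1).toNat)

theorem th_spec {n k j τ s s' : ℤ} (hj : 0 ≤ j) (hjk : j < k) (h0 : 0 ≤ s) (h : s < s')
    (hn : s' < n) : Zw n s s' < th n k j τ ↔ Zb n k j s s' < τ := by
  have hz := Zw_nonneg h h0 hn
  constructor
  · intro hlt
    have : (Zw n s s').toNat < th n k j τ := by omega
    unfold th at this
    rw [Finset.lt_sup_iff] at this
    obtain ⟨⟨u, u'⟩, hm, hlt⟩ := this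
    simp only [Finset.mem_filter, Finset.mem_product, Finset.mem_Ico] at hm hlt
    have := Zb_mono (n := n) (s := s) (s' := s') (u := u) (u' := u') hj hjk (by omega)
    omega
  · intro hlt
    have : (Zw n s s' + 1).toNat ≤ th n k j τ := by
      unfold th
      exact Finset.le_sup (f := fun p : ℤ × ℤ => (Zw n p.1 p.2 + 1).toNat) (b := (s, s'))
        (by simp only [Finset.mem_filter, Finset.mem_product, Finset.mem_Ico]; omega)
    omega

theorem th_mono {n k j τ τ' : ℤ} (h : τ ≤ τ') : th n k j τ ≤ th n k j τ' := by
  unfold th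
  apply Finset.sup_mono
  intro p
  simp only [Finset.mem_filter]
  rintro ⟨h1, h2, h3⟩
  exact ⟨h1, h2, by omega⟩

/-- Word in slot `s`, as seen by bit `j` at quarter-time `τ`. -/
noncomputable def WW (n k : ℤ) (v : ℤ → ℕ) (j τ s : ℤ) : ℕ := VV n v (th n k j τ) s

/-- `u` crosses `s` at bit level at time `τ`. -/
def Cross (n k j τ s u : ℤ) : Prop :=
  0 ≤ s ∧ s < n ∧ 0 ≤ u ∧ u < n ∧
    ((s < u ∧ Zb n k j s u = τ) ∨ (u < s ∧ Zb n k j u s = τ))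

theorem th_part {n k j τ s u : ℤ} (hj : 0 ≤ j) (hjk : j < k) {y : ℕ} (h : Prt n y s u) :
    (y < th n k j τ ↔ ((s < u ∧ Zb n k j s u < τ) ∨ (u < s ∧ Zb n k j u s < τ))) := by
  obtain ⟨a1, a2, a3, a4, ⟨c1, c2⟩ | ⟨c1, c2⟩⟩ := h
  · have := th_spec (τ := τ) hj hjk a1 c1 a4
    rw [c2] at this
    have h' : ¬ u < s := by omega
    simp only [c1, h', true_and, false_and, or_false, ← this]; omega
  · have := th_spec (τ := τ) hj hjk a3 c1 a2
    rw [c2] at this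
    have h' : ¬ s < u := by omega
    simp only [c1, h', true_and, false_and, false_or, ← this]; omega

theorem WW_const {n k j τ τ' s : ℤ} {v : ℤ → ℕ} (hj : 0 ≤ j) (hjk : j < k) (h : τ ≤ τ')
    (hc : ∀ σ u, τ ≤ σ → σ < τ' → ¬ Cross n k j σ s u) :
    WW n k v j τ' s = WW n k v j τ s := by
  apply VV_const (th_mono h)
  intro y u h1 h2 hp
  have e1 := th_part (τ := τ) hj hjk hp
  have e2 := (th_part (τ := τ') hj hjk hp).1 h2
  have e3 : ¬ (y < th n k j τ) := by omega
  rw [e1] at e3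
  obtain ⟨a1, a2, a3, a4, a5⟩ := hp
  rcases e2 with ⟨h3, h4⟩ | ⟨h3, h4⟩
  · exact hc (Zb n k j s u) u (by by_contra hh; exact e3 (Or.inl ⟨h3, by omega⟩)) h4
      ⟨a1, a2, a3, a4, Or.inl ⟨h3, rfl⟩⟩
  · exact hc (Zb n k j u s) u (by by_contra hh; exact e3 (Or.inr ⟨h3, by omega⟩)) h4
      ⟨a1, a2, a3, a4, Or.inr ⟨h3, rfl⟩⟩

/-- value of `s` just before crossing the slot pair `(a,b)` -/
noncomputable def Pre (n : ℤ) (v : ℤ → ℕ) (a b s : ℤ) : ℕ := VV n v (Zw n a b).toNat s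

theorem WW_pre {n k j s u : ℤ} {v : ℤ → ℕ} (hj : 0 ≤ j) (hjk : j < k) (h0 : 0 ≤ s) (h : s < u)
    (hn : u < n) :
    WW n k v j (Zb n k j s u) s = Pre n v s u s ∧ WW n k v j (Zb n k j s u) u = Pre n v s u u := by
  have hz := Zw_nonneg h h0 hn
  have hsp := th_spec (τ := Zb n k j s u) hj hjk h0 h hn
  have hle : th n k j (Zb n k j s u) ≤ (Zw n s u).toNat := by
    by_contra hh
    have : Zw n s u < th n k j (Zb n k j s u) := by omega
    exact absurd (hsp.1 this) (by omega)
  have key : ∀ x, ∀ (y : ℕ) (w : ℤ), th n k j (Zb n k j s u) ≤ y → y < (Zw n s u).toNat →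
      x = s ∨ x = u → ¬ Prt n y x w := by
    intro x y w h1 h2 hx hp
    have e : ¬ y < th n k j (Zb n k j s u) := by omega
    rw [th_part hj hjk hp] at e
    have hZw : Zw n s u ≠ y := by omega
    obtain ⟨a1, a2, a3, a4, ⟨c1, c2⟩ | ⟨c1, c2⟩⟩ := hp
    · exact e (Or.inl ⟨c1, Zb_smono hj hjk (by omega)⟩)
    · exact e (Or.inr ⟨c1, Zb_smono hj hjk (by omega)⟩)
  unfold WW Pre
  exact ⟨(VV_const hle (fun y w h1 h2 => key s y w h1 h2 (Or.inl rfl))).symm,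
    (VV_const hle (fun y w h1 h2 => key u y w h1 h2 (Or.inr rfl))).symm⟩

theorem WW_cross {n k j s u : ℤ} {v : ℤ → ℕ} (hj : 0 ≤ j) (hjk : j < k) (h0 : 0 ≤ s) (h : s < u)
    (hn : u < n) :
    WW n k v j (Zb n k j s u + 1) s = max (Pre n v s u s) (Pre n v s u u) ∧
    WW n k v j (Zb n k j s u + 1) u = min (Pre n v s u s) (Pre n v s u u) := by
  have hz := Zw_nonneg h h0 hn
  have hsp := th_spec (τ := Zb n k j s u + 1) hj hjk h0 h hn
  have hle : (Zw n s u).toNat + 1 ≤ th n k j (Zb n k j s u + 1) := by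
    have := hsp.2 (by omega)
    omega
  have key : ∀ x, ∀ (y : ℕ) (w : ℤ), (Zw n s u).toNat + 1 ≤ y → y < th n k j (Zb n k j s u + 1) →
      x = s ∨ x = u → ¬ Prt n y x w := by
    intro x y w h1 h2 hx hp
    rw [th_part hj hjk hp] at h2
    obtain ⟨a1, a2, a3, a4, a5⟩ := hp
    rcases h2 with ⟨c1, c2⟩ | ⟨c1, c2⟩
    · have : Zw n x w = y := by omega
      have := Zb_smono (n := n) (s := s) (s' := u) (u := x) (u' := w) hj hjk (by omega)
      omega
    · have : Zw n w x = y := by omega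
      have := Zb_smono (n := n) (s := s) (s' := u) (u := w) (u' := x) hj hjk (by omega)
      omega
  obtain ⟨e1, e2⟩ := VV_cross (v := v) (z := (Zw n s u).toNat) h0 h hn (by omega)
  unfold WW Pre
  rw [VV_const hle (fun y w h1 h2 => key s y w h1 h2 (Or.inl rfl)),
    VV_const hle (fun y w h1 h2 => key u y w h1 h2 (Or.inr rfl))]
  exact ⟨e1, e2⟩

/-- final content of slot `s` -/
noncomputable def Fin_ (n : ℤ) (v : ℤ → ℕ) (s : ℤ) : ℕ := VV n v (12 * n).toNat s

theorem WW_final {n k j s τ : ℤ} {v : ℤ → ℕ} (hj : 0 ≤ j) (hjk : j < k)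
    (hc : ∀ σ u, τ ≤ σ → ¬ Cross n k j σ s u) :
    WW n k v j τ s = Fin_ n v s := by
  have hle : th n k j τ ≤ (12 * n).toNat := by
    unfold th
    apply Finset.sup_le
    rintro ⟨a, b⟩ hp
    simp only [Finset.mem_filter, Finset.mem_product, Finset.mem_Ico] at hp ⊢
    have := Zw_lt (n := n) hp.2.1 hp.1.1.1 hp.1.2.2
    omega
  unfold WW Fin_
  refine (VV_const hle ?_).symm
  intro y u h1 h2 hp
  have e : ¬ y < th n k j τ := by omega
  rw [th_part hj hjk hp] at e
  obtain ⟨a1, a2, a3, a4, ⟨c1, c2⟩ | ⟨c1, c2⟩⟩ := hp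
  · exact hc (Zb n k j s u) u (by by_contra hh; exact e (Or.inl ⟨c1, by omega⟩))
      ⟨a1, a2, a3, a4, Or.inl ⟨c1, rfl⟩⟩
  · exact hc (Zb n k j u s) u (by by_contra hh; exact e (Or.inr ⟨c1, by omega⟩))
      ⟨a1, a2, a3, a4, Or.inr ⟨c1, rfl⟩⟩

theorem WW_zero {n k j s : ℤ} {v : ℤ → ℕ} (hj : 0 ≤ j) (hjk : j < k) :
    WW n k v j 0 s = v s := by
  have : th n k j 0 = 0 := by
    unfold th
    rw [Finset.filter_false_of_mem]
    · rfl
    rintro ⟨a, b⟩ hp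
    simp only [Finset.mem_product, Finset.mem_Ico] at hp ⊢
    rintro ⟨h1, h2⟩
    unfold Zb at h2
    split_ifs at h2
    · nlinarith [mul_nonneg (show 0 ≤ a + b by omega) (show 0 ≤ k by omega)]
    · nlinarith [mul_nonneg (show 0 ≤ 2 * n - 1 - a - b - 1 by omega) (show 0 ≤ k by omega)]
    · nlinarith [mul_nonneg (show 0 ≤ 2 * n - 1 + a - b - 1 by omega) (show 0 ≤ k by omega)]
  unfold WW
  rw [this]; rfl


/-! ### Bits and prefixes -/

/-- bit `j` (most significant first) of a `k`-bit number -/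
def bt (k : ℤ) (A : ℕ) (j : ℤ) : Bool := A.testBit (k - 1 - j).toNat

/-- comparison of the prefixes of length `j` -/
def pst (k : ℤ) (A B : ℕ) (j : ℤ) : Ordering :=
  compare (A / 2 ^ (k - j).toNat) (B / 2 ^ (k - j).toNat)

def updO (s : Ordering) (a b : Bool) : Ordering := if s = .eq then compare a b else s
def hiB (s : Ordering) (a b : Bool) : Bool := if s = .lt then b else a
def loB (s : Ordering) (a b : Bool) : Bool := if s = .lt then a else b

set_option linter.unusedVariables false

theorem VV_lt {n : ℤ} {v : ℤ → ℕ} {M : ℕ} (h : ∀ s, v s < M) (z : ℕ) : ∀ s, VV n v z s < M := by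
  induction z with
  | zero => exact h
  | succ z ih =>
    intro s
    by_cases hp : ∃ u, Prt n z s u
    · obtain ⟨u, hu⟩ := hp
      rw [VV_part hu]
      split_ifs
      · exact max_lt (ih _) (ih _)
      · exact min_lt_of_left_lt (ih _)
    · push Not at hp
      rw [VV_none hp]; exact ih s

theorem pst_zero {k : ℤ} {A B : ℕ} (hA : A < 2 ^ k.toNat) (hB : B < 2 ^ k.toNat) :
    pst k A B 0 = .eq := by
  unfold pst
  simp only [sub_zero]
  rw [Nat.div_eq_of_lt hA, Nat.div_eq_of_lt hB]
  simp

theorem div_bit (A m : ℕ) : A / 2 ^ m = 2 * (A / 2 ^ (m + 1)) + (A.testBit m).toNat := by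
  rw [Nat.testBit_eq_decide_div_mod_eq, pow_succ, ← Nat.div_div_eq_div_mul]
  have := Nat.div_add_mod (A / 2 ^ m) 2
  rcases Nat.mod_two_eq_zero_or_one (A / 2 ^ m) with h | h <;> simp [h] <;> omega

theorem pst_succ {k j : ℤ} {A B : ℕ} (hj : 0 ≤ j) (hjk : j < k) :
    pst k A B (j + 1) = updO (pst k A B j) (bt k A j) (bt k B j) := by
  unfold pst updO bt
  obtain ⟨m, hm⟩ : ∃ m : ℕ, (k - 1 - j).toNat = m := ⟨_, rfl⟩
  have h1 : (k - (j + 1)).toNat = m := by omega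
  have h2 : (k - j).toNat = m + 1 := by omega
  rw [h1, h2, hm, div_bit A m, div_bit B m]
  generalize A / 2 ^ (m + 1) = a
  generalize B / 2 ^ (m + 1) = b
  rcases lt_trichotomy a b with h | h | h
  · have e : compare a b = .lt := compare_lt_iff_lt.2 h
    rw [e, if_neg (by decide), compare_lt_iff_lt]
    cases A.testBit m <;> cases B.testBit m <;> simp <;> omega
  · subst h
    simp only [compare_eq_iff_eq.2 (rfl : a = a), if_true]
    cases A.testBit m <;> cases B.testBit m
    · simp
    · rw [compare_lt_iff_lt.2 (by simp)]; rfl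
    · rw [compare_gt_iff_gt.2 (by simp)]; rfl
    · simp
  · have e : compare a b = .gt := compare_gt_iff_gt.2 h
    rw [e, if_neg (by decide), compare_gt_iff_gt]
    cases A.testBit m <;> cases B.testBit m <;> simp <;> omega

theorem bt_max_min {k j : ℤ} {A B : ℕ} (hj : 0 ≤ j) (hjk : j < k) :
    bt k (max A B) j = hiB (pst k A B (j + 1)) (bt k A j) (bt k B j) ∧
    bt k (min A B) j = loB (pst k A B (j + 1)) (bt k A j) (bt k B j) := by
  unfold pst hiB loB bt
  obtain ⟨m, hm⟩ : ∃ m : ℕ, (k - 1 - j).toNat = m := ⟨_, rfl⟩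
  have h1 : (k - (j + 1)).toNat = m := by omega
  rw [h1, hm]
  have key : ∀ C : ℕ, C.testBit m = decide (C / 2 ^ m % 2 = 1) :=
    fun C => Nat.testBit_eq_decide_div_mod_eq
  rcases lt_trichotomy (A / 2 ^ m) (B / 2 ^ m) with h | h | h
  · rw [compare_lt_iff_lt.2 h]
    have : A < B := by
      by_contra hh
      exact absurd (Nat.div_le_div_right (c := 2 ^ m) (not_lt.1 hh)) (by omega)
    simp [max_eq_right this.le, min_eq_left this.le]
  · rw [compare_eq_iff_eq.2 h]
    have : A.testBit m = B.testBit m := by rw [key, key, h]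
    rcases le_total A B with h' | h' <;> simp [h', this]
  · rw [compare_gt_iff_gt.2 h]
    have : B < A := by
      by_contra hh
      exact absurd (Nat.div_le_div_right (c := 2 ^ m) (not_lt.1 hh)) (by omega)
    simp [max_eq_left this.le, min_eq_right this.le]



set_option linter.unusedVariables false

/-! ### The sorting layer: states and local rules -/

inductive Kd
  | ms | pl | ls
  deriving DecidableEq

/-- control part of a cell -/
structure Ctl where
  kd : Kd
  Rp : Bool
  Rm : Bool
  Rl : Bool
  dR : Bool
  dL : Bool
  Lp : Bool → Bool
  Lm : Bool → Bool
  T : Bool → Bool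
  Ka : Bool
  Kw : Bool
  J0 : Bool → Bool
  J1 : Bool → Bool
  J2 : Bool → Bool
  WL : Bool
  S0 : Bool → Bool
  S1 : Bool → Bool

def Ctl.init (κ : Kd) : Ctl where
  kd := κ
  Rp := false
  Rm := false
  Rl := false
  dR := false
  dL := false
  Lp := fun _ => false
  Lm := fun _ => false
  T := fun _ => false
  Ka := false
  Kw := false
  J0 := fun _ => false
  J1 := fun _ => false
  J2 := fun _ => false
  WL := false
  S0 := fun _ => false
  S1 := fun _ => false

def launchR (l c : Ctl) : Bool := c.Rp && !l.Rp && !c.dR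
def lau (z : Ctl) (b : Bool) : Bool := z.T b && !z.Lp b
def lmE (z : Ctl) (b : Bool) : Bool := z.Lm b || (lau z b && z.kd = .ms)
def jinc (z : Ctl) (b : Bool) : Bool := z.J0 b || (z.Rm && z.Lm b)
def jedge (l z : Ctl) (b : Bool) : Bool := z.J2 b || (l.Rm && lmE z b)
def nLm (r : Ctl) (b : Bool) : Bool := (lau r b && r.kd = .ms) || r.Lm b
def nS0 (c r : Ctl) (b : Bool) : Bool :=
  (r.WL && c.kd = .ms && !b) || (if r.kd = .ms then r.S1 (!b) else r.S1 b)
def nRm (l c : Ctl) : Bool := l.Rm || (launchR l c && c.kd = .ms)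

def cstep (l c r : Ctl) : Ctl where
  kd := c.kd
  Rp := l.Rp || launchR l c
  Rm := nRm l c
  Rl := l.Rl || (launchR l c && c.kd = .ls)
  dR := c.dR || launchR l c
  dL := c.dL || lau c false || lau c true
  Lp := fun b => lau r b || r.Lp b
  Lm := nLm r
  T := fun b => if c.kd = .ms then nLm r b || (nS0 c r b && !c.dR) else l.T b
  Ka := if c.kd = .ms then nRm l c else l.Kw
  Kw := c.Ka && !(c.kd = .ls)
  J0 := c.J1
  J1 := fun b => jedge l c b && !l.Rl
  J2 := fun b => jinc l b && !l.Rl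
  WL := r.WL && !(c.kd = .ms)
  S0 := nS0 c r
  S1 := c.S0

/-- data part of a cell -/
structure Dat where
  reg : Bool
  R : Bool
  L : Bool → Bool
  Ksa : Ordering
  Ksw : Ordering
  Ts : Bool → Ordering
  Js0 : Bool → Ordering
  Js1 : Bool → Ordering
  Js2 : Bool → Ordering

def Dat.init (b : Bool) : Dat where
  reg := b
  R := false
  L := fun _ => false
  Ksa := .eq
  Ksw := .eq
  Ts := fun _ => .eq
  Js0 := fun _ => .eq
  Js1 := fun _ => .eq
  Js2 := fun _ => .eq

def realC (c : Ctl) : Bool := !c.dR && !c.dL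

def s1 (d : Dat) : Ordering := updO d.Ksa d.R d.reg
def reg1 (c : Ctl) (d : Dat) : Bool :=
  if c.Ka then (if realC c then loB (s1 d) d.R d.reg else d.R) else d.reg
def R1 (c : Ctl) (d : Dat) : Bool :=
  if c.Ka && realC c then hiB (s1 d) d.R d.reg else d.R
def sI (c : Ctl) (d : Dat) (b : Bool) : Ordering :=
  updO (if c.Rm then .eq else d.Js0 b) (R1 c d) (d.L b)
def R2 (c : Ctl) (d : Dat) : Bool :=
  if jinc c false then hiB (sI c d false) (R1 c d) (d.L false)
  else if jinc c true then hiB (sI c d true) (R1 c d) (d.L true)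
  else R1 c d
def L2 (c : Ctl) (d : Dat) (b : Bool) : Bool :=
  if jinc c b then loB (sI c d b) (R1 c d) (d.L b) else d.L b
def s3 (c : Ctl) (d : Dat) (b : Bool) : Ordering := updO (d.Ts b) (reg1 c d) (L2 c d b)
def reg3 (c : Ctl) (d : Dat) : Bool :=
  if realC c && c.T false && c.Lp false then hiB (s3 c d false) (reg1 c d) (L2 c d false)
  else if realC c && c.T true && c.Lp true then hiB (s3 c d true) (reg1 c d) (L2 c d true)
  else reg1 c d
def L3 (c : Ctl) (d : Dat) (b : Bool) : Bool :=
  if c.T b then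
    if c.Lp b then (if realC c then loB (s3 c d b) (reg1 c d) (L2 c d b) else L2 c d b)
    else reg1 c d
  else L2 c d b
def sE (l : Ctl) (dl : Dat) (z : Ctl) (dz : Dat) (b : Bool) : Ordering :=
  updO (if l.Rm then .eq else dz.Js2 b) (R2 l dl) (L3 z dz b)
def R4 (l : Ctl) (dl : Dat) (z : Ctl) (dz : Dat) : Bool :=
  if jedge l z false then hiB (sE l dl z dz false) (R2 l dl) (L3 z dz false)
  else if jedge l z true then hiB (sE l dl z dz true) (R2 l dl) (L3 z dz true)
  else R2 l dl
def L4 (l : Ctl) (dl : Dat) (z : Ctl) (dz : Dat) (b : Bool) : Bool :=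
  if jedge l z b then loB (sE l dl z dz b) (R2 l dl) (L3 z dz b) else L3 z dz b

def dstep (l : Ctl) (dl : Dat) (c : Ctl) (d : Dat) (r : Ctl) (dr : Dat) : Dat where
  reg := reg3 c d
  R := if launchR l c then reg3 c d else R4 l dl c d
  L := fun b => L4 c d r dr b
  Ksa := if c.kd = .ms then .eq else dl.Ksw
  Ksw := s1 d
  Ts := fun b => if c.kd = .ms then .eq else s3 l dl b
  Js0 := d.Js1
  Js1 := fun b => sE l dl c d b
  Js2 := fun b => sI l dl b

/-- value read out of a cell -/
def readout (c : Ctl) (d : Dat) : Bool :=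
  if c.T false then d.L false else if c.T true then d.L true else reg1 c d

/-- kind of cell `x` in blocks of length `k` -/
def kdAt (k x : ℤ) : Kd := if k ∣ x then .ms else if k ∣ x + 1 then .ls else .pl

/-- the states at the sorting time 0 -/
def start (l r : Bool) (c : Ctl) : Ctl :=
  { c with Rp := l, Rm := l, dR := l, Ka := l, WL := r }
def startD (l : Bool) (d : Dat) : Dat := { d with R := if l then d.reg else d.R }

def crun (n k : ℤ) : ℕ → ℤ → Ctl
  | 0 => fun x => if 0 ≤ x ∧ x < n * k then
      start (decide (x = 0)) (decide (x = n * k - 1)) (Ctl.init (kdAt k x)) else Ctl.init .pl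
  | t + 1 => fun x => if 0 ≤ x ∧ x < n * k then
      cstep (crun n k t (x - 1)) (crun n k t x) (crun n k t (x + 1)) else Ctl.init .pl

def drun (n k : ℤ) (w : ℤ → Bool) : ℕ → ℤ → Dat
  | 0 => fun x => if 0 ≤ x ∧ x < n * k then
      startD (decide (x = 0)) (Dat.init (w x)) else Dat.init false
  | t + 1 => fun x => if 0 ≤ x ∧ x < n * k then
      dstep (crun n k t (x - 1)) (drun n k w t (x - 1)) (crun n k t x) (drun n k w t x)
        (crun n k t (x + 1)) (drun n k w t (x + 1)) else Dat.init false

/-! ### Closed forms of the control layer -/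

section Control

variable {n k : ℤ}

theorem crun_succ {t : ℕ} {x : ℤ} (h0 : 0 ≤ x) (h1 : x < n * k) :
    crun n k (t + 1) x = cstep (crun n k t (x - 1)) (crun n k t x) (crun n k t (x + 1)) := by
  rw [crun]; simp [h0, h1]

theorem crun_out {t : ℕ} {x : ℤ} (h : ¬ (0 ≤ x ∧ x < n * k)) : crun n k t x = Ctl.init .pl := by
  cases t <;> simp only [crun, h, if_false]

theorem crun_zero {x : ℤ} (h0 : 0 ≤ x) (h1 : x < n * k) :
    crun n k 0 x = start (decide (x = 0)) (decide (x = n * k - 1)) (Ctl.init (kdAt k x)) := by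
  rw [crun]; simp [h0, h1]

theorem c_kd (t : ℕ) {x : ℤ} (h0 : 0 ≤ x) (h1 : x < n * k) : (crun n k t x).kd = kdAt k x := by
  induction t with
  | zero => rw [crun_zero h0 h1]; rfl
  | succ t ih => rw [crun_succ h0 h1]; exact ih

theorem kd_ms {x : ℤ} : kdAt k x = .ms ↔ k ∣ x := by
  unfold kdAt; split_ifs <;> simp_all

theorem not_both (hk : 2 ≤ k) {x : ℤ} (h : k ∣ x) : ¬ k ∣ x + 1 := by
  intro h'
  have := (Int.dvd_add_right h).1 h'
  have := Int.le_of_dvd one_pos this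
  omega

theorem kd_ls (hk : 2 ≤ k) {x : ℤ} : kdAt k x = .ls ↔ k ∣ x + 1 := by
  have := not_both hk (x := x)
  unfold kdAt; split_ifs <;> simp_all

theorem c_R (t : ℕ) : ∀ {x : ℤ}, x < n * k →
    ((crun n k t x).Rp = true ↔ x ≤ t ∧ t ≤ 2 * x) ∧
    (0 ≤ x → ((crun n k t x).dR = true ↔ 2 * x ≤ t)) := by
  induction t with
  | zero =>
    intro x h1
    by_cases h0 : 0 ≤ x
    · rw [crun_zero h0 h1]; simp [start, Ctl.init]; omega
    · rw [crun_out (by omega)]; simp [Ctl.init]; omega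
  | succ t ih =>
    intro x h1
    by_cases h0 : 0 ≤ x
    · rw [crun_succ h0 h1]
      have a1 := ih (x := x) h1
      have a2 := ih (x := x - 1) (by omega)
      simp only [cstep, launchR, Bool.or_eq_true, Bool.and_eq_true, Bool.not_eq_true',
        ← Bool.not_eq_true, a1.1, a2.1, a1.2 h0]
      push_cast
      omega
    · rw [crun_out (by omega)]; simp [Ctl.init]; omega

theorem c_Rp (t : ℕ) {x : ℤ} (h : x < n * k) :
    (crun n k t x).Rp = true ↔ x ≤ t ∧ t ≤ 2 * x := (c_R t h).1
theorem c_dR (t : ℕ) {x : ℤ} (h0 : 0 ≤ x) (h : x < n * k) :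
    (crun n k t x).dR = true ↔ 2 * x ≤ t := (c_R t h).2 h0

theorem c_launchR (t : ℕ) {x : ℤ} (h0 : 0 ≤ x) (h : x < n * k) :
    launchR (crun n k t (x - 1)) (crun n k t x) = true ↔ (t : ℤ) + 1 = 2 * x := by
  simp only [launchR, Bool.and_eq_true, Bool.not_eq_true',
        ← Bool.not_eq_true, c_Rp t h, c_dR t h0 h, c_Rp t (show x - 1 < n * k by omega)]
  omega

theorem c_Rm (hk : 2 ≤ k) (t : ℕ) : ∀ {x : ℤ}, x < n * k →
    (((crun n k t x).Rm = true ↔ (x ≤ t ∧ t ≤ 2 * x) ∧ k ∣ t - x) ∧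
     ((crun n k t x).Rl = true ↔ (x ≤ t ∧ t ≤ 2 * x) ∧ k ∣ t - x + 1)) := by
  induction t with
  | zero =>
    intro x h1
    by_cases h0 : 0 ≤ x
    · rw [crun_zero h0 h1]; simp [start, Ctl.init]
      constructor
      · constructor
        · rintro rfl; simp
        · omega
      · intro h h'
        have : x = 0 := by omega
        subst this
        intro h''
        have := Int.le_of_dvd one_pos (by simpa using h'')
        omega
    · rw [crun_out (by omega)]; simp [Ctl.init]; omega
  | succ t ih =>
    intro x h1
    by_cases h0 : 0 ≤ x
    · rw [crun_succ h0 h1]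
      have a2 := ih (x := x - 1) (by omega)
      have e : ((t : ℤ) - (x - 1)) = t + 1 - x := by ring
      rw [e] at a2
      simp only [cstep, nRm, Bool.or_eq_true, Bool.and_eq_true, a2.1, a2.2, c_launchR t h0 h1,
        decide_eq_true_eq, c_kd t h0 h1, kd_ms, kd_ls hk]
      push_cast
      by_cases hx : (t : ℤ) + 1 = 2 * x
      · rw [hx, show 2 * x - x = x by ring]
        constructor <;> constructor <;> intro h
        · rcases h with h | h
          · omega
          · exact ⟨by omega, h.2⟩
        · exact Or.inr ⟨rfl, h.2⟩
        · rcases h with h | h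
          · omega
          · exact ⟨by omega, h.2⟩
        · exact Or.inr ⟨rfl, h.2⟩
      · simp only [hx, false_and, or_false]
        constructor <;> constructor <;> rintro ⟨h1, h2⟩ <;> exact ⟨by omega, h2⟩
    · rw [crun_out (by omega)]; simp [Ctl.init]; omega

theorem c_K (hk : 2 ≤ k) (t : ℕ) : ∀ {x : ℤ}, 0 ≤ x → x < n * k →
    (((crun n k t x).Ka = true ↔ (x ≤ t ∧ t ≤ 2 * x) ∧ k ∣ t - 2 * x) ∧
     ((crun n k t x).Kw = true ↔ (x ≤ t ∧ t ≤ 2 * x + 1) ∧ k ∣ t - 2 * x - 1 ∧ ¬ k ∣ x + 1)) := by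
  induction t with
  | zero =>
    intro x h0 h1
    rw [crun_zero h0 h1]; simp [start, Ctl.init]
    constructor
    · constructor
      · rintro rfl; simp
      · omega
    · intro h h' h2
      have : x = 0 := by omega
      subst this
      simp at h2 ⊢
      exact h2
  | succ t ih =>
    intro x h0 h1
    have hRm := (c_Rm hk (t + 1) h1).1
    rw [crun_succ h0 h1] at hRm ⊢
    have a1 := ih h0 h1
    have hRm' : nRm (crun n k t (x - 1)) (crun n k t x) = true ↔ _ := hRm
    simp only [cstep, Bool.and_eq_true, a1.1, Bool.not_eq_true', ← Bool.not_eq_true,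
        decide_eq_true_eq, c_kd t h0 h1, kd_ms, kd_ls hk]
    constructor
    · by_cases hx : k ∣ x
      · rw [if_pos hx, hRm']
        push_cast
        have : k ∣ (t : ℤ) + 1 - x ↔ k ∣ (t : ℤ) + 1 - 2 * x := by
          rw [show (t : ℤ) + 1 - x = (t + 1 - 2 * x) + x by ring]
          exact Int.dvd_add_left hx
        rw [this]
      · have hx0 : x ≠ 0 := by rintro rfl; exact hx (dvd_zero _)
        rw [if_neg hx, (ih (show 0 ≤ x - 1 by omega) (by omega)).2]
        simp only [sub_add_cancel, hx, not_false_eq_true, and_true]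
        push_cast
        rw [show (t : ℤ) - 2 * (x - 1) - 1 = t + 1 - 2 * x by ring]
        constructor <;> rintro ⟨h2, h3⟩ <;> exact ⟨by omega, h3⟩
    · push_cast
      rw [show (t : ℤ) + 1 - 2 * x - 1 = t - 2 * x by ring]
      constructor
      · rintro ⟨⟨h2, h3⟩, h4⟩; exact ⟨by omega, h3, h4⟩
      · rintro ⟨h2, h3, h4⟩
        refine ⟨⟨?_, h3⟩, h4⟩
        by_contra hh
        have : (t : ℤ) = x - 1 := by omega
        rw [this] at h3
        apply h4
        have := (Int.dvd_neg).2 h3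
        rwa [show -(x - 1 - 2 * x) = x + 1 by ring] at this

end Control


set_option linter.unusedVariables false

section Control2

variable {n k : ℤ}

/-- lane of the left-moving word number `β` (from the right) -/
def lane (β : ℤ) (c : Bool) : Prop := β % 2 = 1 ↔ c = true

theorem mul_lt_cancel {A B : ℤ} (hk : 0 < k) (h : A * k < B * k) : A < B :=
  lt_of_mul_lt_mul_right h hk.le

theorem le_of_lin {A B r : ℤ} (hk : 0 < k) (hr : r < k) (h : A * k ≤ B * k + r) : A ≤ B := by
  by_contra hh
  nlinarith [show B + 1 ≤ A by omega]

theorem eucl {a b r s : ℤ} (hk : 0 < k) (hr : 0 ≤ r) (hr' : r < k) (hs : 0 ≤ s) (hs' : s < k)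
    (h : a * k + r = b * k + s) : a = b ∧ r = s := by
  have h1 : a ≤ b := le_of_lin hk (show s - r < k by omega) (by omega)
  have h2 : b ≤ a := le_of_lin hk (show r - s < k by omega) (by omega)
  have : a = b := le_antisymm h1 h2
  subst this
  exact ⟨rfl, by omega⟩

theorem dvd_block {i j : ℤ} (hk : 2 ≤ k) (h0 : 0 ≤ j) (h1 : j < k) : k ∣ i * k + j ↔ j = 0 := by
  rw [Int.dvd_add_right (Dvd.intro_left i rfl)]
  constructor
  · intro h
    by_contra hh
    have := Int.le_of_dvd (by omega) h
    omega
  · rintro rfl; exact dvd_zero _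

theorem dvd_block' {i j : ℤ} (hk : 2 ≤ k) (h0 : 0 ≤ j) (h1 : j < k) :
    k ∣ i * k + j + 1 ↔ j = k - 1 := by
  rw [add_assoc, Int.dvd_add_right (Dvd.intro_left i rfl)]
  constructor
  · intro h
    have := Int.le_of_dvd (by omega) h
    omega
  · rintro rfl; simp

theorem exists_block (hk : 0 < k) {x : ℤ} (h0 : 0 ≤ x) (h1 : x < n * k) :
    ∃ i j, 0 ≤ i ∧ i < n ∧ 0 ≤ j ∧ j < k ∧ x = i * k + j := by
  refine ⟨x / k, x % k, Int.ediv_nonneg h0 hk.le, ?_, Int.emod_nonneg _ hk.ne',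
    Int.emod_lt_of_pos _ hk, ?_⟩
  · exact Int.ediv_lt_of_lt_mul hk h1
  · rw [mul_comm]; exact (Int.mul_ediv_add_emod x k).symm

theorem block_div {i j : ℤ} (hk : 0 < k) (h0 : 0 ≤ j) (h1 : j < k) : (i * k + j) / k = i := by
  rw [add_comm, Int.add_mul_ediv_right _ _ hk.ne', Int.ediv_eq_zero_of_lt h0 h1, zero_add]

theorem block_range {i j : ℤ} (hi : 0 ≤ i) (hin : i < n) (h0 : 0 ≤ j) (h1 : j < k) :
    0 ≤ i * k + j ∧ i * k + j < n * k := by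
  constructor
  · have := mul_nonneg hi (show 0 ≤ k by omega); omega
  · nlinarith [show i + 1 ≤ n by omega]

theorem c_WL (hn : 1 ≤ n) (hk : 2 ≤ k) (t : ℕ) : ∀ {x : ℤ},
    ((crun n k t x).WL = true ↔ x + t = n * k - 1 ∧ n * k - k < x) := by
  have hN : k ≤ n * k := by nlinarith
  induction t with
  | zero =>
    intro x
    by_cases h : 0 ≤ x ∧ x < n * k
    · rw [crun_zero h.1 h.2]; simp [start, Ctl.init]; omega
    · rw [crun_out h]; simp [Ctl.init]; omega
  | succ t ih =>
    intro x
    by_cases h : 0 ≤ x ∧ x < n * k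
    · rw [crun_succ h.1 h.2]
      simp only [cstep, Bool.and_eq_true, ih, Bool.not_eq_true', ← Bool.not_eq_true,
        decide_eq_true_eq, c_kd t h.1 h.2, kd_ms]
      push_cast
      constructor
      · rintro ⟨⟨h1, h2⟩, h3⟩
        refine ⟨by omega, ?_⟩
        by_contra hh
        exact h3 ⟨n - 1, by linarith [show x = n * k - k by omega]⟩
      · rintro ⟨h1, h2⟩
        refine ⟨by omega, ?_⟩
        rintro ⟨m, rfl⟩
        have h3 : n - 1 < m := mul_lt_cancel (k := k) (by omega) (by linarith)
        have h4 : m < n := mul_lt_cancel (k := k) (by omega) (by linarith)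
        omega
    · rw [crun_out h]; simp [Ctl.init]; omega

theorem div_succ (hk : 2 ≤ k) (x : ℤ) : (x + 1) / k = if k ∣ x + 1 then x / k + 1 else x / k := by
  have hk0 : 0 < k := by omega
  have e := Int.mul_ediv_add_emod x k
  have h0 := Int.emod_nonneg x hk0.ne'
  have h1 := Int.emod_lt_of_pos x hk0
  split_ifs with h
  · obtain ⟨m, hm⟩ := h
    rw [hm, Int.mul_ediv_cancel_left _ hk0.ne']
    have : x = (m - 1) * k + (k - 1) := by linarith
    rw [this, block_div hk0 (by omega) (by omega)]; ring
  · have hx : x % k ≠ k - 1 := by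
      intro h2
      exact h ⟨x / k + 1, by linarith⟩
    have : x + 1 = x / k * k + (x % k + 1) := by linarith
    rw [this, block_div hk0 (by omega) (by omega)]

theorem c_S (hn : 1 ≤ n) (hk : 2 ≤ k) (t : ℕ) : ∀ {x : ℤ} {c : Bool}, 0 ≤ x →
    (((crun n k t x).S0 c = true ↔
      t = k - 1 + 2 * (n * k - k - x) ∧ x ≤ n * k - k ∧ lane (n - 1 - x / k) c) ∧
     ((crun n k t x).S1 c = true ↔
      t = k + 2 * (n * k - k - x) ∧ x ≤ n * k - k ∧ lane (n - 1 - x / k) c)) := by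
  have hN : k ≤ n * k := by nlinarith
  induction t with
  | zero =>
    intro x c h0
    by_cases h : 0 ≤ x ∧ x < n * k
    · rw [crun_zero h.1 h.2]; simp [start, Ctl.init]; omega
    · rw [crun_out h]; simp [Ctl.init]; omega
  | succ t ih =>
    intro x c h0
    by_cases h : 0 ≤ x ∧ x < n * k
    · rw [crun_succ h.1 h.2]
      refine ⟨?_, ?_⟩
      swap
      · simp only [cstep, (ih h0).1]
        push_cast
        constructor <;> rintro ⟨h1, h2, h3⟩ <;> exact ⟨by omega, h2, h3⟩
      have hl : x ≤ n * k - k - 1 → ((if (crun n k t (x + 1)).kd = .ms then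
          (crun n k t (x + 1)).S1 (!c) else (crun n k t (x + 1)).S1 c) = true ↔
          t = k + 2 * (n * k - k - (x + 1)) ∧ lane (n - 1 - x / k) c) := by
        intro hx
        simp only [c_kd t (show 0 ≤ x + 1 by omega) (show x + 1 < n * k by omega), kd_ms]
        have := div_succ hk x
        split_ifs with hd
        · rw [if_pos hd] at this
          rw [(ih (by omega)).2, this]
          have : lane (n - 1 - (x / k + 1)) (!c) ↔ lane (n - 1 - x / k) c := by
            unfold lane; cases c <;> simp <;> omega
          rw [this]
          constructor
          · rintro ⟨h1, h2, h3⟩; exact ⟨h1, h3⟩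
          · rintro ⟨h1, h3⟩; exact ⟨h1, by omega, h3⟩
        · rw [if_neg hd] at this
          rw [(ih (by omega)).2, this]
          constructor
          · rintro ⟨h1, h2, h3⟩; exact ⟨h1, h3⟩
          · rintro ⟨h1, h3⟩; exact ⟨h1, by omega, h3⟩
      simp only [cstep, nS0, Bool.or_eq_true, Bool.and_eq_true, Bool.not_eq_true', c_WL hn hk,
        decide_eq_true_eq, c_kd t h.1 h.2, kd_ms]
      push_cast
      by_cases hx : x ≤ n * k - k - 1
      · rw [hl hx]
        constructor
        · rintro (h | ⟨h1, h2⟩)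
          · omega
          · exact ⟨by omega, by omega, h2⟩
        · rintro ⟨h1, h2, h3⟩
          exact Or.inr ⟨by omega, h3⟩
      · have hS : ∀ b, (crun n k t (x + 1)).S1 b = false := by
          intro b
          rw [← Bool.not_eq_true, (ih (by omega)).2]
          omega
        simp only [hS]
        by_cases hx' : x = n * k - k
        · have : x / k = n - 1 := by
            rw [show x = (n - 1) * k + 0 by rw [hx']; ring]
            exact block_div (by omega) le_rfl (by omega)
          rw [this]
          have hd : k ∣ x := ⟨n - 1, by rw [hx']; ring⟩
          have e2 : lane (n - 1 - (n - 1)) c ↔ c = false := by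
            unfold lane; cases c <;> simp
          rw [e2]
          simp only [hd, and_true, ite_self, Bool.false_eq_true, or_false]
          constructor
          · rintro ⟨h1, h2⟩; exact ⟨by omega, by omega, h2⟩
          · rintro ⟨h1, h2, h3⟩; exact ⟨by omega, h3⟩
        · simp only [ite_self, Bool.false_eq_true, or_false]
          constructor
          · rintro ⟨⟨h1, ⟨m, hm⟩⟩, h2⟩
            exfalso
            subst hm
            have h3 : n - 1 < m := mul_lt_cancel (k := k) (by omega) (by
              rw [sub_mul, one_mul, mul_comm m k]; omega)
            have h4 : m < n := mul_lt_cancel (k := k) (by omega) (by linarith)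
            omega
          · rintro ⟨h1, h2, h3⟩; omega
    · rw [crun_out h]; simp [Ctl.init]
      constructor <;> intro h1 h2 <;> omega

/-- `T` token closed form -/
def PT (n k : ℤ) (c : Bool) (i j t : ℤ) : Prop :=
  ∃ β, 0 ≤ β ∧ 2 * β + 2 ≤ n ∧ β + i ≤ n - 1 ∧ lane β c ∧ t + i * k = n * k - 1 + β * k + j

/-- left-moving bit closed form -/
def PL (n k : ℤ) (c : Bool) (x t β j : ℤ) : Prop :=
  0 ≤ β ∧ 2 * β + 2 ≤ n ∧ 0 ≤ j ∧ j < k ∧ lane β c ∧ x + t = n * k - 1 + β * k + 2 * j ∧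
    x < n * k - k - β * k + j

theorem lane_eq {β β' : ℤ} {c : Bool} (h : lane β c) (h' : lane β' c) : (β - β') % 2 = 0 := by
  unfold lane at *
  cases c <;> simp at * <;> omega

/-- decoding of the line is unique within a lane -/
theorem line_unique {β β' j j' : ℤ} {c : Bool} (hk : 2 ≤ k) (h : lane β c) (h' : lane β' c)
    (h0 : 0 ≤ j) (h1 : j < k) (h0' : 0 ≤ j') (h1' : j' < k)
    (e : β * k + 2 * j = β' * k + 2 * j') : β = β' ∧ j = j' := by
  have hl := lane_eq h h'
  have a1 : β < β' + 2 := mul_lt_cancel (k := k) (by omega) (by linarith)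
  have a2 : β' < β + 2 := mul_lt_cancel (k := k) (by omega) (by linarith)
  have : β = β' := by omega
  subst this
  exact ⟨rfl, by omega⟩

structure LInv (n k : ℤ) (t : ℕ) : Prop where
  T : ∀ {i j : ℤ} {c : Bool}, 0 ≤ i → i < n → 0 ≤ j → j < k →
    ((crun n k t (i * k + j)).T c = true ↔ PT n k c i j t)
  Lp : ∀ {x : ℤ} {c : Bool}, 0 ≤ x → ((crun n k t x).Lp c = true ↔ ∃ β j, PL n k c x t β j)
  Lm : ∀ {x : ℤ} {c : Bool}, 0 ≤ x → ((crun n k t x).Lm c = true ↔ ∃ β, PL n k c x t β 0)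

/-- launching closed form -/
theorem LInv.lau {t : ℕ} (h : LInv n k t) (hk : 2 ≤ k) {i j : ℤ} {c : Bool} (hi : 0 ≤ i)
    (hin : i < n) (hj : 0 ≤ j) (hjk : j < k) :
    lau (crun n k t (i * k + j)) c = true ↔
      (n ≤ 2 * i ∧ lane (n - 1 - i) c ∧ t + i * k = n * k - 1 + (n - 1 - i) * k + j) := by
  have hr := block_range (n := n) hi hin hj hjk
  unfold _root_.lau
  simp only [Bool.and_eq_true, Bool.not_eq_true', ← Bool.not_eq_true, h.T hi hin hj hjk, h.Lp hr.1]
  constructor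
  · rintro ⟨⟨β, b0, b1, b2, b3, b4⟩, h2⟩
    have : β = n - 1 - i := by
      by_contra hne
      refine h2 ⟨β, j, b0, b1, hj, hjk, b3, by linarith, ?_⟩
      have := mul_le_mul_of_nonneg_right (show i + β + 1 ≤ n - 1 by omega) (show 0 ≤ k by omega)
      nlinarith
    subst this
    exact ⟨by omega, b3, b4⟩
  · rintro ⟨h1, h2, h3⟩
    refine ⟨⟨n - 1 - i, by omega, by omega, by omega, h2, h3⟩, ?_⟩
    rintro ⟨β, j', b0, b1, b2, b3, b4, b5, b6⟩
    obtain ⟨rfl, rfl⟩ := line_unique hk h2 b4 hj hjk b2 b3 (by linarith)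
    linarith

theorem PL_step (hk : 2 ≤ k) {x t β j : ℤ} {c : Bool} :
    PL n k c x (t + 1) β j ↔ PL n k c (x + 1) t β j ∨
      (0 ≤ β ∧ 2 * β + 2 ≤ n ∧ 0 ≤ j ∧ j < k ∧ lane β c ∧
        x + 1 = (n - 1 - β) * k + j ∧ t + (n - 1 - β) * k = n * k - 1 + β * k + j) := by
  unfold PL
  constructor
  · rintro ⟨b0, b1, b2, b3, b4, b5, b6⟩
    by_cases hx : x + 1 < n * k - k - β * k + j
    · exact Or.inl ⟨b0, b1, b2, b3, b4, by linarith, hx⟩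
    · exact Or.inr ⟨b0, b1, b2, b3, b4, by nlinarith, by nlinarith⟩
  · rintro (⟨b0, b1, b2, b3, b4, b5, b6⟩ | ⟨b0, b1, b2, b3, b4, b5, b6⟩)
    · exact ⟨b0, b1, b2, b3, b4, by linarith, by linarith⟩
    · exact ⟨b0, b1, b2, b3, b4, by linarith, by linarith⟩

theorem linv (hn : 1 ≤ n) (hk : 2 ≤ k) (t : ℕ) : LInv n k t := by
  have hN : k ≤ n * k := by nlinarith
  have hPL0 : ∀ {x c β j}, 0 ≤ x → ¬ PL n k c x 0 β j := by
    rintro x c β j hx ⟨b0, b1, b2, b3, b4, b5, b6⟩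
    have := mul_nonneg b0 (show 0 ≤ k by omega)
    omega
  have hPLout : ∀ {x c β j} {t : ℕ}, n * k ≤ x → ¬ PL n k c x t β j := by
    rintro x c β j t hx ⟨b0, b1, b2, b3, b4, b5, b6⟩
    have := mul_nonneg b0 (show 0 ≤ k by omega)
    omega
  induction t with
  | zero =>
    refine ⟨?_, ?_, ?_⟩
    · intro i j c hi hin hj hjk
      have hr := block_range (n := n) hi hin hj hjk
      rw [crun_zero hr.1 hr.2]
      simp only [start, Ctl.init, Bool.false_eq_true, false_iff]
      rintro ⟨β, b0, b1, b2, b3, b4⟩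
      have := mul_nonneg b0 (show 0 ≤ k by omega)
      have := mul_le_mul_of_nonneg_right (show i + 1 ≤ n by omega) (show 0 ≤ k by omega)
      push_cast at b4
      nlinarith
    · intro x c hx
      by_cases h : 0 ≤ x ∧ x < n * k
      · rw [crun_zero h.1 h.2]
        simp only [start, Ctl.init, Bool.false_eq_true, false_iff]
        rintro ⟨β, j, h⟩
        exact hPL0 hx h
      · rw [crun_out h]
        simp only [Ctl.init, Bool.false_eq_true, false_iff]
        rintro ⟨β, j, h⟩
        exact hPL0 hx h
    · intro x c hx
      by_cases h : 0 ≤ x ∧ x < n * k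
      · rw [crun_zero h.1 h.2]
        simp only [start, Ctl.init, Bool.false_eq_true, false_iff]
        rintro ⟨β, h⟩
        exact hPL0 hx h
      · rw [crun_out h]
        simp only [Ctl.init, Bool.false_eq_true, false_iff]
        rintro ⟨β, h⟩
        exact hPL0 hx h
  | succ t ih =>
    -- launching at x+1
    have hlau : ∀ {x c}, 0 ≤ x → (lau (crun n k t x) c = true ↔
        ∃ β j, 0 ≤ β ∧ 2 * β + 2 ≤ n ∧ 0 ≤ j ∧ j < k ∧ lane β c ∧
        x = (n - 1 - β) * k + j ∧ t + (n - 1 - β) * k = n * k - 1 + β * k + j) := by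
      intro x c hx
      by_cases h : 0 ≤ x ∧ x < n * k
      · obtain ⟨i, j, hi, hin, hj, hjk, rfl⟩ := exists_block (by omega) h.1 h.2
        rw [ih.lau hk hi hin hj hjk]
        constructor
        · rintro ⟨h1, h2, h3⟩
          exact ⟨n - 1 - i, j, by omega, by omega, hj, hjk, h2, by ring, by linarith⟩
        · rintro ⟨β, j', b0, b1, b2, b3, b4, b5, b6⟩
          obtain ⟨rfl, rfl⟩ := eucl (by omega) hj hjk b2 b3 b5
          refine ⟨by omega, by simpa using b4, by linarith⟩
      · rw [crun_out h]
        simp only [lau, Ctl.init, Bool.false_and, Bool.false_eq_true, false_iff]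
        rintro ⟨β, j', b0, b1, b2, b3, b4, b5, b6⟩
        have := mul_nonneg b0 (show 0 ≤ k by omega)
        have : x = n * k - k - β * k + j' := by linarith
        omega
    have hLp : ∀ {x : ℤ} {c : Bool}, 0 ≤ x →
        ((crun n k (t + 1) x).Lp c = true ↔ ∃ β j, PL n k c x (t + 1 : ℕ) β j) := by
      intro x c hx
      by_cases h : 0 ≤ x ∧ x < n * k
      · rw [crun_succ h.1 h.2]
        simp only [cstep, Bool.or_eq_true, hlau (show 0 ≤ x + 1 by omega),
          ih.Lp (show 0 ≤ x + 1 by omega)]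
        push_cast
        simp only [PL_step hk]
        constructor
        · rintro (⟨β, j, h⟩ | ⟨β, j, h⟩)
          · exact ⟨β, j, Or.inr h⟩
          · exact ⟨β, j, Or.inl h⟩
        · rintro ⟨β, j, h | h⟩
          · exact Or.inr ⟨β, j, h⟩
          · exact Or.inl ⟨β, j, h⟩
      · rw [crun_out h]
        simp only [Ctl.init, Bool.false_eq_true, false_iff]
        rintro ⟨β, j, h⟩
        exact hPLout (by omega) h
    have hLm : ∀ {x : ℤ} {c : Bool}, 0 ≤ x →
        ((crun n k (t + 1) x).Lm c = true ↔ ∃ β, PL n k c x (t + 1 : ℕ) β 0) := by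
      intro x c hx
      by_cases h : 0 ≤ x ∧ x < n * k
      · rw [crun_succ h.1 h.2]
        simp only [cstep, nLm, Bool.or_eq_true, Bool.and_eq_true, hlau (show 0 ≤ x + 1 by omega),
          ih.Lm (show 0 ≤ x + 1 by omega), decide_eq_true_eq]
        push_cast
        simp only [PL_step hk]
        constructor
        · rintro (⟨⟨β, j, b0, b1, b2, b3, b4, b5, b6⟩, hms⟩ | ⟨β, h⟩)
          · have hr := block_range (n := n) (i := n - 1 - β) (by omega) (by omega) b2 b3
            rw [b5, c_kd t hr.1 hr.2, kd_ms, dvd_block hk b2 b3] at hms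
            subst hms
            exact ⟨β, Or.inr ⟨b0, b1, b2, b3, b4, b5, b6⟩⟩
          · exact ⟨β, Or.inl h⟩
        · rintro ⟨β, h | h⟩
          · exact Or.inr ⟨β, h⟩
          · refine Or.inl ⟨⟨β, 0, h⟩, ?_⟩
            obtain ⟨b0, b1, b2, b3, b4, b5, b6⟩ := h
            have hr := block_range (n := n) (i := n - 1 - β) (by omega) (by omega) b2 b3
            rw [b5, c_kd t hr.1 hr.2, kd_ms, dvd_block hk b2 b3]
      · rw [crun_out h]
        simp only [Ctl.init, Bool.false_eq_true, false_iff]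
        rintro ⟨β, h⟩
        exact hPLout (by omega) h
    refine ⟨?_, hLp, hLm⟩
    intro i j c hi hin hj hjk
    have hr := block_range (n := n) hi hin hj hjk
    have eLm := hLm (c := c) hr.1
    have eS0 := (c_S hn hk (t + 1) (c := c) hr.1).1
    rw [crun_succ hr.1 hr.2] at eLm eS0 ⊢
    have eLm' : nLm (crun n k t (i * k + j + 1)) c = true ↔ _ := eLm
    have eS0' : nS0 (crun n k t (i * k + j)) (crun n k t (i * k + j + 1)) c = true ↔ _ := eS0
    simp only [cstep, c_kd t hr.1 hr.2, kd_ms, dvd_block hk hj hjk]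
    split_ifs with hj0
    · subst hj0
      simp only [Bool.or_eq_true, Bool.and_eq_true, Bool.not_eq_true', ← Bool.not_eq_true,
        eLm', eS0', c_dR t hr.1 hr.2, block_div (show 0 < k by omega) hj hjk]
      push_cast
      constructor
      · rintro (⟨β, b0, b1, b2, b3, b4, b5, b6⟩ | ⟨⟨h1, h2, h3⟩, h4⟩)
        · refine ⟨β, b0, b1, ?_, b4, by push_cast at b5 ⊢; linarith⟩
          have : i < n - 1 - β := mul_lt_cancel (k := k) (by omega) (by linarith)
          omega
        · have hβ : n - 1 - i < i + 1 := by
            apply mul_lt_cancel (k := k) (by omega)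
            nlinarith
          have hβ : n - 1 - i ≠ i := by
            intro h
            have : n * k = 2 * (i * k) + k := by rw [show n = 2 * i + 1 by omega]; ring
            omega
          exact ⟨n - 1 - i, by omega, by omega, by omega, h3, by push_cast; linarith⟩
      · rintro ⟨β, b0, b1, b2, b3, b4⟩
        push_cast at b4
        by_cases hβ : β + i = n - 1
        · right
          have hi' : i = n - 1 - β := by omega
          subst hi'
          have hbk := mul_le_mul_of_nonneg_right (show 2 * β + 2 ≤ n by omega) (show 0 ≤ k by omega)
          refine ⟨⟨by linarith, ?_, by simpa using b3⟩, by nlinarith⟩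
          have := mul_nonneg b0 (show 0 ≤ k by omega)
          linarith
        · left
          refine ⟨β, b0, b1, by omega, by omega, b3, by push_cast; linarith, ?_⟩
          have := mul_le_mul_of_nonneg_right (show i + β + 1 ≤ n - 1 by omega) (show 0 ≤ k by omega)
          nlinarith
    · rw [show i * k + j - 1 = i * k + (j - 1) by ring, ih.T hi hin (by omega) (by omega)]
      unfold PT
      push_cast
      constructor <;> rintro ⟨β, b0, b1, b2, b3, b4⟩ <;> exact ⟨β, b0, b1, b2, b3, by linarith⟩

end Control2


set_option linter.unusedVariables false

section Control3

variable {n k : ℤ}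

def tL (n k s j : ℤ) : ℤ := n * k - 1 + (n - 1 - 2 * s) * k + j

theorem c_dL (hn : 1 ≤ n) (hk : 2 ≤ k) (t : ℕ) {i j : ℤ} (hi : 0 ≤ i) (hin : i < n) (hj : 0 ≤ j)
    (hjk : j < k) :
    (crun n k t (i * k + j)).dL = true ↔ n ≤ 2 * i ∧ tL n k i j < t := by
  have hr := block_range (n := n) hi hin hj hjk
  induction t with
  | zero =>
    rw [crun_zero hr.1 hr.2]
    simp only [start, Ctl.init, Bool.false_eq_true, false_iff]
    rintro ⟨h1, h2⟩
    have := mul_le_mul_of_nonneg_right (show 1 ≤ 2 * n - 1 - 2 * i by omega) (show 0 ≤ k by omega)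
    unfold tL at h2
    push_cast at h2
    nlinarith
  | succ t ih =>
    rw [crun_succ hr.1 hr.2]
    have h := linv hn hk t
    simp only [cstep, Bool.or_eq_true, ih, h.lau hk hi hin hj hjk]
    have e : ((t : ℤ) + i * k = n * k - 1 + (n - 1 - i) * k + j) ↔ (t : ℤ) = tL n k i j := by
      unfold tL
      constructor <;> intro h <;> linarith
    rw [e]
    have hl : lane (n - 1 - i) false ∨ lane (n - 1 - i) true := by
      unfold lane; simp; omega
    push_cast
    constructor
    · rintro ((⟨h1, h2⟩ | ⟨h1, h2, h3⟩) | ⟨h1, h2, h3⟩) <;> exact ⟨h1, by omega⟩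
    · rintro ⟨h1, h2⟩
      by_cases h3 : (t : ℤ) = tL n k i j
      · rcases hl with h4 | h4
        · exact Or.inl (Or.inr ⟨h1, h4, h3⟩)
        · exact Or.inr ⟨h1, h4, h3⟩
      · exact Or.inl (Or.inl ⟨h1, by omega⟩)

theorem c_real (hn : 1 ≤ n) (hk : 2 ≤ k) (t : ℕ) {i j : ℤ} (hi : 0 ≤ i) (hin : i < n) (hj : 0 ≤ j)
    (hjk : j < k) :
    realC (crun n k t (i * k + j)) = true ↔
      (t : ℤ) < 2 * (i * k + j) ∧ (n ≤ 2 * i → t ≤ tL n k i j) := by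
  have hr := block_range (n := n) hi hin hj hjk
  simp only [realC, Bool.and_eq_true, Bool.not_eq_true', ← Bool.not_eq_true,
    c_dL hn hk t hi hin hj hjk, c_dR t hr.1 hr.2]
  by_cases h : n ≤ 2 * i <;> simp [h]

/-- conditions for a right-mover / left-mover pair -/
def CRL (n a β : ℤ) (c : Bool) : Prop :=
  0 ≤ a ∧ 0 ≤ β ∧ 2 * β + 2 ≤ n ∧ 3 * a < n + β ∧ 3 * β + 2 ≤ n + a ∧ lane β c

def PI (n k : ℤ) (c : Bool) (x t a β j : ℤ) : Prop :=
  CRL n a β c ∧ 0 ≤ j ∧ j < k ∧ t - x = a * k + j ∧ x + t = n * k - 1 + β * k + 2 * j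

def PE (n k : ℤ) (c : Bool) (x t a β j : ℤ) : Prop :=
  CRL n a β c ∧ 0 ≤ j ∧ j < k ∧ t - x + 1 = a * k + j ∧ x + t = n * k - 1 + β * k + 2 * j

def PJ (n k : ℤ) (c : Bool) (x t a β j : ℤ) : Prop :=
  CRL n a β c ∧ 0 ≤ j ∧ j + 1 < k ∧ t - x = a * k + j ∧ x + t = n * k - 1 + β * k + 2 * j + 1

theorem PI.flight {c : Bool} {x t a β j : ℤ} (hk : 2 ≤ k) (h : PI n k c x t a β j) :
    0 ≤ x ∧ x ≤ t ∧ t ≤ 2 * x ∧ PL n k c x t β j ∧ x < n * k := by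
  obtain ⟨⟨c1, c2, c3, c4, c5, c6⟩, h1, h2, h3, h4⟩ := h
  have e1 := mul_le_mul_of_nonneg_right (show 1 ≤ n + β - 3 * a by omega) (show 0 ≤ k by omega)
  have e2 := mul_nonneg (show 0 ≤ n + a - 3 * β - 2 by omega) (show 0 ≤ k by omega)
  have e3 := mul_nonneg c1 (show 0 ≤ k by omega)
  have e4 := mul_nonneg c2 (show 0 ≤ k by omega)
  have f : x < n * k - k - β * k + j := by nlinarith
  refine ⟨by nlinarith, by linarith, by nlinarith, ⟨c2, c3, h1, h2, c6, h4, f⟩, by linarith⟩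

theorem PE.flight {c : Bool} {x t a β j : ℤ} (hk : 2 ≤ k) (h : PE n k c x t a β j) :
    1 ≤ x ∧ x - 1 ≤ t ∧ t ≤ 2 * (x - 1) ∧ x ≤ n * k - k - β * k + j ∧ x < n * k := by
  obtain ⟨⟨c1, c2, c3, c4, c5, c6⟩, h1, h2, h3, h4⟩ := h
  have e1 := mul_le_mul_of_nonneg_right (show 1 ≤ n + β - 3 * a by omega) (show 0 ≤ k by omega)
  have e2 := mul_nonneg (show 0 ≤ n + a - 3 * β - 2 by omega) (show 0 ≤ k by omega)
  have e3 := mul_nonneg c1 (show 0 ≤ k by omega)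
  have e4 := mul_nonneg c2 (show 0 ≤ k by omega)
  have f : x ≤ n * k - k - β * k + j := by nlinarith
  refine ⟨by nlinarith, by linarith, by nlinarith, f, by linarith⟩

/-- the msb/msb meeting inside a cell -/
theorem meetI (hn : 1 ≤ n) (hk : 2 ≤ k) (t : ℕ) {x : ℤ} {c : Bool} (h0 : 0 ≤ x) (h1 : x < n * k) :
    ((crun n k t x).Rm = true ∧ (crun n k t x).Lm c = true) ↔ ∃ a β, PI n k c x t a β 0 := by
  rw [(c_Rm hk t h1).1, (linv hn hk t).Lm h0]
  constructor
  · rintro ⟨⟨⟨h2, h3⟩, ⟨a, h4⟩⟩, β, b0, b1, b2, b3, b4, b5, b6⟩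
    have h4' : (t : ℤ) - x = a * k := by rw [h4, mul_comm]
    refine ⟨a, β, ⟨?_, b0, b1, ?_, ?_, b4⟩, le_rfl, b3, by omega, b5⟩
    · have : -1 < a := mul_lt_cancel (k := k) (by omega) (by omega)
      omega
    · apply mul_lt_cancel (k := k) (by omega)
      nlinarith
    · have : 3 * β + 1 < n + a := by
        apply mul_lt_cancel (k := k) (by omega)
        nlinarith
      omega
  · rintro ⟨a, β, h⟩
    obtain ⟨f1, f2, f3, f4, f5⟩ := h.flight hk
    refine ⟨⟨⟨f2, f3⟩, ⟨a, ?_⟩⟩, β, f4⟩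
    have := h.2.2.2.1
    rw [this]; ring

theorem lmE_iff (hn : 1 ≤ n) (hk : 2 ≤ k) (t : ℕ) {x : ℤ} {c : Bool} (h0 : 0 ≤ x)
    (h1 : x < n * k) : lmE (crun n k t x) c = true ↔
      ∃ β, 0 ≤ β ∧ 2 * β + 2 ≤ n ∧ lane β c ∧ x + t = n * k - 1 + β * k ∧ x ≤ n * k - k - β * k := by
  obtain ⟨i, j, hi, hin, hj, hjk, rfl⟩ := exists_block (by omega) h0 h1
  simp only [lmE, Bool.or_eq_true, Bool.and_eq_true, (linv hn hk t).Lm h0, decide_eq_true_eq,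
    (linv hn hk t).lau hk hi hin hj hjk, c_kd t h0 h1, kd_ms, dvd_block hk hj hjk]
  constructor
  · rintro (⟨β, b0, b1, b2, b3, b4, b5, b6⟩ | ⟨⟨b1, b2, b3⟩, rfl⟩)
    · exact ⟨β, b0, b1, b4, by linarith, by linarith⟩
    · exact ⟨n - 1 - i, by omega, by omega, b2, by linarith, by linarith⟩
  · rintro ⟨β, b0, b1, b2, b3, b4⟩
    by_cases hx : i * k + j < n * k - k - β * k
    · exact Or.inl ⟨β, b0, b1, le_rfl, by omega, b2, by linarith, by linarith⟩
    · right
      have e : i * k + j = (n - 1 - β) * k + 0 := by linarith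
      obtain ⟨rfl, rfl⟩ := eucl (by omega) hj hjk le_rfl (by omega) e
      exact ⟨⟨by omega, by simpa using b2, by linarith⟩, rfl⟩

theorem meetE (hn : 1 ≤ n) (hk : 2 ≤ k) (t : ℕ) {x : ℤ} {c : Bool} (h0 : 0 ≤ x) (h1 : x < n * k) :
    ((crun n k t (x - 1)).Rm = true ∧ lmE (crun n k t x) c = true) ↔
      ∃ a β, PE n k c x t a β 0 := by
  rw [(c_Rm hk t (show x - 1 < n * k by omega)).1, lmE_iff hn hk t h0 h1]
  constructor
  · rintro ⟨⟨⟨h2, h3⟩, ⟨a, h4⟩⟩, β, b0, b1, b4, b5, b6⟩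
    have h4' : (t : ℤ) - (x - 1) = a * k := by rw [h4, mul_comm]
    refine ⟨a, β, ⟨?_, b0, b1, ?_, ?_, b4⟩, le_rfl, by omega, by omega, by omega⟩
    · have : -1 < a := mul_lt_cancel (k := k) (by omega) (by omega)
      omega
    · apply mul_lt_cancel (k := k) (by omega)
      nlinarith
    · have : 3 * β + 1 < n + a := by
        apply mul_lt_cancel (k := k) (by omega)
        nlinarith
      omega
  · rintro ⟨a, β, h⟩
    obtain ⟨f1, f2, f3, f4, f5⟩ := h.flight hk
    obtain ⟨⟨c1, c2, c3, c4, c5, c6⟩, g1, g2, g3, g4⟩ := h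
    refine ⟨⟨⟨f2, f3⟩, ⟨a, by linarith⟩⟩, β, c2, c3, c6, by omega, by omega⟩

structure JInv (n k : ℤ) (t : ℕ) : Prop where
  J0 : ∀ {x : ℤ} {c : Bool}, x < n * k →
    ((crun n k t x).J0 c = true ↔ ∃ a β j, PI n k c x t a β j ∧ 1 ≤ j)
  J1 : ∀ {x : ℤ} {c : Bool}, x < n * k →
    ((crun n k t x).J1 c = true ↔ ∃ a β j, PJ n k c x t a β j)
  J2 : ∀ {x : ℤ} {c : Bool}, x < n * k →
    ((crun n k t x).J2 c = true ↔ ∃ a β j, PE n k c x t a β j ∧ 1 ≤ j)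

theorem JInv.jinc {t : ℕ} (h : JInv n k t) (hn : 1 ≤ n) (hk : 2 ≤ k) {x : ℤ} {c : Bool}
    (h1 : x < n * k) : jinc (crun n k t x) c = true ↔ ∃ a β j, PI n k c x t a β j := by
  by_cases h0 : 0 ≤ x
  · simp only [_root_.jinc, Bool.or_eq_true, Bool.and_eq_true, h.J0 h1, meetI hn hk t h0 h1]
    constructor
    · rintro (⟨a, β, j, h, _⟩ | ⟨a, β, h⟩)
      · exact ⟨a, β, j, h⟩
      · exact ⟨a, β, 0, h⟩
    · rintro ⟨a, β, j, h⟩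
      by_cases hj : 1 ≤ j
      · exact Or.inl ⟨a, β, j, h, hj⟩
      · have : j = 0 := by have := h.2.1; omega
        subst this
        exact Or.inr ⟨a, β, h⟩
  · rw [crun_out (by omega)]
    simp only [_root_.jinc, Ctl.init, Bool.or_false, Bool.and_false, Bool.false_eq_true, false_iff]
    rintro ⟨a, β, j, h⟩
    exact h0 (h.flight hk).1

theorem JInv.jedge {t : ℕ} (h : JInv n k t) (hn : 1 ≤ n) (hk : 2 ≤ k) {x : ℤ} {c : Bool}
    (h0 : 0 ≤ x) (h1 : x < n * k) :
    jedge (crun n k t (x - 1)) (crun n k t x) c = true ↔ ∃ a β j, PE n k c x t a β j := by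
  simp only [_root_.jedge, Bool.or_eq_true, Bool.and_eq_true, h.J2 h1, meetE hn hk t h0 h1]
  constructor
  · rintro (⟨a, β, j, h, _⟩ | ⟨a, β, h⟩)
    · exact ⟨a, β, j, h⟩
    · exact ⟨a, β, 0, h⟩
  · rintro ⟨a, β, j, h⟩
    by_cases hj : 1 ≤ j
    · exact Or.inl ⟨a, β, j, h, hj⟩
    · have : j = 0 := by have := h.2.1; omega
      subst this
      exact Or.inr ⟨a, β, h⟩

theorem jinv (hn : 1 ≤ n) (hk : 2 ≤ k) (t : ℕ) : JInv n k t := by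
  have hN : k ≤ n * k := by nlinarith
  induction t with
  | zero =>
    have key : ∀ (x a j : ℤ), 0 ≤ x → 0 ≤ a → 0 ≤ j → ¬ ((0 : ℤ) - x = a * k + j ∧ (0 < x ∨ 0 < j)) := by
      intro x a j h0 h1 h2 h3
      have := mul_nonneg h1 (show 0 ≤ k by omega)
      omega
    have h : ∀ x c, ((crun n k 0 x).J0 c = false) ∧ ((crun n k 0 x).J1 c = false) ∧
        ((crun n k 0 x).J2 c = false) := by
      intro x c
      by_cases h : 0 ≤ x ∧ x < n * k
      · rw [crun_zero h.1 h.2]; simp [start, Ctl.init]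
      · rw [crun_out h]; simp [Ctl.init]
    refine ⟨?_, ?_, ?_⟩ <;> intro x c hx <;>
      simp only [(h x c).1, (h x c).2.1, (h x c).2.2, Bool.false_eq_true, false_iff]
    · rintro ⟨a, β, j, h1, h2⟩
      have := h1.flight hk
      obtain ⟨⟨c1, c2, c3, c4, c5, c6⟩, g1, g2, g3, g4⟩ := h1
      exact key x a j (by omega) (by omega) g1 ⟨by exact_mod_cast g3, by omega⟩
    · rintro ⟨a, β, j, h1⟩
      obtain ⟨⟨c1, c2, c3, c4, c5, c6⟩, g1, g2, g3, g4⟩ := h1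
      have e3 := mul_nonneg c1 (show 0 ≤ k by omega)
      have e4 := mul_nonneg c2 (show 0 ≤ k by omega)
      push_cast at *
      omega
    · rintro ⟨a, β, j, h1, h2⟩
      have := h1.flight hk
      obtain ⟨⟨c1, c2, c3, c4, c5, c6⟩, g1, g2, g3, g4⟩ := h1
      have e3 := mul_nonneg c1 (show 0 ≤ k by omega)
      push_cast at *
      omega
  | succ t ih =>
    have hRl : ∀ {x a j : ℤ}, x - 1 < n * k → 0 ≤ j → j < k → x - 1 ≤ t → t ≤ 2 * (x - 1) →
        (t : ℤ) - x + 1 = a * k + j → ((crun n k t (x - 1)).Rl = true ↔ j + 1 = k) := by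
      intro x a j hx hj hjk h1 h2 h3
      rw [(c_Rm hk t hx).2, show (t : ℤ) - (x - 1) + 1 = a * k + j + 1 by linarith,
        dvd_block' hk hj hjk]
      omega
    refine ⟨?_, ?_, ?_⟩ <;> intro x c hx <;> by_cases h0 : 0 ≤ x
    · rw [crun_succ h0 hx]
      simp only [cstep, ih.J1 hx]
      push_cast
      constructor
      · rintro ⟨a, β, j, h, g1, g2, g3, g4⟩
        exact ⟨a, β, j + 1, ⟨h, by omega, by omega, by omega, by omega⟩, by omega⟩
      · rintro ⟨a, β, j, ⟨h, g1, g2, g3, g4⟩, g5⟩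
        exact ⟨a, β, j - 1, h, by omega, by omega, by omega, by omega⟩
    · rw [crun_out (by omega)]
      simp only [Ctl.init, Bool.false_eq_true, false_iff]
      rintro ⟨a, β, j, h1, h2⟩
      exact h0 (h1.flight hk).1
    · rw [crun_succ h0 hx]
      simp only [cstep, Bool.and_eq_true, ih.jedge hn hk h0 hx, Bool.not_eq_true',
        ← Bool.not_eq_true]
      push_cast
      constructor
      · rintro ⟨⟨a, β, j, h⟩, h2⟩
        obtain ⟨f1, f2, f3, f4, f5⟩ := h.flight hk
        obtain ⟨h, g1, g2, g3, g4⟩ := h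
        rw [hRl (by omega) g1 g2 f2 f3 g3] at h2
        exact ⟨a, β, j, h, by omega, by omega, by omega, by omega⟩
      · rintro ⟨a, β, j, h, g1, g2, g3, g4⟩
        have h' : PE n k c x t a β j := ⟨h, by omega, by omega, by omega, by omega⟩
        obtain ⟨f1, f2, f3, f4, f5⟩ := h'.flight hk
        refine ⟨⟨a, β, j, h'⟩, ?_⟩
        rw [hRl (by omega) g1 (by omega) f2 f3 h'.2.2.2.1]
        omega
    · rw [crun_out (by omega)]
      simp only [Ctl.init, Bool.false_eq_true, false_iff]
      rintro ⟨a, β, j, h, g1, g2, g3, g4⟩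
      have h' : PE n k c x t a β j :=
        ⟨h, by omega, by omega, by push_cast at *; omega, by push_cast at *; omega⟩
      have := (h'.flight hk).1
      omega
    · rw [crun_succ h0 hx]
      simp only [cstep, Bool.and_eq_true, ih.jinc hn hk (show x - 1 < n * k by omega),
        Bool.not_eq_true', ← Bool.not_eq_true]
      push_cast
      constructor
      · rintro ⟨⟨a, β, j, h⟩, h2⟩
        obtain ⟨f1, f2, f3, f4, f5⟩ := h.flight hk
        obtain ⟨h, g1, g2, g3, g4⟩ := h
        rw [hRl (a := a) (by omega) g1 g2 f2 f3 (by omega)] at h2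
        exact ⟨a, β, j + 1, ⟨h, by omega, by omega, by omega, by omega⟩, by omega⟩
      · rintro ⟨a, β, j, ⟨h, g1, g2, g3, g4⟩, g5⟩
        have h' : PI n k c (x - 1) t a β (j - 1) := ⟨h, by omega, by omega, by omega, by omega⟩
        obtain ⟨f1, f2, f3, f4, f5⟩ := h'.flight hk
        refine ⟨⟨a, β, j - 1, h'⟩, ?_⟩
        rw [hRl (by omega) h'.2.1 h'.2.2.1 f2 f3 (a := a) (by omega)]
        omega
    · rw [crun_out (by omega)]
      simp only [Ctl.init, Bool.false_eq_true, false_iff]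
      rintro ⟨a, β, j, h1, h2⟩
      have := (h1.flight hk).1
      omega

theorem PI_unique (hk : 2 ≤ k) {c c' : Bool} {x t a a' β β' j j' : ℤ} (h : PI n k c x t a β j)
    (h' : PI n k c' x t a' β' j') : c = c' ∧ a = a' ∧ β = β' ∧ j = j' := by
  obtain ⟨⟨c1, c2, c3, c4, c5, c6⟩, h1, h2, h3, h4⟩ := h
  obtain ⟨⟨c1', c2', c3', c4', c5', c6'⟩, h1', h2', h3', h4'⟩ := h'
  obtain ⟨rfl, rfl⟩ := eucl (by omega) h1 h2 h1' h2' (h3.symm.trans h3')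
  have : β = β' := mul_right_cancel₀ (show k ≠ 0 by omega) (by linarith)
  subst this
  refine ⟨?_, rfl, rfl, rfl⟩
  unfold lane at c6 c6'
  cases c <;> cases c' <;> simp_all

theorem PE_unique (hk : 2 ≤ k) {c c' : Bool} {x t a a' β β' j j' : ℤ} (h : PE n k c x t a β j)
    (h' : PE n k c' x t a' β' j') : c = c' ∧ a = a' ∧ β = β' ∧ j = j' := by
  obtain ⟨⟨c1, c2, c3, c4, c5, c6⟩, h1, h2, h3, h4⟩ := h
  obtain ⟨⟨c1', c2', c3', c4', c5', c6'⟩, h1', h2', h3', h4'⟩ := h'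
  obtain ⟨rfl, rfl⟩ := eucl (by omega) h1 h2 h1' h2' (h3.symm.trans h3')
  have : β = β' := mul_right_cancel₀ (show k ≠ 0 by omega) (by linarith)
  subst this
  refine ⟨?_, rfl, rfl, rfl⟩
  unfold lane at c6 c6'
  cases c <;> cases c' <;> simp_all

end Control3


set_option linter.unusedVariables false

section Data

variable {n k : ℤ}

def mRR (n s u : ℤ) : Prop := s + 3 * u + 2 ≤ 2 * n
def mLR (n s u : ℤ) : Prop := 2 * n ≤ 3 * s + u + 1
def mRL (n s u : ℤ) : Prop := 2 * n < s + 3 * u + 2 ∧ 3 * s + u + 1 < 2 * n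

theorem Zb_RR {s u j : ℤ} (h : mRR n s u) : Zb n k j s u = 4 * ((s + u) * k + 2 * j) := by
  unfold Zb mRR at *; rw [if_pos h]; ring

theorem Zb_LR {s u j : ℤ} (h0 : 0 ≤ s) (hu : s < u) (hn : u < n) (h : mLR n s u) :
    Zb n k j s u = 4 * ((2 * n - 1 - s - u) * k - 1 + j) + 2 := by
  unfold Zb mLR at *; rw [if_neg (by omega), if_pos h]; ring

theorem Zb_RL {s u j : ℤ} (h : mRL n s u) :
    Zb n k j s u = 2 * ((2 * n - 1 + s - u) * k) + 6 * j - 1 := by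
  unfold Zb mRL at *; rw [if_neg (by omega), if_neg (by omega)]

theorem Zb_cases {j s u : ℤ} (hj : 0 ≤ j) (hjk : j < k) (h0 : 0 ≤ s) (h : s < u) (hn : u < n) :
    (mRR n s u ∧ ∃ t0, t0 = (s + u) * k + 2 * j ∧ Zb n k j s u = 4 * t0 ∧ 2 * s < n ∧
      2 * (s * k + j) < t0 ∧ t0 < 2 * (u * k + j) ∧ (n ≤ 2 * u → t0 ≤ tL n k u j)) ∨
    (mLR n s u ∧ ∃ t0, t0 = (2 * n - 1 - s - u) * k - 1 + j ∧ Zb n k j s u = 4 * t0 + 2 ∧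
      n ≤ 2 * u ∧ tL n k u j < t0 ∧ t0 < 2 * (s * k + j) ∧ (n ≤ 2 * s → t0 < tL n k s j)) ∨
    (mRL n s u ∧ ∃ t0, t0 = (2 * n - 1 + s - u) * k + 3 * j ∧ Zb n k j s u = 2 * t0 - 1 ∧
      2 * s < n ∧ n ≤ 2 * u ∧ 8 * (s * k + j) + 1 ≤ 2 * t0 - 1 ∧ 4 * tL n k u j + 3 ≤ 2 * t0 - 1) := by
  have hk : 0 < k := by omega
  have key : ∀ {A B : ℤ}, A ≤ B → A * k ≤ B * k := fun h => mul_le_mul_of_nonneg_right h hk.le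
  by_cases h1 : mRR n s u
  · left
    refine ⟨h1, _, rfl, Zb_RR h1, ?_, ?_, ?_, ?_⟩
    · unfold mRR at h1; omega
    · have := key (show s + 1 ≤ u by omega); linarith
    · have := key (show s + 1 ≤ u by omega); linarith
    · intro h2
      have := key (show s + 3 * u + 2 ≤ 2 * n from h1)
      unfold tL; linarith
  · right
    by_cases h2 : mLR n s u
    · left
      refine ⟨h2, _, rfl, Zb_LR h0 h hn h2, ?_, ?_, ?_, ?_⟩
      · unfold mLR at h2; omega
      · have := key (show s + 1 ≤ u by omega); unfold tL; linarith
      · have := key (show 2 * n ≤ 3 * s + u + 1 from h2); linarith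
      · intro h3
        have := key (show s + 1 ≤ u by omega)
        unfold tL; linarith
    · right
      unfold mRR mLR at *
      have hm : mRL n s u := ⟨by omega, by omega⟩
      refine ⟨hm, _, rfl, (Zb_RL hm).trans (by ring), by omega, by omega, ?_, ?_⟩
      · have := key (show 3 * s + u + 2 ≤ 2 * n by omega); linarith
      · have := key (show 2 * n ≤ s + 3 * u + 1 by omega); unfold tL; linarith

def Rest (n k s j t : ℤ) : Prop := t < 2 * (s * k + j) ∧ (n ≤ 2 * s → t ≤ tL n k s j)

theorem rest_cross {s j t τ u : ℤ} (hj : 0 ≤ j) (hjk : j < k) (h : Rest n k s j t)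
    (hc : Cross n k j τ s u) (h1 : 4 * t ≤ τ) (h2 : τ < 4 * t + 4) :
    (0 ≤ u ∧ u < s ∧ τ = 4 * t ∧ mRR n u s ∧ t = (u + s) * k + 2 * j) ∨
    (s < u ∧ u < n ∧ τ = 4 * t + 2 ∧ mLR n s u ∧ t = (2 * n - 1 - s - u) * k - 1 + j ∧
      (n ≤ 2 * s → t < tL n k s j)) ∨
    (τ = 4 * t + 3 ∧ n ≤ 2 * s ∧ t = tL n k s j) := by
  obtain ⟨a1, a2, a3, a4, ⟨c1, c2⟩ | ⟨c1, c2⟩⟩ := hc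
  · obtain ⟨g1, g2⟩ := h
    rcases Zb_cases hj hjk a1 c1 a4 with ⟨m, t0, e1, e2, e3, e4, e5, e6⟩ |
      ⟨m, t0, e1, e2, e3, e4, e5, e6⟩ | ⟨m, t0, e1, e2, e3, e4, e5, e6⟩
    · omega
    · refine Or.inr (Or.inl ⟨c1, a4, by omega, m, by omega, by omega⟩)
    · omega
  · obtain ⟨g1, g2⟩ := h
    rcases Zb_cases hj hjk a3 c1 a2 with ⟨m, t0, e1, e2, e3, e4, e5, e6⟩ |
      ⟨m, t0, e1, e2, e3, e4, e5, e6⟩ | ⟨m, t0, e1, e2, e3, e4, e5, e6⟩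
    · exact Or.inl ⟨a3, c1, by omega, m, by omega⟩
    · have := g2 e3; omega
    · have := g2 e4
      exact Or.inr (Or.inr ⟨by omega, e4, by omega⟩)

theorem R_cross {s j t τ u : ℤ} (hj : 0 ≤ j) (hjk : j < k) (hs : 2 * s < n)
    (h : 2 * (s * k + j) ≤ t)
    (hc : Cross n k j τ s u) (h1 : 4 * t ≤ τ) (h2 : τ < 4 * t + 4) : s < u ∧ u < n ∧
    ((τ = 4 * t ∧ mRR n s u ∧ t = (s + u) * k + 2 * j) ∨
     (mRL n s u ∧ τ = 2 * ((2 * n - 1 + s - u) * k) + 6 * j - 1)) := by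
  obtain ⟨a1, a2, a3, a4, ⟨c1, c2⟩ | ⟨c1, c2⟩⟩ := hc
  · rcases Zb_cases hj hjk a1 c1 a4 with ⟨m, t0, e1, e2, e3, e4, e5, e6⟩ |
      ⟨m, t0, e1, e2, e3, e4, e5, e6⟩ | ⟨m, t0, e1, e2, e3, e4, e5, e6⟩
    · exact ⟨c1, a4, Or.inl ⟨by omega, m, by omega⟩⟩
    · omega
    · exact ⟨c1, a4, Or.inr ⟨m, by linarith⟩⟩
  · rcases Zb_cases hj hjk a3 c1 a2 with ⟨m, t0, e1, e2, e3, e4, e5, e6⟩ |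
      ⟨m, t0, e1, e2, e3, e4, e5, e6⟩ | ⟨m, t0, e1, e2, e3, e4, e5, e6⟩
    · omega
    · omega
    · omega

theorem L_cross {s j t τ u : ℤ} (hj : 0 ≤ j) (hjk : j < k) (hs : n ≤ 2 * s)
    (h : tL n k s j < t ∨ (tL n k s j = t ∧ 4 * t + 3 ≤ τ))
    (hc : Cross n k j τ s u) (h1 : 4 * t ≤ τ) (h2 : τ < 4 * t + 4) : 0 ≤ u ∧ u < s ∧
    ((τ = 4 * t + 2 ∧ mLR n u s ∧ t = (2 * n - 1 - u - s) * k - 1 + j) ∨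
     (mRL n u s ∧ τ = 2 * ((2 * n - 1 + u - s) * k) + 6 * j - 1)) := by
  obtain ⟨a1, a2, a3, a4, ⟨c1, c2⟩ | ⟨c1, c2⟩⟩ := hc
  · rcases Zb_cases hj hjk a1 c1 a4 with ⟨m, t0, e1, e2, e3, e4, e5, e6⟩ |
      ⟨m, t0, e1, e2, e3, e4, e5, e6⟩ | ⟨m, t0, e1, e2, e3, e4, e5, e6⟩
    · omega
    · have := e6 hs; omega
    · omega
  · rcases Zb_cases hj hjk a3 c1 a2 with ⟨m, t0, e1, e2, e3, e4, e5, e6⟩ |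
      ⟨m, t0, e1, e2, e3, e4, e5, e6⟩ | ⟨m, t0, e1, e2, e3, e4, e5, e6⟩
    · have := e6 hs; omega
    · exact ⟨a3, c1, Or.inl ⟨by omega, m, by omega⟩⟩
    · exact ⟨a3, c1, Or.inr ⟨m, by linarith⟩⟩

variable {v : ℤ → ℕ}

theorem pair_step {s u j τ : ℤ} (hj : 0 ≤ j) (hjk : j < k) (h0 : 0 ≤ s) (h : s < u) (hn : u < n)
    (hτ : Zb n k j s u = τ) {o : Ordering} {A B : Bool}
    (ho : o = pst k (Pre n v s u s) (Pre n v s u u) j)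
    (hA : A = bt k (WW n k v j τ s) j) (hB : B = bt k (WW n k v j τ u) j) :
    hiB (updO o A B) A B = bt k (WW n k v j (τ + 1) s) j ∧
    loB (updO o A B) A B = bt k (WW n k v j (τ + 1) u) j ∧
    updO o A B = pst k (Pre n v s u s) (Pre n v s u u) (j + 1) := by
  subst hτ
  rw [(WW_pre hj hjk h0 h hn).1] at hA
  rw [(WW_pre hj hjk h0 h hn).2] at hB
  rw [(WW_cross hj hjk h0 h hn).1, (WW_cross hj hjk h0 h hn).2, (bt_max_min hj hjk).1,
    (bt_max_min hj hjk).2]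
  have e : updO o A B = pst k (Pre n v s u s) (Pre n v s u u) (j + 1) := by
    rw [pst_succ hj hjk, ho, hA, hB]
  rw [e, hA, hB]
  exact ⟨rfl, rfl, rfl⟩

theorem WW_one {s j τ τ' : ℤ} (hj : 0 ≤ j) (hjk : j < k) (e : τ' = τ + 1)
    (h : ∀ u, ¬ Cross n k j τ s u) : WW n k v j τ' s = WW n k v j τ s := by
  subst e
  apply WW_const hj hjk (by omega)
  intro σ u h1 h2
  rw [show σ = τ by omega]
  exact h u

end Data


set_option linter.unusedVariables false

section Data2

variable {n k : ℤ} {v : ℤ → ℕ} {w : ℤ → Bool}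

theorem drun_succ {t : ℕ} {x : ℤ} (h0 : 0 ≤ x) (h1 : x < n * k) :
    drun n k w (t + 1) x = dstep (crun n k t (x - 1)) (drun n k w t (x - 1)) (crun n k t x)
      (drun n k w t x) (crun n k t (x + 1)) (drun n k w t (x + 1)) := by
  rw [drun]; simp [h0, h1]

theorem drun_zero {x : ℤ} (h0 : 0 ≤ x) (h1 : x < n * k) :
    drun n k w 0 x = startD (decide (x = 0)) (Dat.init (w x)) := by
  rw [drun]; simp [h0, h1]

structure DInv (n k : ℤ) (v : ℤ → ℕ) (w : ℤ → Bool) (t : ℕ) : Prop where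
  reg : ∀ {s j : ℤ}, 0 ≤ s → s < n → 0 ≤ j → j < k → Rest n k s j t →
    (drun n k w t (s * k + j)).reg = bt k (WW n k v j (4 * t) s) j
  R : ∀ {x a j : ℤ}, 0 ≤ x → x < n * k → 0 ≤ a → 2 * a < n → 0 ≤ j → j < k →
    (t : ℤ) - x = a * k + j → t ≤ 2 * x → (drun n k w t x).R = bt k (WW n k v j (4 * t) a) j
  L : ∀ {x β j : ℤ} {c : Bool}, 0 ≤ x → PL n k c x t β j →
    (drun n k w t x).L c = bt k (WW n k v j (4 * t) (n - 1 - β)) j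
  Ksa : ∀ {a s j : ℤ}, 0 ≤ a → a < s → s < n → 0 ≤ j → j < k → mRR n a s →
    (t : ℤ) = (a + s) * k + 2 * j →
    (drun n k w t (s * k + j)).Ksa = pst k (Pre n v a s a) (Pre n v a s s) j
  Ksw : ∀ {a s j : ℤ}, 0 ≤ a → a < s → s < n → 0 ≤ j → j < k → mRR n a s →
    (t : ℤ) = (a + s) * k + 2 * j + 1 →
    (drun n k w t (s * k + j)).Ksw = pst k (Pre n v a s a) (Pre n v a s s) (j + 1)
  Ts : ∀ {s b j : ℤ} {c : Bool}, 0 ≤ s → s < b → b < n → 0 ≤ j → j < k → mLR n s b →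
    lane (n - 1 - b) c → (t : ℤ) = (2 * n - 1 - s - b) * k - 1 + j →
    (drun n k w t (s * k + j)).Ts c = pst k (Pre n v s b s) (Pre n v s b b) j
  Js0 : ∀ {x a β j : ℤ} {c : Bool}, x < n * k → PI n k c x t a β j → 1 ≤ j →
    (drun n k w t x).Js0 c = pst k (Pre n v a (n - 1 - β) a) (Pre n v a (n - 1 - β) (n - 1 - β)) j
  Js1 : ∀ {x a β j : ℤ} {c : Bool}, x < n * k → PJ n k c x t a β j →
    (drun n k w t x).Js1 c =
      pst k (Pre n v a (n - 1 - β) a) (Pre n v a (n - 1 - β) (n - 1 - β)) (j + 1)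
  Js2 : ∀ {x a β j : ℤ} {c : Bool}, x < n * k → PE n k c x t a β j → 1 ≤ j →
    (drun n k w t x).Js2 c = pst k (Pre n v a (n - 1 - β) a) (Pre n v a (n - 1 - β) (n - 1 - β)) j

theorem CRL.facts {a β : ℤ} {c : Bool} (h : CRL n a β c) :
    0 ≤ a ∧ 2 * a < n ∧ a < n - 1 - β ∧ n - 1 - β < n ∧ mRL n a (n - 1 - β) ∧
    n ≤ 2 * (n - 1 - β) := by
  obtain ⟨c1, c2, c3, c4, c5, c6⟩ := h
  refine ⟨c1, by omega, by omega, by omega, ⟨by omega, by omega⟩, by omega⟩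

theorem CRL.of {a u : ℤ} (ha : 0 ≤ a) (hu : u < n) (hau : a < u) (h : mRL n a u) :
    ∃ c, CRL n a (n - 1 - u) c := by
  obtain ⟨h1, h2⟩ := h
  refine ⟨decide ((n - 1 - u) % 2 = 1), ha, by omega, by omega, by omega, by omega, ?_⟩
  unfold lane; simp

/-- `Ka` at a real cell: decoding -/
theorem Ka_dec (hn : 1 ≤ n) (hk : 2 ≤ k) (t : ℕ) {s j : ℤ} (hs : 0 ≤ s) (hsn : s < n)
    (hj : 0 ≤ j) (hjk : j < k) :
    (crun n k t (s * k + j)).Ka = true ↔ ∃ a, 0 ≤ a ∧ a ≤ s ∧ (t : ℤ) = (a + s) * k + 2 * j := by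
  have hr := block_range (n := n) hs hsn hj hjk
  rw [(c_K hk t hr.1 hr.2).1]
  constructor
  · rintro ⟨⟨h1, h2⟩, ⟨m, h3⟩⟩
    refine ⟨m + s, ?_, ?_, by linarith⟩
    · have : -1 < m + s := mul_lt_cancel (k := k) (by omega) (by nlinarith)
      omega
    · have : m + s ≤ s := le_of_lin (k := k) (r := 0) (by omega) (by omega) (by nlinarith)
      omega
  · rintro ⟨a, h1, h2, h3⟩
    have e1 := mul_nonneg h1 (show 0 ≤ k by omega)
    have e2 := mul_le_mul_of_nonneg_right h2 (show 0 ≤ k by omega)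
    exact ⟨⟨by linarith, by linarith⟩, ⟨a - s, by linarith⟩⟩

theorem rest_RR {a s j t : ℤ} (hk : 2 ≤ k) (hj : 0 ≤ j) (hjk : j < k) (ha : 0 ≤ a) (has : a ≤ s)
    (ht : t = (a + s) * k + 2 * j) (h : Rest n k s j t) (hsn : s < n) : a < s ∧ mRR n a s := by
  obtain ⟨h1, h2⟩ := h
  subst ht
  have h3 : a < s := mul_lt_cancel (k := k) (by omega) (by linarith)
  refine ⟨h3, ?_⟩
  unfold mRR
  by_cases hs : n ≤ 2 * s
  · have h4 := h2 hs
    unfold tL at h4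
    have : a + 3 * s + 1 < 2 * n := mul_lt_cancel (k := k) (by omega) (by linarith)
    omega
  · omega

theorem RR_rest {a s j t : ℤ} (hj : 0 ≤ j) (hjk : j < k) (ha : 0 ≤ a) (has : a < s) (hsn : s < n)
    (ht : t = (a + s) * k + 2 * j) (h : mRR n a s) : Rest n k s j t ∧ 2 * a < n := by
  rcases Zb_cases hj hjk ha has hsn with ⟨m, t0, e1, e2, e3, e4, e5, e6⟩ |
      ⟨m, t0, e1, e2, e3, e4, e5, e6⟩ | ⟨m, t0, e1, e2, e3, e4, e5, e6⟩
  · rw [← e1] at ht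
    subst ht
    exact ⟨⟨e5, e6⟩, e3⟩
  · unfold mRR mLR at *; omega
  · unfold mRR mRL at *; omega

theorem LR_rest {s b j t : ℤ} (hj : 0 ≤ j) (hjk : j < k) (ha : 0 ≤ s) (has : s < b) (hsn : b < n)
    (ht : t = (2 * n - 1 - s - b) * k - 1 + j) (h : mLR n s b) :
    Rest n k s j t ∧ n ≤ 2 * b ∧ tL n k b j < t := by
  rcases Zb_cases hj hjk ha has hsn with ⟨m, t0, e1, e2, e3, e4, e5, e6⟩ |
      ⟨m, t0, e1, e2, e3, e4, e5, e6⟩ | ⟨m, t0, e1, e2, e3, e4, e5, e6⟩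
  · unfold mRR mLR at *; omega
  · rw [← e1] at ht
    subst ht
    exact ⟨⟨e5, fun h => (e6 h).le⟩, e3, e4⟩
  · unfold mLR mRL at *; omega

theorem rest_LR {s b j t : ℤ} (hk : 2 ≤ k) (hj : 0 ≤ j) (hjk : j < k)
    (ht : t = (2 * n - 1 - s - b) * k - 1 + j) (h : Rest n k s j t) : mLR n s b := by
  obtain ⟨h1, h2⟩ := h
  subst ht
  have : 2 * n - 1 < 3 * s + b + 1 := mul_lt_cancel (k := k) (by omega) (by linarith)
  unfold mLR; omega

theorem PL.fl {c : Bool} {x t β j : ℤ} (h : PL n k c x t β j) :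
    n ≤ 2 * (n - 1 - β) ∧ tL n k (n - 1 - β) j < t ∧ 0 ≤ n - 1 - β ∧ n - 1 - β < n := by
  obtain ⟨b0, b1, b2, b3, b4, b5, b6⟩ := h
  refine ⟨by omega, ?_, by omega, by omega⟩
  unfold tL; linarith

section Sub

variable {t : ℕ} (D : DInv n k v w t) (hn : 1 ≤ n) (hk : 2 ≤ k)
include D hn hk

theorem S1_pair {a s j : ℤ} (ha : 0 ≤ a) (has : a < s) (hsn : s < n) (hj : 0 ≤ j) (hjk : j < k)
    (hm : mRR n a s) (ht : (t : ℤ) = (a + s) * k + 2 * j) :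
    hiB (s1 (drun n k w t (s * k + j))) (drun n k w t (s * k + j)).R (drun n k w t (s * k + j)).reg
      = bt k (WW n k v j (4 * t + 1) a) j ∧
    loB (s1 (drun n k w t (s * k + j))) (drun n k w t (s * k + j)).R (drun n k w t (s * k + j)).reg
      = bt k (WW n k v j (4 * t + 1) s) j ∧
    s1 (drun n k w t (s * k + j)) = pst k (Pre n v a s a) (Pre n v a s s) (j + 1) := by
  have hr := block_range (n := n) (by omega) hsn hj hjk
  obtain ⟨f1, f2⟩ := RR_rest hj hjk ha has hsn ht hm
  have hZ : Zb n k j a s = 4 * t := by rw [Zb_RR hm, ht]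
  unfold s1
  exact pair_step hj hjk ha has hsn hZ (D.Ksa ha has hsn hj hjk hm ht)
    (D.R hr.1 hr.2 ha f2 hj hjk (by rw [ht]; ring) (by have := f1.1; omega))
    (D.reg (by omega) hsn hj hjk f1)

theorem S1_reg {s j : ℤ} (hs : 0 ≤ s) (hsn : s < n) (hj : 0 ≤ j) (hjk : j < k)
    (hR : Rest n k s j t) :
    reg1 (crun n k t (s * k + j)) (drun n k w t (s * k + j)) = bt k (WW n k v j (4 * t + 1) s) j := by
  unfold reg1
  rw [if_pos ((c_real hn hk t hs hsn hj hjk).2 hR)]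
  split_ifs with hK
  · obtain ⟨a, h1, h2, h3⟩ := (Ka_dec hn hk t hs hsn hj hjk).1 hK
    obtain ⟨h4, h5⟩ := rest_RR hk hj hjk h1 h2 h3 hR hsn
    exact (S1_pair D hn hk h1 h4 hsn hj hjk h5 h3).2.1
  · rw [D.reg hs hsn hj hjk hR, WW_one hj hjk rfl]
    intro u hc
    rcases rest_cross hj hjk hR hc (by omega) (by omega) with h | h | h
    · exact hK ((Ka_dec hn hk t hs hsn hj hjk).2 ⟨u, h.1, h.2.1.le, h.2.2.2.2⟩)
    · omega
    · omega

theorem S1_R {x a j : ℤ} (h0 : 0 ≤ x) (hx : x < n * k) (ha : 0 ≤ a) (han : 2 * a < n)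
    (hj : 0 ≤ j) (hjk : j < k) (ht : (t : ℤ) - x = a * k + j) (h2 : t ≤ 2 * x) :
    R1 (crun n k t x) (drun n k w t x) = bt k (WW n k v j (4 * t + 1) a) j := by
  obtain ⟨s, j', hs, hsn, hj', hjk', rfl⟩ := exists_block (by omega) h0 hx
  have hRF : 2 * (a * k + j) ≤ t := by omega
  unfold R1
  split_ifs with hK
  · rw [Bool.and_eq_true, Ka_dec hn hk t hs hsn hj' hjk', c_real hn hk t hs hsn hj' hjk'] at hK
    obtain ⟨⟨a', h1, h3, h4⟩, hR⟩ := hK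
    obtain ⟨h5, h6⟩ := rest_RR hk hj' hjk' h1 h3 h4 hR hsn
    obtain ⟨rfl, rfl⟩ := eucl (k := k) (by omega) hj hjk hj' hjk' (a := a) (b := a') (by linarith)
    exact (S1_pair D hn hk h1 h5 hsn hj hjk h6 h4).1
  · rw [D.R h0 hx ha han hj hjk ht h2, WW_one hj hjk rfl]
    intro u hc
    obtain ⟨g1, g2, g3 | g3⟩ := R_cross hj hjk han hRF hc (by omega) (by omega)
    · obtain ⟨g3, g4, g5⟩ := g3
      have hu := RR_rest hj hjk ha g1 g2 g5 g4
      obtain ⟨rfl, rfl⟩ := eucl (k := k) (by omega) hj hjk hj' hjk' (a := u) (b := s) (by linarith)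
      apply hK
      rw [Bool.and_eq_true]
      exact ⟨(Ka_dec hn hk t hs hsn hj hjk).2 ⟨a, ha, g1.le, g5⟩,
        (c_real hn hk t hs hsn hj hjk).2 hu.1⟩
    · omega

end Sub
end Data2


set_option linter.unusedVariables false
set_option linter.unusedSectionVars false

section Data3

variable {n k : ℤ} {v : ℤ → ℕ} {w : ℤ → Bool}

theorem pst_Pre_zero (hv : ∀ s, v s < 2 ^ k.toNat) (a b s u : ℤ) :
    pst k (Pre n v a b s) (Pre n v a b u) 0 = .eq :=
  pst_zero (VV_lt hv _ _) (VV_lt hv _ _)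

variable {t : ℕ} (D : DInv n k v w t) (hn : 1 ≤ n) (hk : 2 ≤ k) (hv : ∀ s, v s < 2 ^ k.toNat)
include D hn hk hv

theorem S1_L {x β j : ℤ} {c : Bool} (h0 : 0 ≤ x) (h : PL n k c x t β j) :
    (drun n k w t x).L c = bt k (WW n k v j (4 * t + 1) (n - 1 - β)) j := by
  rw [D.L h0 h, WW_one h.2.2.1 h.2.2.2.1 rfl]
  intro u hc
  obtain ⟨f1, f2, f3, f4⟩ := h.fl
  obtain ⟨g1, g2, g3 | g3⟩ :=
    L_cross h.2.2.1 h.2.2.2.1 f1 (Or.inl f2) hc (by omega) (by omega) <;> omega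

theorem S2_pair {x a β j : ℤ} {c : Bool} (h1 : x < n * k) (h : PI n k c x t a β j) :
    hiB (sI (crun n k t x) (drun n k w t x) c) (R1 (crun n k t x) (drun n k w t x))
      ((drun n k w t x).L c) = bt k (WW n k v j (4 * t + 2) a) j ∧
    loB (sI (crun n k t x) (drun n k w t x) c) (R1 (crun n k t x) (drun n k w t x))
      ((drun n k w t x).L c) = bt k (WW n k v j (4 * t + 2) (n - 1 - β)) j ∧
    sI (crun n k t x) (drun n k w t x) c =
      pst k (Pre n v a (n - 1 - β) a) (Pre n v a (n - 1 - β) (n - 1 - β)) (j + 1) := by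
  obtain ⟨f1, f2, f3, f4, f5⟩ := h.flight hk
  have h' := h
  obtain ⟨hC, g1, g2, g3, g4⟩ := h
  obtain ⟨e1, e2, e3, e4, e5, e6⟩ := hC.facts
  have hZ : Zb n k j a (n - 1 - β) = 4 * t + 1 := by rw [Zb_RL e5]; linarith
  unfold sI
  rw [show 4 * (t : ℤ) + 2 = 4 * t + 1 + 1 by ring]
  refine pair_step g1 g2 e1 e3 e4 hZ ?_ (S1_R D hn hk f1 h1 e1 e2 g1 g2 g3 f3)
    (S1_L D hn hk hv f1 f4)
  have hRm : (crun n k t x).Rm = true ↔ j = 0 := by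
    rw [(c_Rm hk t h1).1, g3, dvd_block hk g1 g2]
    omega
  simp only [hRm]
  split_ifs with hj
  · subst hj; rw [pst_Pre_zero hv]
  · exact D.Js0 h1 h' (by omega)

theorem S2_R {x a j : ℤ} (h0 : 0 ≤ x) (hx : x < n * k) (ha : 0 ≤ a) (han : 2 * a < n)
    (hj : 0 ≤ j) (hjk : j < k) (ht : (t : ℤ) - x = a * k + j) (h2 : t ≤ 2 * x) :
    R2 (crun n k t x) (drun n k w t x) = bt k (WW n k v j (4 * t + 2) a) j := by
  have hRF : 2 * (a * k + j) ≤ t := by omega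
  have J := jinv hn hk t
  have key : ∀ c, jinc (crun n k t x) c = true →
      hiB (sI (crun n k t x) (drun n k w t x) c) (R1 (crun n k t x) (drun n k w t x))
      ((drun n k w t x).L c) = bt k (WW n k v j (4 * t + 2) a) j := by
    intro c hc
    rw [J.jinc hn hk hx] at hc
    obtain ⟨a', β, j', h⟩ := hc
    have := (S2_pair D hn hk hv hx h).1
    obtain ⟨rfl, rfl⟩ := eucl (k := k) (by omega) hj hjk h.2.1 h.2.2.1 (a := a) (b := a')
      (ht.symm.trans h.2.2.2.1)
    exact this
  unfold R2
  split_ifs with h1 h3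
  · exact key _ h1
  · exact key _ h3
  · rw [S1_R D hn hk h0 hx ha han hj hjk ht h2,
      WW_one (τ' := 4 * t + 2) (τ := 4 * t + 1) hj hjk (by ring)]
    intro u hc
    obtain ⟨g1, g2, g3 | ⟨g3, g4⟩⟩ := R_cross hj hjk han hRF hc (by omega) (by omega)
    · omega
    · obtain ⟨c, hC⟩ := CRL.of ha g2 g1 g3
      have : jinc (crun n k t x) c = true := by
        rw [J.jinc hn hk hx]
        exact ⟨a, n - 1 - u, j, hC, hj, hjk, ht, by linarith⟩
      cases c
      · exact h1 this
      · exact h3 this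

theorem S2_L {x β j : ℤ} {c : Bool} (h0 : 0 ≤ x) (h : PL n k c x t β j) :
    L2 (crun n k t x) (drun n k w t x) c = bt k (WW n k v j (4 * t + 2) (n - 1 - β)) j := by
  have J := jinv hn hk t
  have hP := h
  obtain ⟨f1, f2, f3, f4⟩ := h.fl
  obtain ⟨b0, b1, b2, b3, b4, b5, b6⟩ := h
  have hx : x < n * k := by
    have := mul_nonneg b0 (show 0 ≤ k by omega)
    omega
  unfold L2
  split_ifs with hi
  · rw [J.jinc hn hk hx] at hi
    obtain ⟨a', β', j', h⟩ := hi
    have := (S2_pair D hn hk hv hx h).2.1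
    obtain ⟨rfl, rfl⟩ := line_unique hk b4 h.1.2.2.2.2.2 b2 b3 h.2.1 h.2.2.1
      (by have := h.2.2.2.2; linarith)
    exact this
  · rw [S1_L D hn hk hv h0 hP, WW_one (τ' := 4 * t + 2) (τ := 4 * t + 1) b2 b3 (by ring)]
    intro u hc
    obtain ⟨g1, g2, g3 | ⟨g3, g4⟩⟩ := L_cross b2 b3 f1 (Or.inl f2) hc (by omega) (by omega)
    · omega
    · obtain ⟨c', hC⟩ := CRL.of g1 (by omega) g2 g3
      have hb : n - 1 - (n - 1 - β) = β := by ring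
      rw [hb] at hC
      have : c' = c := by
        have := hC.2.2.2.2.2
        unfold lane at this b4
        cases c <;> cases c' <;> simp_all
      subst this
      apply hi
      rw [J.jinc hn hk hx]
      exact ⟨u, β, j, hC, b2, b3, by linarith, b5⟩

theorem S2_reg {s j : ℤ} (hs : 0 ≤ s) (hsn : s < n) (hj : 0 ≤ j) (hjk : j < k)
    (hR : Rest n k s j t) :
    reg1 (crun n k t (s * k + j)) (drun n k w t (s * k + j)) = bt k (WW n k v j (4 * t + 2) s) j := by
  rw [S1_reg D hn hk hs hsn hj hjk hR,
      WW_one (τ' := 4 * t + 2) (τ := 4 * t + 1) hj hjk (by ring)]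
  intro u hc
  rcases rest_cross hj hjk hR hc (by omega) (by omega) with h | h | h <;> omega

/-- token and left-mover at a cell -/
theorem TL_dec {s j : ℤ} {c : Bool} (hs : 0 ≤ s) (hsn : s < n) (hj : 0 ≤ j) (hjk : j < k)
    (hT : (crun n k t (s * k + j)).T c = true) (hL : (crun n k t (s * k + j)).Lp c = true) :
    ∃ b, s < b ∧ b < n ∧ lane (n - 1 - b) c ∧ (t : ℤ) = (2 * n - 1 - s - b) * k - 1 + j ∧
      PL n k c (s * k + j) t (n - 1 - b) j := by
  have hr := block_range (n := n) hs hsn hj hjk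
  rw [(linv hn hk t).T hs hsn hj hjk] at hT
  rw [(linv hn hk t).Lp hr.1] at hL
  obtain ⟨β, b0, b1, b2, b3, b4⟩ := hT
  obtain ⟨β', j', h⟩ := hL
  have h' := h
  obtain ⟨d0, d1, d2, d3, d4, d5, d6⟩ := h
  obtain ⟨rfl, rfl⟩ := line_unique hk b3 d4 hj hjk d2 d3 (by linarith)
  have : s < n - 1 - β := mul_lt_cancel (k := k) (by omega) (by linarith)
  refine ⟨n - 1 - β, this, by omega, ?_, by linarith, ?_⟩
  · rwa [show n - 1 - (n - 1 - β) = β by ring]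
  · rwa [show n - 1 - (n - 1 - β) = β by ring]

theorem TL_cod {s b j : ℤ} {c : Bool} (hs : 0 ≤ s) (hsb : s < b) (hb : b < n) (hj : 0 ≤ j)
    (hjk : j < k) (hl : lane (n - 1 - b) c) (hnb : n ≤ 2 * b)
    (ht : (t : ℤ) = (2 * n - 1 - s - b) * k - 1 + j) :
    (crun n k t (s * k + j)).T c = true ∧ PL n k c (s * k + j) t (n - 1 - b) j := by
  rw [(linv hn hk t).T hs (by omega) hj hjk]
  have := mul_le_mul_of_nonneg_right (show s + 1 ≤ b by omega) (show 0 ≤ k by omega)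
  exact ⟨⟨n - 1 - b, by omega, by omega, by omega, hl, by linarith⟩,
    ⟨by omega, by omega, hj, hjk, hl, by linarith, by linarith⟩⟩

theorem S3_pair {s b j : ℤ} {c : Bool} (hs : 0 ≤ s) (hsb : s < b) (hb : b < n) (hj : 0 ≤ j)
    (hjk : j < k) (hl : lane (n - 1 - b) c) (hm : mLR n s b)
    (ht : (t : ℤ) = (2 * n - 1 - s - b) * k - 1 + j) :
    hiB (s3 (crun n k t (s * k + j)) (drun n k w t (s * k + j)) c)
      (reg1 (crun n k t (s * k + j)) (drun n k w t (s * k + j)))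
      (L2 (crun n k t (s * k + j)) (drun n k w t (s * k + j)) c)
      = bt k (WW n k v j (4 * t + 3) s) j ∧
    loB (s3 (crun n k t (s * k + j)) (drun n k w t (s * k + j)) c)
      (reg1 (crun n k t (s * k + j)) (drun n k w t (s * k + j)))
      (L2 (crun n k t (s * k + j)) (drun n k w t (s * k + j)) c)
      = bt k (WW n k v j (4 * t + 3) b) j ∧
    s3 (crun n k t (s * k + j)) (drun n k w t (s * k + j)) c =
      pst k (Pre n v s b s) (Pre n v s b b) (j + 1) := by
  obtain ⟨f1, f2, f3⟩ := LR_rest hj hjk hs hsb hb ht hm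
  obtain ⟨f4, f5⟩ := TL_cod D hn hk hv hs hsb hb hj hjk hl f2 ht
  have hZ : Zb n k j s b = 4 * t + 2 := by rw [Zb_LR hs hsb hb hm, ht]
  have hr := block_range (n := n) hs (by omega) hj hjk
  unfold s3
  rw [show 4 * (t : ℤ) + 3 = 4 * t + 2 + 1 by ring]
  refine pair_step hj hjk hs hsb hb hZ (D.Ts hs hsb hb hj hjk hm hl ht)
    (S2_reg D hn hk hv hs (by omega) hj hjk f1) ?_
  have := S2_L D hn hk hv hr.1 f5
  rwa [show n - 1 - (n - 1 - b) = b by ring] at this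

theorem S3_reg {s j : ℤ} (hs : 0 ≤ s) (hsn : s < n) (hj : 0 ≤ j) (hjk : j < k)
    (hR : Rest n k s j t) :
    reg3 (crun n k t (s * k + j)) (drun n k w t (s * k + j)) = bt k (WW n k v j (4 * t + 3) s) j := by
  have key : ∀ c, (crun n k t (s * k + j)).T c = true → (crun n k t (s * k + j)).Lp c = true →
      hiB (s3 (crun n k t (s * k + j)) (drun n k w t (s * k + j)) c)
      (reg1 (crun n k t (s * k + j)) (drun n k w t (s * k + j)))
      (L2 (crun n k t (s * k + j)) (drun n k w t (s * k + j)) c)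
      = bt k (WW n k v j (4 * t + 3) s) j := by
    intro c h1 h2
    obtain ⟨b, g1, g2, g3, g4, g5⟩ := TL_dec D hn hk hv hs hsn hj hjk h1 h2
    exact (S3_pair D hn hk hv hs g1 g2 hj hjk g3 (rest_LR hk hj hjk g4 hR) g4).1
  have hreal := (c_real hn hk t hs hsn hj hjk).2 hR
  unfold reg3
  simp only [hreal, Bool.true_and, Bool.and_eq_true]
  split_ifs with h1 h2
  · exact key _ h1.1 h1.2
  · exact key _ h2.1 h2.2
  · rw [S2_reg D hn hk hv hs hsn hj hjk hR,
      WW_one (τ' := 4 * t + 3) (τ := 4 * t + 2) hj hjk (by ring)]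
    intro u hc
    rcases rest_cross hj hjk hR hc (by omega) (by omega) with h | ⟨g1, g2, g3, g4, g5, g6⟩ | h
    · omega
    · obtain ⟨e1, e2, e3⟩ := LR_rest hj hjk hs g1 g2 g5 g4
      have hl : lane (n - 1 - u) (decide ((n - 1 - u) % 2 = 1)) := by unfold lane; simp
      have hr := block_range (n := n) hs (by omega) hj hjk
      obtain ⟨f4, f5⟩ := TL_cod D hn hk hv hs g1 g2 hj hjk hl e2 g5
      have f6 : (crun n k t (s * k + j)).Lp (decide ((n - 1 - u) % 2 = 1)) = true := by
        rw [(linv hn hk t).Lp hr.1]; exact ⟨_, _, f5⟩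
      cases hd : decide ((n - 1 - u) % 2 = 1) <;> rw [hd] at f4 f6
      · exact h1 ⟨f4, f6⟩
      · exact h2 ⟨f4, f6⟩
    · omega

theorem S3_Lfly {x β j : ℤ} {c : Bool} (h0 : 0 ≤ x) (h : PL n k c x t β j) :
    L3 (crun n k t x) (drun n k w t x) c = bt k (WW n k v j (4 * t + 3) (n - 1 - β)) j := by
  have hP := h
  obtain ⟨f1, f2, f3, f4⟩ := h.fl
  obtain ⟨b0, b1, b2, b3, b4, b5, b6⟩ := h
  have hx : x < n * k := by
    have := mul_nonneg b0 (show 0 ≤ k by omega)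
    omega
  have hLp : (crun n k t x).Lp c = true := by rw [(linv hn hk t).Lp h0]; exact ⟨_, _, hP⟩
  obtain ⟨s, j', hs, hsn, hj', hjk', rfl⟩ := exists_block (by omega) h0 hx
  have hno : (∀ u, ¬ Cross n k j (4 * t + 2) (n - 1 - β) u) →
      L2 (crun n k t (s * k + j')) (drun n k w t (s * k + j')) c =
      bt k (WW n k v j (4 * t + 3) (n - 1 - β)) j := by
    intro h
    rw [S2_L D hn hk hv h0 hP, WW_one (τ' := 4 * t + 3) (τ := 4 * t + 2) b2 b3 (by ring) h]
  have hcr : ∀ u, Cross n k j (4 * t + 2) (n - 1 - β) u →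
      (crun n k t (s * k + j')).T c = true ∧ realC (crun n k t (s * k + j')) = true := by
    intro u hc
    obtain ⟨g1, g2, ⟨g3, g4, g5⟩ | ⟨g3, g4⟩⟩ := L_cross b2 b3 f1 (Or.inl f2) hc (by omega) (by omega)
    · obtain ⟨rfl, rfl⟩ := eucl (k := k) (by omega) b2 b3 hj' hjk' (a := u) (b := s) (by linarith)
      rw [c_real hn hk t hs hsn hj' hjk']
      have hl : lane (n - 1 - (n - 1 - β)) c := by rwa [show n - 1 - (n - 1 - β) = β by ring]
      exact ⟨(TL_cod D hn hk hv hs g2 f4 hj' hjk' hl f1 g5).1,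
        (LR_rest hj' hjk' hs g2 f4 g5 g4).1⟩
    · omega
  unfold L3
  rw [if_pos hLp]
  split_ifs with hT hre
  · obtain ⟨b, g1, g2, g3, g4, g5⟩ := TL_dec D hn hk hv hs hsn hj' hjk' hT hLp
    rw [c_real hn hk t hs hsn hj' hjk'] at hre
    obtain ⟨e1, rfl⟩ := line_unique hk b4 g3 b2 b3 hj' hjk' (by have := g5.2.2.2.2.2.1; linarith)
    have := (S3_pair D hn hk hv hs g1 g2 hj' hjk' g3 (rest_LR hk hj' hjk' g4 hre) g4).2.1
    rwa [show b = n - 1 - β by omega] at this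
  · exact hno fun u hc => hre (hcr u hc).2
  · exact hno fun u hc => hT (hcr u hc).1

theorem S3_L {x β j : ℤ} {c : Bool} (h0 : 0 ≤ x) (b0 : 0 ≤ β) (b1 : 2 * β + 2 ≤ n) (b2 : 0 ≤ j)
    (b3 : j < k) (b4 : lane β c) (b5 : x + t = n * k - 1 + β * k + 2 * j)
    (b6 : x ≤ n * k - k - β * k + j) :
    L3 (crun n k t x) (drun n k w t x) c = bt k (WW n k v j (4 * t + 3) (n - 1 - β)) j := by
  by_cases h : x < n * k - k - β * k + j
  · exact S3_Lfly D hn hk hv h0 ⟨b0, b1, b2, b3, b4, b5, h⟩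
  · have hx : x = (n - 1 - β) * k + j := by linarith
    have hl := (linv hn hk t).lau hk (i := n - 1 - β) (j := j) (c := c) (by omega) (by omega) b2 b3
    subst hx
    have hla : lau (crun n k t ((n - 1 - β) * k + j)) c = true := by
      rw [hl]
      exact ⟨by omega, by simpa using b4, by linarith⟩
    have htL : (t : ℤ) = tL n k (n - 1 - β) j := by unfold tL; linarith
    have hR : Rest n k (n - 1 - β) j t := by
      refine ⟨?_, fun _ => htL.le⟩
      have := mul_le_mul_of_nonneg_right (show 2 * β + 2 ≤ n by omega) (show 0 ≤ k by omega)
      linarith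
    simp only [lau, Bool.and_eq_true, Bool.not_eq_true'] at hla
    unfold L3
    simp only [hla.1, hla.2, if_true, Bool.false_eq_true, if_false]
    rw [S2_reg D hn hk hv (by omega) (by omega) b2 b3 hR,
      WW_one (τ' := 4 * t + 3) (τ := 4 * t + 2) b2 b3 (by ring)]
    intro u hc
    rcases rest_cross b2 b3 hR hc (by omega) (by omega) with h | h | h <;> omega

theorem S4_pair {x a β j : ℤ} {c : Bool} (h1 : x < n * k) (h : PE n k c x t a β j) :
    hiB (sE (crun n k t (x - 1)) (drun n k w t (x - 1)) (crun n k t x) (drun n k w t x) c)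
      (R2 (crun n k t (x - 1)) (drun n k w t (x - 1))) (L3 (crun n k t x) (drun n k w t x) c)
      = bt k (WW n k v j (4 * t + 4) a) j ∧
    loB (sE (crun n k t (x - 1)) (drun n k w t (x - 1)) (crun n k t x) (drun n k w t x) c)
      (R2 (crun n k t (x - 1)) (drun n k w t (x - 1))) (L3 (crun n k t x) (drun n k w t x) c)
      = bt k (WW n k v j (4 * t + 4) (n - 1 - β)) j ∧
    sE (crun n k t (x - 1)) (drun n k w t (x - 1)) (crun n k t x) (drun n k w t x) c =
      pst k (Pre n v a (n - 1 - β) a) (Pre n v a (n - 1 - β) (n - 1 - β)) (j + 1) := by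
  obtain ⟨f1, f2, f3, f4, f5⟩ := h.flight hk
  have h' := h
  obtain ⟨hC, g1, g2, g3, g4⟩ := h
  obtain ⟨e1, e2, e3, e4, e5, e6⟩ := hC.facts
  have hZ : Zb n k j a (n - 1 - β) = 4 * t + 3 := by rw [Zb_RL e5]; linarith
  unfold sE
  rw [show 4 * (t : ℤ) + 4 = 4 * t + 3 + 1 by ring]
  have hR2 := S2_R D hn hk hv (x := x - 1) (by omega) (by omega) e1 e2 g1 g2 (by omega) f3
  have hWa : WW n k v j (4 * t + 3) a = WW n k v j (4 * t + 2) a := by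
    apply WW_one g1 g2 (by ring)
    intro u hc
    obtain ⟨d1, d2, d3 | d3⟩ := R_cross (t := t) g1 g2 e2 (by omega) hc (by omega) (by omega) <;> omega
  rw [← hWa] at hR2
  refine pair_step g1 g2 e1 e3 e4 hZ ?_ hR2
    (S3_L D hn hk hv (by omega) hC.2.1 hC.2.2.1 g1 g2 hC.2.2.2.2.2 g4 f4)
  have hRm : (crun n k t (x - 1)).Rm = true ↔ j = 0 := by
    rw [(c_Rm hk t (by omega)).1, show (t : ℤ) - (x - 1) = a * k + j by omega, dvd_block hk g1 g2]
    omega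
  simp only [hRm]
  split_ifs with hj
  · subst hj; rw [pst_Pre_zero hv]
  · exact D.Js2 h1 h' (by omega)

theorem S4_R {x a j : ℤ} (h0 : 1 ≤ x) (hx : x < n * k) (ha : 0 ≤ a) (han : 2 * a < n)
    (hj : 0 ≤ j) (hjk : j < k) (ht : (t : ℤ) - (x - 1) = a * k + j) (h2 : t ≤ 2 * (x - 1)) :
    R4 (crun n k t (x - 1)) (drun n k w t (x - 1)) (crun n k t x) (drun n k w t x)
      = bt k (WW n k v j (4 * t + 4) a) j := by
  have hRF : 2 * (a * k + j) ≤ t := by omega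
  have J := jinv hn hk t
  have key : ∀ c, jedge (crun n k t (x - 1)) (crun n k t x) c = true →
      hiB (sE (crun n k t (x - 1)) (drun n k w t (x - 1)) (crun n k t x) (drun n k w t x) c)
      (R2 (crun n k t (x - 1)) (drun n k w t (x - 1))) (L3 (crun n k t x) (drun n k w t x) c)
      = bt k (WW n k v j (4 * t + 4) a) j := by
    intro c hc
    rw [J.jedge hn hk (by omega) hx] at hc
    obtain ⟨a', β, j', h⟩ := hc
    have := (S4_pair D hn hk hv hx h).1
    have h4 := h.2.2.2.1
    obtain ⟨rfl, rfl⟩ := eucl (k := k) (by omega) hj hjk h.2.1 h.2.2.1 (a := a) (b := a') (by omega)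
    exact this
  unfold R4
  split_ifs with h1 h3
  · exact key _ h1
  · exact key _ h3
  · rw [S2_R D hn hk hv (by omega) (by omega) ha han hj hjk ht h2]
    congr 1
    symm
    apply WW_const hj hjk (by omega)
    intro σ u s1 s2 hc
    obtain ⟨g1, g2, g3 | ⟨g3, g4⟩⟩ := R_cross hj hjk han hRF hc (by omega) (by omega)
    · omega
    · have hσ : σ = 4 * t + 3 := by omega
      obtain ⟨c, hC⟩ := CRL.of ha g2 g1 g3
      have : jedge (crun n k t (x - 1)) (crun n k t x) c = true := by
        rw [J.jedge hn hk (by omega) hx]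
        exact ⟨a, n - 1 - u, j, hC, hj, hjk, by omega, by linarith⟩
      cases c
      · exact h1 this
      · exact h3 this

theorem S4_L {x β j : ℤ} {c : Bool} (h0 : 1 ≤ x) (b0 : 0 ≤ β) (b1 : 2 * β + 2 ≤ n) (b2 : 0 ≤ j)
    (b3 : j < k) (b4 : lane β c) (b5 : x + t = n * k - 1 + β * k + 2 * j)
    (b6 : x ≤ n * k - k - β * k + j) :
    L4 (crun n k t (x - 1)) (drun n k w t (x - 1)) (crun n k t x) (drun n k w t x) c
      = bt k (WW n k v j (4 * t + 4) (n - 1 - β)) j := by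
  have J := jinv hn hk t
  have hx : x < n * k := by
    have := mul_nonneg b0 (show 0 ≤ k by omega)
    omega
  unfold L4
  split_ifs with hi
  · rw [J.jedge hn hk (by omega) hx] at hi
    obtain ⟨a', β', j', h⟩ := hi
    have := (S4_pair D hn hk hv hx h).2.1
    obtain ⟨rfl, rfl⟩ := line_unique hk b4 h.1.2.2.2.2.2 b2 b3 h.2.1 h.2.2.1
      (by have := h.2.2.2.2; linarith)
    exact this
  · rw [S3_L D hn hk hv (by omega) b0 b1 b2 b3 b4 b5 b6,
      WW_one (τ' := 4 * t + 4) (τ := 4 * t + 3) b2 b3 (by ring)]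
    intro u hc
    have htL : tL n k (n - 1 - β) j ≤ t := by unfold tL; linarith
    obtain ⟨g1, g2, g3 | ⟨g3, g4⟩⟩ := L_cross (t := t) b2 b3 (by omega)
      (by omega) hc (by omega) (by omega)
    · omega
    · obtain ⟨c', hC⟩ := CRL.of g1 (by omega) g2 g3
      have hb : n - 1 - (n - 1 - β) = β := by ring
      rw [hb] at hC
      have : c' = c := by
        have := hC.2.2.2.2.2
        unfold lane at this b4
        cases c <;> cases c' <;> simp_all
      subst this
      apply hi
      rw [J.jedge hn hk (by omega) hx]
      exact ⟨u, β, j, hC, b2, b3, by linarith, b5⟩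

end Data3


set_option linter.unusedVariables false

section Data4

variable {n k : ℤ} {v : ℤ → ℕ} {w : ℤ → Bool}

theorem dinv (hn : 1 ≤ n) (hk : 2 ≤ k) (hv : ∀ s, v s < 2 ^ k.toNat)
    (hw : ∀ s j : ℤ, 0 ≤ s → s < n → 0 ≤ j → j < k → w (s * k + j) = bt k (v s) j) (t : ℕ) :
    DInv n k v w t := by
  have hN : k ≤ n * k := by nlinarith
  induction t with
  | zero =>
    refine ⟨?_, ?_, ?_, ?_, ?_, ?_, ?_, ?_, ?_⟩
    · intro s j hs hsn hj hjk hR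
      have hr := block_range (n := n) hs hsn hj hjk
      rw [drun_zero hr.1 hr.2]
      simp only [Nat.cast_zero, mul_zero, WW_zero hj hjk]
      exact hw s j hs hsn hj hjk
    · intro x a j h0 hx ha han hj hjk ht h2
      have := mul_nonneg ha (show 0 ≤ k by omega)
      have hx0 : x = 0 := by push_cast at ht; omega
      have hj0 : j = 0 := by push_cast at ht; omega
      have ha0 : a = 0 := by
        have : a * k = 0 := by push_cast at ht; omega
        rcases mul_eq_zero.1 this with h | h <;> omega
      subst hx0 hj0 ha0
      rw [drun_zero (by omega) (by omega)]
      simp only [Nat.cast_zero, mul_zero, WW_zero le_rfl hjk]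
      have := hw 0 0 le_rfl (by omega) le_rfl hjk
      simpa [startD, Dat.init] using this
    · rintro x β j c h0 ⟨b0, b1, b2, b3, b4, b5, b6⟩
      have := mul_nonneg b0 (show 0 ≤ k by omega)
      push_cast at b5; omega
    · intro a s j ha has hsn hj hjk hm ht
      have := mul_le_mul_of_nonneg_right (show 1 ≤ a + s by omega) (show 0 ≤ k by omega)
      push_cast at ht; omega
    · intro a s j ha has hsn hj hjk hm ht
      have := mul_le_mul_of_nonneg_right (show 1 ≤ a + s by omega) (show 0 ≤ k by omega)
      push_cast at ht; omega
    · intro s b j c ha has hsn hj hjk hm hl ht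
      have := mul_le_mul_of_nonneg_right (show 1 ≤ 2 * n - 1 - s - b by omega)
        (show 0 ≤ k by omega)
      push_cast at ht; omega
    · intro x a β j c hx h hj
      obtain ⟨f1, f2, f3, f4⟩ := h.flight hk
      obtain ⟨⟨c1, c2, c3, c4, c5, c6⟩, h1, h2, h3, h4⟩ := h
      have := mul_nonneg c1 (show 0 ≤ k by omega)
      push_cast at h3; omega
    · intro x a β j c hx h
      obtain ⟨⟨c1, c2, c3, c4, c5, c6⟩, h1, h2, h3, h4⟩ := h
      have e1 := mul_nonneg c1 (show 0 ≤ k by omega)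
      have e2 := mul_nonneg c2 (show 0 ≤ k by omega)
      push_cast at h3 h4; omega
    · intro x a β j c hx h hj
      obtain ⟨f1, f2, f3, f4⟩ := h.flight hk
      obtain ⟨⟨c1, c2, c3, c4, c5, c6⟩, h1, h2, h3, h4⟩ := h
      have := mul_nonneg c1 (show 0 ≤ k by omega)
      push_cast at h3; omega
  | succ t D =>
    have e4 : 4 * ((t + 1 : ℕ) : ℤ) = 4 * t + 4 := by push_cast; ring
    refine ⟨?_, ?_, ?_, ?_, ?_, ?_, ?_, ?_, ?_⟩
    · intro s j hs hsn hj hjk hR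
      have hr := block_range (n := n) hs hsn hj hjk
      have hR' : Rest n k s j t := by
        obtain ⟨r1, r2⟩ := hR
        push_cast at r1 r2
        exact ⟨by omega, fun h => by have := r2 h; omega⟩
      rw [drun_succ hr.1 hr.2, e4,
        WW_one (τ := 4 * t + 3) hj hjk (by ring) (s := s)]
      · exact S3_reg D hn hk hv hs hsn hj hjk hR'
      · intro u hc
        rcases rest_cross hj hjk hR' hc (by omega) (by omega) with h | h | h
        · omega
        · omega
        · have := hR.2 h.2.1
          push_cast at this
          omega
    · intro x a j h0 hx ha han hj hjk ht h2
      rw [drun_succ h0 hx, e4]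
      simp only [dstep]
      have h4 := c_launchR (n := n) (k := k) t h0 hx
      push_cast at ht h2
      split_ifs with hL
      · rw [h4] at hL
        have hxa : x = a * k + j := by omega
        subst hxa
        have hR' : Rest n k a j t := ⟨by omega, fun h => by omega⟩
        rw [WW_one (τ := 4 * t + 3) hj hjk (by ring) (s := a)]
        · exact S3_reg D hn hk hv ha (by omega) hj hjk hR'
        · intro u hc
          rcases rest_cross hj hjk hR' hc (by omega) (by omega) with h | h | h <;> omega
      · rw [h4] at hL
        have := mul_nonneg ha (show 0 ≤ k by omega)
        exact S4_R D hn hk hv (by omega) hx ha han hj hjk (by omega) (by omega)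
    · intro x β j c h0 h
      obtain ⟨b0, b1, b2, b3, b4, b5, b6⟩ := h
      have hb := mul_nonneg b0 (show 0 ≤ k by omega)
      rw [drun_succ h0 (by omega), e4]
      push_cast at b5
      have := S4_L D hn hk hv (x := x + 1) (c := c) (by omega) b0 b1 b2 b3 b4 (by omega) (by omega)
      rwa [add_sub_cancel_right] at this
    · intro a s j ha has hsn hj hjk hm ht
      have hr := block_range (n := n) (by omega) hsn hj hjk
      rw [drun_succ hr.1 hr.2]
      simp only [dstep, c_kd t hr.1 hr.2, kd_ms, dvd_block hk hj hjk]
      split_ifs with hj0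
      · subst hj0; rw [pst_Pre_zero hv]
      · have := D.Ksw ha has hsn (j := j - 1) (by omega) (by omega) hm (by push_cast at ht; omega)
        rwa [sub_add_cancel, ← add_sub_assoc] at this
    · intro a s j ha has hsn hj hjk hm ht
      have hr := block_range (n := n) (by omega) hsn hj hjk
      rw [drun_succ hr.1 hr.2]
      exact (S1_pair D hn hk ha has hsn hj hjk hm (by push_cast at ht; omega)).2.2
    · intro s b j c hs hsb hb hj hjk hm hl ht
      have hr := block_range (n := n) hs (by omega) hj hjk
      rw [drun_succ hr.1 hr.2]
      simp only [dstep, c_kd t hr.1 hr.2, kd_ms, dvd_block hk hj hjk]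
      split_ifs with hj0
      · subst hj0; rw [pst_Pre_zero hv]
      · have := (S3_pair D hn hk hv hs hsb hb (j := j - 1) (by omega) (by omega) hl hm
          (by push_cast at ht; omega)).2.2
        rwa [sub_add_cancel, ← add_sub_assoc] at this
    · intro x a β j c hx h hj
      obtain ⟨f1, f2, f3, f4⟩ := h.flight hk
      rw [drun_succ f1 hx]
      obtain ⟨hC, h1, h2, h3, h4⟩ := h
      push_cast at h3 h4
      have := D.Js1 hx (show PJ n k c x t a β (j - 1) from
        ⟨hC, by omega, by omega, by omega, by omega⟩)
      rwa [sub_add_cancel] at this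
    · intro x a β j c hx h
      obtain ⟨hC, h1, h2, h3, h4⟩ := h
      push_cast at h3 h4
      have hE : PE n k c x t a β j := ⟨hC, by omega, by omega, by omega, by omega⟩
      obtain ⟨f1, f2⟩ := hE.flight hk
      rw [drun_succ (by omega) hx]
      exact (S4_pair D hn hk hv hx hE).2.2
    · intro x a β j c hx h hj
      obtain ⟨f1, f2⟩ := h.flight hk
      rw [drun_succ (by omega) hx]
      obtain ⟨hC, h1, h2, h3, h4⟩ := h
      push_cast at h3 h4
      have hI : PI n k c (x - 1) t a β (j - 1) := ⟨hC, by omega, by omega, by omega, by omega⟩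
      have := (S2_pair D hn hk hv (by omega) hI).2.2
      rwa [sub_add_cancel] at this

end Data4


set_option linter.unusedVariables false

section Readout

variable {n k : ℤ} {v : ℤ → ℕ} {w : ℤ → Bool}

theorem final_L {i j : ℤ} (hk : 2 ≤ k) (hi : 0 ≤ i) (hin : 2 * i + 2 ≤ n) (hj : 0 ≤ j)
    (hjk : j < k) : ∀ σ u, 4 * (n * k - 1 + j) ≤ σ → ¬ Cross n k j σ (n - 1 - i) u := by
  rintro σ u hσ ⟨a1, a2, a3, a4, ⟨c1, c2⟩ | ⟨c1, c2⟩⟩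
  · rcases Zb_cases hj hjk a1 c1 a4 with ⟨m, t0, e1, e2, e3, e4, e5, e6⟩ |
      ⟨m, t0, e1, e2, e3, e4, e5, e6⟩ | ⟨m, t0, e1, e2, e3, e4, e5, e6⟩
    · omega
    · have := e6 (by omega)
      unfold tL at this
      have := mul_nonneg (show 0 ≤ n - 2 - 2 * i by omega) (show 0 ≤ k by omega)
      have : t0 < n * k - 1 + j := by linarith
      omega
    · omega
  · rcases Zb_cases hj hjk a3 c1 a2 with ⟨m, t0, e1, e2, e3, e4, e5, e6⟩ |
      ⟨m, t0, e1, e2, e3, e4, e5, e6⟩ | ⟨m, t0, e1, e2, e3, e4, e5, e6⟩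
    · have := e6 (by omega)
      unfold tL at this
      have := mul_nonneg (show 0 ≤ n - 2 - 2 * i by omega) (show 0 ≤ k by omega)
      have : t0 < n * k - 1 + j := by linarith
      omega
    · have hu : i < u := by unfold mLR at m; omega
      have := mul_le_mul_of_nonneg_right (show i + 1 ≤ u by omega) (show 0 ≤ k by omega)
      have : t0 < n * k - 1 + j := by linarith
      omega
    · have := mul_le_mul_of_nonneg_right (show u + 1 ≤ n - 1 - i by omega) (show 0 ≤ k by omega)
      have : 2 * t0 < 4 * (n * k - 1 + j) := by linarith
      omega

theorem final_R {s j : ℤ} (hk : 2 ≤ k) (hs : 0 ≤ s) (hsn : 2 * s < n) (hj : 0 ≤ j)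
    (hjk : j < k) : ∀ σ u, 4 * (n * k - k + 2 * j) ≤ σ → ¬ Cross n k j σ s u := by
  have h1 := mul_nonneg (show 0 ≤ n - 1 - 2 * s by omega) (show 0 ≤ k by omega)
  have h2 : 2 * (s * k + j) ≤ n * k - k + 2 * j := by linarith
  rintro σ u hσ ⟨a1, a2, a3, a4, ⟨c1, c2⟩ | ⟨c1, c2⟩⟩
  · rcases Zb_cases hj hjk a1 c1 a4 with ⟨m, t0, e1, e2, e3, e4, e5, e6⟩ |
      ⟨m, t0, e1, e2, e3, e4, e5, e6⟩ | ⟨m, t0, e1, e2, e3, e4, e5, e6⟩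
    · have hu : s + u + 1 ≤ n - 1 := by unfold mRR at m; omega
      have := mul_le_mul_of_nonneg_right hu (show 0 ≤ k by omega)
      have : t0 < n * k - k + 2 * j := by linarith
      omega
    · omega
    · have := mul_le_mul_of_nonneg_right (show s + 1 ≤ u by omega) (show 0 ≤ k by omega)
      have : 2 * t0 - 1 < 4 * (n * k - k + 2 * j) := by linarith
      omega
  · rcases Zb_cases hj hjk a3 c1 a2 with ⟨m, t0, e1, e2, e3, e4, e5, e6⟩ |
      ⟨m, t0, e1, e2, e3, e4, e5, e6⟩ | ⟨m, t0, e1, e2, e3, e4, e5, e6⟩ <;> omega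

theorem reg_final (hn : 1 ≤ n) (hk : 2 ≤ k) (hv : ∀ s, v s < 2 ^ k.toNat)
    (hw : ∀ s j : ℤ, 0 ≤ s → s < n → 0 ≤ j → j < k → w (s * k + j) = bt k (v s) j)
    {i j : ℤ} (hi : 0 ≤ i) (hin : i < n) (h2 : n ≤ 2 * i + 1) (hj : 0 ≤ j) (hjk : j < k)
    (e : ℕ) : ∀ t : ℕ, (t : ℤ) = n * k - k + 2 * j + e → (t : ℤ) ≤ n * k - 1 + j →
      reg1 (crun n k t (i * k + j)) (drun n k w t (i * k + j)) =
        bt k (Fin_ n v (n - 1 - i)) j := by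
  have hr := block_range (n := n) hi hin hj hjk
  have hm := mul_nonneg (show 0 ≤ 2 * i + 1 - n by omega) (show 0 ≤ k by omega)
  have hx2 : n * k - k + 2 * j ≤ 2 * (i * k + j) := by linarith
  have hreal : ∀ t : ℕ, n * k - k + 2 * j ≤ (t : ℤ) →
      realC (crun n k t (i * k + j)) = false := by
    intro t ht
    rw [← Bool.not_eq_true, c_real hn hk t hi hin hj hjk]
    rintro ⟨r1, r2⟩
    by_cases h3 : n ≤ 2 * i
    · have := r2 h3
      unfold tL at this
      have := mul_nonneg (show 0 ≤ 2 * i - n by omega) (show 0 ≤ k by omega)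
      linarith
    · have h4 : n = 2 * i + 1 := by omega
      rw [h4] at ht
      linarith
  induction e with
  | zero =>
    intro t ht ht'
    have hK : (crun n k t (i * k + j)).Ka = true := by
      rw [Ka_dec hn hk t hi hin hj hjk]
      exact ⟨n - 1 - i, by omega, by omega, by rw [ht]; push_cast; ring⟩
    unfold reg1
    rw [if_pos hK, hreal t (by simp [ht]), if_neg (by simp),
      (dinv hn hk hv hw t).R hr.1 hr.2 (a := n - 1 - i) (j := j) (by omega) (by omega) hj hjk
        (by rw [ht]; push_cast; ring) (by rw [ht]; push_cast; omega),
      WW_final hj hjk]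
    have : 4 * (t : ℤ) = 4 * (n * k - k + 2 * j) := by rw [ht]; simp
    rw [this]
    exact final_R hk (by omega) (by omega) hj hjk
  | succ e ih =>
    intro t ht ht'
    have hN : k ≤ n * k := by nlinarith
    obtain ⟨t, rfl⟩ : ∃ t', t = t' + 1 := ⟨t - 1, by push_cast at ht; omega⟩
    push_cast at ht ht'
    have hK : (crun n k (t + 1) (i * k + j)).Ka = false := by
      rw [← Bool.not_eq_true, Ka_dec hn hk (t + 1) hi hin hj hjk]
      rintro ⟨a, g1, g2, g3⟩
      push_cast at g3
      have : n - 1 < a + i := mul_lt_cancel (k := k) (by omega) (by linarith)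
      have : a + i < n := mul_lt_cancel (k := k) (by omega) (by linarith)
      omega
    have hreg : (drun n k w (t + 1) (i * k + j)).reg =
        reg1 (crun n k t (i * k + j)) (drun n k w t (i * k + j)) := by
      rw [drun_succ hr.1 hr.2]
      simp [dstep, reg3, hreal t (by omega)]
    unfold reg1
    rw [hK, if_neg (by simp), hreg]
    exact ih t (by omega) (by omega)

/-- what the cells show when the finishing token passes -/
theorem readout_final (hn : 1 ≤ n) (hk : 2 ≤ k) (hv : ∀ s, v s < 2 ^ k.toNat)
    (hw : ∀ s j : ℤ, 0 ≤ s → s < n → 0 ≤ j → j < k → w (s * k + j) = bt k (v s) j)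
    {i j : ℤ} (hi : 0 ≤ i) (hin : i < n) (hj : 0 ≤ j) (hjk : j < k)
    (t : ℕ) (ht : (t : ℤ) = n * k - 1 + j) :
      readout (crun n k t (i * k + j)) (drun n k w t (i * k + j)) =
        bt k (Fin_ n v (n - 1 - i)) j := by
  have hr := block_range (n := n) hi hin hj hjk
  have hT : ∀ c, (crun n k t (i * k + j)).T c = true ↔ 2 * i + 2 ≤ n ∧ lane i c := by
    intro c
    rw [(linv hn hk t).T hi hin hj hjk]
    constructor
    · rintro ⟨β, b0, b1, b2, b3, b4⟩
      have : β = i := mul_right_cancel₀ (show k ≠ 0 by omega) (by linarith)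
      subst this
      exact ⟨b1, b3⟩
    · rintro ⟨h1, h2⟩
      exact ⟨i, hi, h1, by omega, h2, by rw [ht]; ring⟩
  unfold readout
  by_cases h : 2 * i + 2 ≤ n
  · have hm := mul_nonneg (show 0 ≤ n - 2 - 2 * i by omega) (show 0 ≤ k by omega)
    have key : ∀ c, lane i c → (drun n k w t (i * k + j)).L c = bt k (Fin_ n v (n - 1 - i)) j := by
      intro c hc
      rw [(dinv hn hk hv hw t).L hr.1 (β := i) (j := j)
        ⟨hi, h, hj, hjk, hc, by rw [ht]; ring, by linarith⟩, WW_final hj hjk]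
      rw [ht]
      exact final_L hk hi h hj hjk
    by_cases hl : lane i false
    · rw [if_pos ((hT _).2 ⟨h, hl⟩), key _ hl]
    · have hl' : lane i true := by unfold lane at *; simp at *; omega
      rw [if_neg (by rw [hT]; tauto), if_pos ((hT _).2 ⟨h, hl'⟩), key _ hl']
  · rw [if_neg (by rw [hT]; tauto), if_neg (by rw [hT]; tauto)]
    exact reg_final hn hk hv hw hi hin (by omega) hj hjk (k - 1 - j).toNat t
      (by rw [ht, Int.toNat_of_nonneg (by omega)]; ring) (by omega)

theorem Fin_sorted (s s' : ℤ) (h0 : 0 ≤ s) (h : s ≤ s') (h1 : s' < n) :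
    Fin_ n v s' ≤ Fin_ n v s := by
  rcases h.eq_or_lt with rfl | h
  · exact le_rfl
  · unfold Fin_
    exact VV_sorted _ s s' h0 h h1 (by have := Zw_lt h h0 h1; omega)

end Readout


set_option linter.unusedVariables false

/-! ### The firing squad layer -/

inductive GS
  | sleep
  | w
  | w0 (kL lL bL kR lR bR : Bool)
  | cell (d par mark land kap fresh b ok ol : Bool)

namespace GS

def mir : GS → GS
  | sleep => sleep
  | w => w
  | w0 a b c d e f => w0 d e f a b c
  | cell d a1 a2 a3 a4 a5 a6 a7 a8 => cell (!d) a1 a2 a3 a4 a5 a6 a7 a8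

def isW : GS → Bool
  | w => true
  | w0 .. => true
  | _ => false

/-- data carried by a front -/
structure Fr where
  par : Bool
  b : Bool
  ok : Bool
  ol : Bool

def frontR : GS → Option Fr
  | w0 _ _ _ k l b => some ⟨true, b, k, l⟩
  | cell false par _ _ _ true b ok ol => some ⟨!par, b, ok, ol⟩
  | _ => none

def frontL (s : GS) : Option Fr := frontR (mir s)

/-- mark of a right oriented cell or wall -/
def markL : GS → Bool
  | w => true
  | w0 .. => true
  | cell false _ m .. => m
  | _ => false

/-- a left oriented marked cell -/
def mark1 : GS → Bool
  | cell true _ m .. => m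
  | _ => false

def kap0 : GS → Bool
  | cell false _ _ _ kp .. => kp
  | _ => false

def land0 : GS → Bool
  | cell false _ _ ld .. => ld
  | _ => false

def hitL (l c : GS) (f : Fr) : GS :=
  match c with
  | cell false cp cm _ _ _ _ _ _ =>
    let ld := f.ok && markL l
    let ok2 := if ld then !cp else f.ok
    if ld || (cm && !f.ol) then w0 ok2 ld cp (!f.par) true f.par
    else cell true f.par true true (!f.par) true f.b ok2 ld
  | _ => cell true f.par true true (!f.par) true false false false

def stay0 (l : GS) (par mark fresh b : Bool) (r : GS) : GS :=
  if fresh && b && mark1 r then w0 false false par false false false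
  else
    let ld := kap0 r && markL l
    cell false par (ld || (mark && !land0 r)) ld (if ld then !par else kap0 r) false false false false

def stay (l c r : GS) : GS :=
  match c with
  | cell false par mark _ _ fresh b _ _ => stay0 l par mark fresh b r
  | cell true par mark _ _ fresh b _ _ => mir (stay0 (mir r) par mark fresh b (mir l))
  | c => c

def gstep (l c r : GS) : GS :=
  if isW c then w else
  match frontR l, frontL r with
  | some f, some f' => w0 (!f.par) true f.par (!f'.par) true f'.par
  | none, some f' => hitL l c f'
  | some f, none => mir (hitL (mir r) (mir c) f)
  | none, none => stay l c r

theorem mir_mir (s : GS) : mir (mir s) = s := by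
  cases s <;> simp [mir]

theorem isW_mir (s : GS) : isW (mir s) = isW s := by
  cases s <;> simp [mir, isW]

theorem stay_mir (l c r : GS) : stay (mir r) (mir c) (mir l) = mir (stay l c r) := by
  rcases c with _ | _ | _ | ⟨_ | _, par, mark, land, kap, fresh, b, ok, ol⟩
  · rfl
  · rfl
  · rfl
  · show mir (stay0 (mir (mir l)) par mark fresh b (mir (mir r))) = mir (stay0 l par mark fresh b r)
    rw [mir_mir, mir_mir]
  · show stay0 (mir r) par mark fresh b (mir l) = mir (mir (stay0 (mir r) par mark fresh b (mir l)))
    rw [mir_mir]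

theorem gstep_mir (l c r : GS) : gstep (mir r) (mir c) (mir l) = mir (gstep l c r) := by
  unfold gstep
  rw [isW_mir]
  have h1 : frontL (mir l) = frontR l := by unfold frontL; rw [mir_mir]
  have h2 : frontR (mir r) = frontL r := rfl
  rw [h1, h2]
  split_ifs
  · rfl
  · cases frontR l <;> cases frontL r
    · exact stay_mir l c r
    · show mir (hitL (mir (mir l)) (mir (mir c)) _) = _
      rw [mir_mir, mir_mir]
    · exact (mir_mir _).symm
    · rfl

theorem gstep_w {l c r : GS} (h : isW c = true) : gstep l c r = w := by
  unfold gstep; rw [if_pos h]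

end GS

/-! ### Marks -/

def Mk (V y : ℕ) : Prop := ∃ s, V / 2 ^ (s + 1) = y
def Ld (V y : ℕ) : Prop := ∃ s, 2 ^ (s + 1) ∣ V ∧ V / 2 ^ (s + 1) = y
def Kp (V y : ℕ) : Prop := ∃ s, 2 ^ (s + 2) ∣ V ∧ V / 2 ^ (s + 2) < y ∧ y ≤ V / 2 ^ (s + 1)

theorem div_pow_succ (V s : ℕ) : V / 2 ^ (s + 1) = V / 2 / 2 ^ s := by
  rw [pow_succ', Nat.div_div_eq_div_mul]

theorem dvd_pow_succ (V s : ℕ) : 2 ^ (s + 1) ∣ V ↔ V % 2 = 0 ∧ 2 ^ s ∣ V / 2 := by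
  rw [pow_succ']
  constructor
  · rintro ⟨m, rfl⟩
    refine ⟨by rw [mul_assoc]; omega, ⟨m, ?_⟩⟩
    rw [mul_assoc]; omega
  · rintro ⟨h, m, hm⟩
    exact ⟨m, by rw [mul_assoc, ← hm]; omega⟩

theorem Mk_rec (V y : ℕ) : Mk V y ↔ V / 2 = y ∨ Mk (V / 2) y := by
  constructor
  · rintro ⟨s, h⟩
    rw [div_pow_succ] at h
    cases s with
    | zero => left; simpa using h
    | succ s => right; exact ⟨s, h⟩
  · rintro (h | ⟨s, h⟩)
    · exact ⟨0, by simpa using h⟩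
    · exact ⟨s + 1, by rw [div_pow_succ]; exact h⟩

theorem Ld_rec (V y : ℕ) : Ld V y ↔ V % 2 = 0 ∧ (V / 2 = y ∨ Ld (V / 2) y) := by
  constructor
  · rintro ⟨s, h, h'⟩
    rw [div_pow_succ] at h'
    rw [dvd_pow_succ] at h
    refine ⟨h.1, ?_⟩
    cases s with
    | zero => left; simpa using h'
    | succ s => right; exact ⟨s, h.2, h'⟩
  · rintro ⟨h0, h | ⟨s, h, h'⟩⟩
    · exact ⟨0, by rw [dvd_pow_succ]; simp [h0], by simpa using h⟩
    · exact ⟨s + 1, by rw [dvd_pow_succ]; exact ⟨h0, h⟩, by rw [div_pow_succ]; exact h'⟩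

theorem Kp_rec (V y : ℕ) : Kp V y ↔
    V % 2 = 0 ∧ ((V / 2 % 2 = 0 ∧ V / 2 / 2 < y ∧ y ≤ V / 2) ∨ Kp (V / 2) y) := by
  constructor
  · rintro ⟨s, h, h', h''⟩
    rw [div_pow_succ] at h' h''
    rw [dvd_pow_succ] at h
    refine ⟨h.1, ?_⟩
    cases s with
    | zero =>
      left
      have := h.2
      rw [dvd_pow_succ] at this
      exact ⟨this.1, by simpa using h', by simpa using h''⟩
    | succ s => right; exact ⟨s, h.2, h', h''⟩
  · rintro ⟨h0, ⟨h1, h2, h3⟩ | ⟨s, h, h', h''⟩⟩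
    · exact ⟨0, by rw [dvd_pow_succ, dvd_pow_succ]; simp [h0, h1],
        by rw [div_pow_succ, div_pow_succ]; simpa using h2, by rw [div_pow_succ]; simpa using h3⟩
    · exact ⟨s + 1, by rw [dvd_pow_succ]; exact ⟨h0, h⟩, by rw [div_pow_succ]; exact h',
        by rw [div_pow_succ]; exact h''⟩

theorem Mk_le {V y : ℕ} (h : Mk V y) : y ≤ V / 2 := by
  obtain ⟨s, rfl⟩ := h
  rw [div_pow_succ]
  exact Nat.div_le_self _ _

theorem Ld_le {V y : ℕ} (h : Ld V y) : y ≤ V / 2 := by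
  obtain ⟨s, _, rfl⟩ := h
  rw [div_pow_succ]
  exact Nat.div_le_self _ _

theorem Kp_le {V y : ℕ} (h : Kp V y) : y ≤ V / 2 := by
  obtain ⟨s, _, _, h⟩ := h
  rw [div_pow_succ] at h
  exact h.trans (Nat.div_le_self _ _)

theorem Mk_zero (V : ℕ) : Mk V 0 := by
  refine ⟨V, Nat.div_eq_of_lt ?_⟩
  exact lt_of_lt_of_le (Nat.lt_pow_self (by norm_num)) (Nat.pow_le_pow_right (by norm_num) (by omega))

theorem Ld_Mk {V y : ℕ} (h : Ld V y) : Mk V y := by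
  obtain ⟨s, _, h⟩ := h
  exact ⟨s, h⟩

/-- an odd `V` has the same marks as `V - 1` -/
theorem Mk_odd {V y : ℕ} (h : V % 2 = 0) : Mk (V + 1) y ↔ Mk V y := by
  rw [Mk_rec, Mk_rec V, show (V + 1) / 2 = V / 2 by omega]

theorem Ld_step (V : ℕ) : ∀ y, 1 ≤ y → y < V / 2 → (Ld V y ↔ Kp V (y + 1) ∧ Mk (V - 2) (y - 1)) := by
  induction V using Nat.strong_induction_on with
  | _ V ih =>
  intro y h1 h2
  rw [Ld_rec, Kp_rec]
  by_cases he : V % 2 = 0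
  · have hM : Mk (V - 2) (y - 1) ↔ Mk (V / 2 - 1) (y - 1) := by
      rw [Mk_rec, show (V - 2) / 2 = V / 2 - 1 by omega]
      constructor
      · rintro (h | h)
        · omega
        · exact h
      · exact Or.inr
    rw [hM]
    by_cases he2 : V / 2 % 2 = 0
    · have hM2 : Mk (V / 2 - 1) (y - 1) ↔ Mk (V / 2 - 2) (y - 1) := by
        rw [show V / 2 - 1 = V / 2 - 2 + 1 by omega]
        exact Mk_odd (by omega)
      rw [hM2]
      by_cases hy : y < V / 2 / 2
      · have := ih (V / 2) (by omega) y h1 hy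
        rw [this]
        simp only [he, he2, true_and]
        constructor
        · rintro (h | ⟨h, h'⟩)
          · omega
          · exact ⟨Or.inr h, h'⟩
        · rintro ⟨h | h, h'⟩
          · omega
          · exact Or.inr ⟨h, h'⟩
      · have hM3 : Mk (V / 2 - 2) (y - 1) ↔ y = V / 2 / 2 := by
          rw [Mk_rec]
          constructor
          · rintro (h | h)
            · omega
            · have := Mk_le h; omega
          · intro h; left; omega
        rw [hM3]
        simp only [he, he2, true_and]
        constructor
        · rintro (h | h)
          · omega
          · have := Ld_le h
            exact ⟨Or.inl ⟨by omega, by omega⟩, by omega⟩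
        · rintro ⟨_, rfl⟩
          right
          rw [Ld_rec]
          exact ⟨he2, Or.inl rfl⟩
    · have a1 : ¬ Ld (V / 2) y := by rw [Ld_rec]; tauto
      have a2 : ¬ Kp (V / 2) (y + 1) := by rw [Kp_rec]; tauto
      have : V / 2 ≠ y := by omega
      tauto
  · tauto

theorem Mk_step (V : ℕ) : ∀ y, 1 ≤ y → y < V / 2 →
    (Mk V y ↔ Ld V y ∨ (Mk (V - 1) y ∧ ¬ Ld V (y + 1))) := by
  induction V using Nat.strong_induction_on with
  | _ V ih =>
  intro y h1 h2
  by_cases he : V % 2 = 0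
  · rw [Mk_rec, Ld_rec, Ld_rec V, Mk_rec (V - 1), show (V - 1) / 2 = V / 2 - 1 by omega]
    by_cases hy : y < V / 2 / 2
    · have := ih (V / 2) (by omega) y h1 hy
      rw [this]
      have a1 : V / 2 ≠ y := by omega
      have a2 : V / 2 ≠ y + 1 := by omega
      have a3 : V / 2 - 1 ≠ y := by omega
      tauto
    · by_cases he2 : V / 2 % 2 = 0
      · have a1 : Mk (V / 2) y ↔ y = V / 2 / 2 := by
          rw [Mk_rec]
          constructor
          · rintro (h | h)
            · omega
            · have := Mk_le h; omega
          · intro h; left; omega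
        have a2 : Ld (V / 2) y ↔ y = V / 2 / 2 := by
          constructor
          · intro h; have := Ld_le h; omega
          · rintro rfl; rw [Ld_rec]; exact ⟨he2, Or.inl rfl⟩
        have a3 : ¬ Mk (V / 2 - 1) y := by intro h; have := Mk_le h; omega
        have a4 : V / 2 ≠ y := by omega
        rw [a1, a2]
        by_cases hy2 : y + 1 = V / 2
        · tauto
        · have a5 : V / 2 - 1 ≠ y := by omega
          tauto
      · have a1 : Mk (V / 2 - 1) y ↔ Mk (V / 2) y := by
          conv_rhs => rw [show V / 2 = V / 2 - 1 + 1 by omega]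
          exact (Mk_odd (by omega)).symm
        have a2 : ∀ y, ¬ Ld (V / 2) y := by intro y; rw [Ld_rec]; tauto
        have a4 : V / 2 ≠ y := by omega
        have a5 : Mk (V / 2) y → V / 2 ≠ y + 1 := by intro h; have := Mk_le h; omega
        have a6 := a2 y
        have a7 := a2 (y + 1)
        have a8 : V / 2 - 1 = y ↔ V / 2 = y + 1 := by omega
        rw [a1, a8]
        tauto
  · have a2 : ∀ y, ¬ Ld V y := by intro y; rw [Ld_rec]; tauto
    have a6 := a2 y
    have a7 := a2 (y + 1)
    have : Mk V y ↔ Mk (V - 1) y := by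
      conv_lhs => rw [show V = V - 1 + 1 by omega]
      exact Mk_odd (by omega)
    tauto

open Classical in
theorem Kp_step (V : ℕ) : ∀ y, 1 ≤ y → y < V / 2 →
    (Kp V y ↔ if Ld V y then y % 2 = 0 else Kp V (y + 1)) := by
  induction V using Nat.strong_induction_on with
  | _ V ih =>
  intro y h1 h2
  by_cases he : V % 2 = 0
  · rw [Kp_rec, Kp_rec V, Ld_rec]
    have a4 : V / 2 ≠ y := by omega
    by_cases hy : y < V / 2 / 2
    · have := ih (V / 2) (by omega) y h1 hy
      rw [this]
      have a1 : ¬ (V / 2 % 2 = 0 ∧ V / 2 / 2 < y ∧ y ≤ V / 2) := by omega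
      have a2 : ¬ (V / 2 % 2 = 0 ∧ V / 2 / 2 < y + 1 ∧ y + 1 ≤ V / 2) := by omega
      simp only [he, a4, a1, a2, false_or, true_and]
    · by_cases he2 : V / 2 % 2 = 0
      · have a2 : Ld (V / 2) y ↔ y = V / 2 / 2 := by
          constructor
          · intro h; have := Ld_le h; omega
          · rintro rfl; rw [Ld_rec]; exact ⟨he2, Or.inl rfl⟩
        rw [a2]
        simp only [he, he2, a4, false_or, true_and]
        by_cases hy2 : y = V / 2 / 2
        · rw [if_pos hy2, Kp_rec, hy2]
          constructor
          · rintro (h | ⟨_, h | h⟩)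
            · omega
            · exact h.1
            · have := Kp_le h; omega
          · intro h
            exact Or.inr ⟨he2, Or.inl ⟨h, by omega, by omega⟩⟩
        · rw [if_neg hy2]
          constructor
          · intro _; exact Or.inl ⟨by omega, by omega⟩
          · intro _; exact Or.inl ⟨by omega, by omega⟩
      · have a1 : ∀ y, ¬ Kp (V / 2) y := by intro y; rw [Kp_rec]; tauto
        have a2 : ¬ Ld (V / 2) y := by rw [Ld_rec]; tauto
        simp [a1, a2, he2, a4]
  · have a2 : ∀ y, ¬ Kp V y := by intro y; rw [Kp_rec]; tauto
    have a3 : ¬ Ld V y := by rw [Ld_rec]; tauto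
    simp [a2, a3]

theorem Mk_half (y : ℕ) : Mk (2 * y) y := by rw [Mk_rec]; left; omega
theorem Mk_half' (y : ℕ) : Mk (2 * y + 1) y := by rw [Mk_rec]; left; omega
theorem Ld_half (y : ℕ) : Ld (2 * y) y := by rw [Ld_rec]; omega
theorem Ld_odd {V : ℕ} (h : V % 2 = 1) (y : ℕ) : ¬ Ld V y := by rw [Ld_rec]; omega
theorem Kp_odd {V : ℕ} (h : V % 2 = 1) (y : ℕ) : ¬ Kp V y := by rw [Kp_rec]; omega
theorem Kp_half {y : ℕ} (hy : 1 ≤ y) : Kp (2 * y) y ↔ y % 2 = 0 := by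
  rw [Kp_rec]
  constructor
  · rintro ⟨_, h | h⟩
    · omega
    · have := Kp_le h; omega
  · intro h
    exact ⟨by omega, Or.inl ⟨by omega, by omega, by omega⟩⟩


set_option linter.unusedVariables false

open GS

/-- classical truth value -/
noncomputable def bb (p : Prop) : Bool := @decide p (Classical.propDecidable p)

theorem bb_iff (p : Prop) : bb p = true ↔ p := by unfold bb; exact @decide_eq_true_iff p (Classical.propDecidable p)
theorem bb_true {p : Prop} (h : p) : bb p = true := (bb_iff p).2 h
theorem bb_false {p : Prop} (h : ¬ p) : bb p = false := by
  rw [← Bool.not_eq_true, bb_iff]; exact h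
theorem bb_congr {p q : Prop} (h : p ↔ q) : bb p = bb q := by rw [propext h]
theorem bb_eq {p : Prop} {b : Bool} (h : p ↔ b = true) : bb p = b := by
  rw [Bool.eq_iff_iff, bb_iff]; exact h

def od (y : ℕ) : Bool := decide (y % 2 = 1)
theorem od_succ (y : ℕ) : od (y + 1) = !od y := by
  unfold od; rw [Bool.eq_iff_iff]; simp; omega
theorem od_iff (y : ℕ) : od y = true ↔ y % 2 = 1 := by simp [od]
theorem not_od_iff (y : ℕ) : (!od y) = true ↔ y % 2 = 0 := by simp [od]

noncomputable def cellP (V y : ℕ) : GS :=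
  cell false (od y) (bb (Mk V y)) (bb (Ld V y)) (bb (Kp V y)) false false false false

structure GRun (g : ℕ → ℕ → GS) (B : ℕ) : Prop where
  step : ∀ t y, y + 1 < B → g (t + 1) (y + 1) = gstep (g t y) (g t (y + 1)) (g t (y + 2))
  wall : ∀ t y, y ≤ B → isW (g t y) = true → g (t + 1) y = w

structure HHyp (g : ℕ → ℕ → GS) (U : ℕ) : Prop where
  run : GRun g (U / 2)
  W : isW (g 0 0) = true
  F1 : ∀ d, 1 ≤ d → 2 * d < U → ∃ b ok ol, g d d = cell false (od d) true true (!od d) true b ok ol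
  F2 : ∀ d, 1 ≤ d → 2 * d + 1 < U → g (d + 1) d = cellP (2 * d + 1) d
  R : 2 ≤ U → ∃ x y z, g (U - U / 2) (U / 2) =
    w0 (bb (Kp U (U / 2))) (bb (Ld U (U / 2))) (od (U / 2)) x y z

theorem GRun.wall_lt {g : ℕ → ℕ → GS} {B : ℕ} (h : GRun g B) {t y : ℕ} (hy : y ≤ B)
    (hw : isW (g t y) = true) : ∀ T, t < T → g T y = w := by
  intro T hT
  induction T with
  | zero => omega
  | succ T ih =>
    rcases Nat.lt_or_ge t T with h1 | h1
    · exact h.wall T y hy (by rw [ih h1]; rfl)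
    · have : T = t := by omega
      subst this
      exact h.wall T y hy hw

theorem HHyp.w_zero {g : ℕ → ℕ → GS} {U : ℕ} (h : HHyp g U) {t : ℕ} (ht : 1 ≤ t) : g t 0 = w :=
  h.run.wall_lt (by omega) h.W t (by omega)

theorem frontR_cellP (V y : ℕ) : frontR (cellP V y) = none := rfl
theorem frontL_cell0 (a1 a2 a3 a4 a5 a6 a7 a8 : Bool) :
    frontL (cell false a1 a2 a3 a4 a5 a6 a7 a8) = none := rfl
theorem frontR_cell1 (a1 a2 a3 a4 a5 a6 a7 a8 : Bool) :
    frontR (cell true a1 a2 a3 a4 a5 a6 a7 a8) = none := rfl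

theorem gstep_stay {l c r : GS} (hc : isW c = false) (hl : frontR l = none) (hr : frontL r = none) :
    gstep l c r = stay l c r := by
  unfold gstep; rw [hl, hr, if_neg (by rw [hc]; simp)]

theorem gstep_hitL {l c r : GS} {f : Fr} (hc : isW c = false) (hl : frontR l = none)
    (hr : frontL r = some f) : gstep l c r = hitL l c f := by
  unfold gstep; rw [hl, hr, if_neg (by rw [hc]; simp)]

/-- update of the marks -/
theorem marks_upd {V y : ℕ} (h1 : 1 ≤ y) (h2 : y < V / 2) :
    (bb (Kp V (y + 1)) && bb (Mk (V - 2) (y - 1))) = bb (Ld V y) ∧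
    (bb (Ld V y) || (bb (Mk (V - 1) y) && !bb (Ld V (y + 1)))) = bb (Mk V y) ∧
    (if bb (Ld V y) = true then !od y else bb (Kp V (y + 1))) = bb (Kp V y) := by
  refine ⟨?_, ?_, ?_⟩
  · symm; apply bb_eq; rw [Ld_step V y h1 h2]; simp [bb_iff]
  · symm; apply bb_eq; rw [Mk_step V y h1 h2]
    simp only [Bool.or_eq_true, Bool.and_eq_true, bb_iff, Bool.not_eq_true', ← Bool.not_eq_true]
  · symm; apply bb_eq; rw [Kp_step V y h1 h2]
    by_cases h : Ld V y
    · rw [if_pos h, if_pos (bb_true h), not_od_iff]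
    · rw [if_neg h, if_neg (by rw [bb_false h]; simp), bb_iff]

theorem HHyp.left {g : ℕ → ℕ → GS} {U : ℕ} (h : HHyp g U) {t y : ℕ} (hy : 1 ≤ y) (hty : y ≤ t)
    (hP : 2 ≤ y → g t (y - 1) = cellP (t + y - 1) (y - 1)) :
    frontR (g t (y - 1)) = none ∧ markL (g t (y - 1)) = bb (Mk (t + y - 1) (y - 1)) := by
  rcases Nat.lt_or_ge y 2 with h2 | h2
  · have : y = 1 := by omega
    subst this
    rw [h.w_zero hty]
    exact ⟨rfl, (bb_true (Mk_zero _)).symm⟩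
  · rw [hP h2]
    exact ⟨rfl, rfl⟩

theorem HHyp.P {g : ℕ → ℕ → GS} {U : ℕ} (h : HHyp g U) (t : ℕ) : ∀ y, 1 ≤ y → y + 1 ≤ t → t + y < U →
    g t y = cellP (t + y) y := by
  induction t with
  | zero => intro y _ hy; omega
  | succ t ih =>
    intro y h1 h2 h3
    rcases Nat.lt_or_ge y t with h4 | h4
    · have hs := h.run.step t (y - 1) (by omega)
      rw [show y - 1 + 1 = y by omega, show y - 1 + 2 = y + 1 by omega] at hs
      have hc := ih y h1 (by omega) (by omega)
      have hl := h.left (t := t) h1 (by omega) (by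
        intro h5
        rw [ih (y - 1) (by omega) (by omega) (by omega), show t + (y - 1) = t + y - 1 by omega])
      have hr : frontL (g t (y + 1)) = none ∧ kap0 (g t (y + 1)) = bb (Kp (t + 1 + y) (y + 1)) ∧
          land0 (g t (y + 1)) = bb (Ld (t + 1 + y) (y + 1)) := by
        rcases Nat.lt_or_ge (y + 1) t with h5 | h5
        · rw [ih (y + 1) (by omega) (by omega) (by omega)]
          rw [show t + (y + 1) = t + 1 + y by omega]
          exact ⟨rfl, rfl, rfl⟩
        · have e : t = y + 1 := by omega
          obtain ⟨b, ok, ol, hh⟩ := h.F1 (y + 1) (by omega) (by omega)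
          rw [e, hh]
          refine ⟨rfl, ?_, ?_⟩
          · symm; apply bb_eq
            rw [show y + 1 + 1 + y = 2 * (y + 1) by ring, Kp_half (by omega)]
            exact (not_od_iff _).symm
          · symm; apply bb_true
            rw [show y + 1 + 1 + y = 2 * (y + 1) by ring]
            exact Ld_half _
      rw [hs, gstep_stay (by rw [hc]; rfl) hl.1 hr.1, hc]
      have hm := marks_upd (V := t + 1 + y) (y := y) h1 (by omega)
      have e1 : t + y - 1 = t + 1 + y - 2 := by omega
      have e2 : t + y = t + 1 + y - 1 := by omega
      show stay0 _ _ _ _ _ _ = _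
      unfold stay0
      simp only [Bool.and_false, Bool.false_and, Bool.false_eq_true, if_false, hl.2, hr.2.1, hr.2.2]
      rw [e1, e2, hm.1, hm.2.1, hm.2.2]
      rfl
    · have e : t = y := by omega
      subst e
      rw [h.F2 t h1 (by omega), show 2 * t + 1 = t + 1 + t by ring]

theorem Mk_half2 {U a : ℕ} (h : Mk U a) : Mk U (a / 2) := by
  obtain ⟨s, rfl⟩ := h
  exact ⟨s + 1, by rw [pow_succ 2 (s + 1), ← Nat.div_div_eq_div_mul]⟩

theorem Mk_gap {U a y : ℕ} (h : Mk U a) (hy : Mk U y) (hlt : y < a) : y ≤ a / 2 := by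
  obtain ⟨s, rfl⟩ := h
  obtain ⟨s', rfl⟩ := hy
  have : s + 1 ≤ s' := by
    by_contra hc
    have : U / 2 ^ (s + 1) ≤ U / 2 ^ (s' + 1) :=
      Nat.div_le_div_left (Nat.pow_le_pow_right (by norm_num) (by omega)) (by positivity)
    omega
  rw [Nat.div_div_eq_div_mul, ← pow_succ]
  exact Nat.div_le_div_left (Nat.pow_le_pow_right (by norm_num) (by omega)) (by positivity)

theorem pred_div_pow {U m : ℕ} : (U - 1) / m = U / m ∨ (U - 1) / m + 1 = U / m := by
  rcases Nat.eq_zero_or_pos m with rfl | hm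
  · simp
  rcases Nat.eq_zero_or_pos U with rfl | hU
  · simp
  have := Nat.succ_div (a := U - 1) (b := m)
  rw [show U - 1 + 1 = U by omega] at this
  rw [this]
  split_ifs <;> simp

theorem Mk_odd_half {U a : ℕ} (h : Mk U a) (ha : a % 2 = 1) : Mk (U - 1) (a / 2) := by
  obtain ⟨s, rfl⟩ := h
  refine ⟨s + 1, ?_⟩
  rw [pow_succ 2 (s + 1), ← Nat.div_div_eq_div_mul]
  rcases pred_div_pow (U := U) (m := 2 ^ (s + 1)) with h | h <;> omega

theorem Mk_odd_gap {U a z : ℕ} (h : Mk U a) (ha : a % 2 = 1) (hz : Mk (U - 1) z) (h1 : a / 2 < z) :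
    a ≤ z + 1 := by
  obtain ⟨s, rfl⟩ := h
  obtain ⟨s', rfl⟩ := hz
  have hp := pred_div_pow (U := U) (m := 2 ^ (s + 1))
  have : s' ≤ s := by
    by_contra hc
    have h3 : (U - 1) / 2 ^ (s' + 1) ≤ (U - 1) / 2 ^ (s + 1 + 1) :=
      Nat.div_le_div_left (Nat.pow_le_pow_right (by norm_num) (by omega)) (by positivity)
    rw [pow_succ 2 (s + 1), ← Nat.div_div_eq_div_mul] at h3
    omega
  have h3 : (U - 1) / 2 ^ (s + 1) ≤ (U - 1) / 2 ^ (s' + 1) :=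
      Nat.div_le_div_left (Nat.pow_le_pow_right (by norm_num) (by omega)) (by positivity)
  omega

theorem Mk_exists (U : ℕ) : ∀ y, 1 ≤ y → y ≤ U / 2 → ∃ a, Mk U a ∧ a / 2 < y ∧ y ≤ a := by
  induction U using Nat.strong_induction_on with
  | _ U ih =>
  intro y h1 h2
  rcases Nat.lt_or_ge (U / 2 / 2) y with h | h
  · exact ⟨U / 2, by rw [Mk_rec]; exact Or.inl rfl, h, h2⟩
  · obtain ⟨a, h3, h4, h5⟩ := ih (U / 2) (by omega) y h1 h
    exact ⟨a, by rw [Mk_rec]; exact Or.inr h3, h4, h5⟩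

/-- one step of the returning front -/
theorem HHyp.hit {g : ℕ → ℕ → GS} {U : ℕ} (h : HHyp g U) {y : ℕ} {par b : Bool} (h1 : 1 ≤ y)
    (h2 : y < U / 2)
    (hf : frontL (g (U - (y + 1)) (y + 1)) = some ⟨par, b, bb (Kp U (y + 1)), bb (Ld U (y + 1))⟩) :
    g (U - y) y = if bb (Mk U y) = true
      then w0 (bb (Kp U y)) (bb (Ld U y)) (od y) (!par) true par
      else cell true par true true (!par) true b (bb (Kp U y)) (bb (Ld U y)) := by
  have hs := h.run.step (U - (y + 1)) (y - 1) (by omega)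
  rw [show y - 1 + 1 = y by omega, show y - 1 + 2 = y + 1 by omega,
    show U - (y + 1) + 1 = U - y by omega] at hs
  have hc := h.P (U - (y + 1)) y h1 (by omega) (by omega)
  have hl := h.left (t := U - (y + 1)) h1 (by omega) (by
        intro h5
        rw [h.P _ (y - 1) (by omega) (by omega) (by omega)]
        congr 1; omega)
  rw [hs, gstep_hitL (by rw [hc]; rfl) hl.1 hf, hc]
  have hm := marks_upd (V := U) (y := y) h1 (by omega)
  rw [show U - (y + 1) + y - 1 = U - 2 by omega] at hl
  rw [show U - (y + 1) + y = U - 1 by omega]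
  show (if _ then _ else _) = _
  simp only [hl.2, hm.1, hm.2.1, hm.2.2]

/-- the returning front on a segment -/
theorem HHyp.seg {g : ℕ → ℕ → GS} {U a : ℕ} (h : HHyp g U) (hM : Mk U a)
    (ha : ∃ x y z, g (U - a) a = w0 (bb (Kp U a)) (bb (Ld U a)) (od a) x y z) (e : ℕ) :
    a / 2 < a - (e + 1) → g (U - (a - (e + 1))) (a - (e + 1)) =
      cell true (od (e + 1)) true true (!od (e + 1)) true (od a) (bb (Kp U (a - (e + 1))))
        (bb (Ld U (a - (e + 1)))) := by
  have hle := Mk_le hM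
  obtain ⟨x, y, z, ha⟩ := ha
  induction e with
  | zero =>
    intro h1
    have := h.hit (y := a - 1) (par := true) (b := od a) (by omega) (by omega) (by
      rw [show a - 1 + 1 = a by omega, ha]; rfl)
    rw [show a - (0 + 1) = a - 1 by omega, this, if_neg]
    · rfl
    · rw [bb_iff]; intro hc; have := Mk_gap hM hc (by omega); omega
  | succ e ih =>
    intro h1
    have h2 := ih (by omega)
    have := h.hit (y := a - (e + 1 + 1)) (par := od (e + 1 + 1)) (b := od a) (by omega) (by omega) (by
      rw [show a - (e + 1 + 1) + 1 = a - (e + 1) by omega, h2, od_succ (e + 1)]; rfl)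
    rw [this, if_neg]
    rw [bb_iff]; intro hc; have := Mk_gap hM hc (by omega); omega

theorem HHyp.seg_end {g : ℕ → ℕ → GS} {U a : ℕ} (h : HHyp g U) (hM : Mk U a)
    (ha : ∃ x y z, g (U - a) a = w0 (bb (Kp U a)) (bb (Ld U a)) (od a) x y z) (h2 : 2 ≤ a) :
    g (U - a / 2) (a / 2) =
      w0 (bb (Kp U (a / 2))) (bb (Ld U (a / 2))) (od (a / 2)) (!od (a - a / 2)) true (od (a - a / 2)) := by
  have hle := Mk_le hM
  have hseg := h.seg hM ha
  obtain ⟨x, y, z, ha⟩ := ha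
  have hM2 := Mk_half2 hM
  have := h.hit (y := a / 2) (par := od (a - a / 2)) (b := od a) (by omega) (by omega) (by
    rcases Nat.lt_or_ge 3 a with h3 | h3
    · have := hseg (a - a / 2 - 2) (by omega)
      rw [show a - (a - a / 2 - 2 + 1) = a / 2 + 1 by omega] at this
      rw [this, show a - a / 2 = a - a / 2 - 2 + 1 + 1 by omega, od_succ (a - a / 2 - 2 + 1)]
      rfl
    · rcases Nat.lt_or_ge 2 a with h4 | h4
      · have e : a = 3 := by omega
        have := hseg 0 (by omega)
        subst e
        rw [show 3 / 2 + 1 = 3 - (0 + 1) by omega, this]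
        rfl
      · have e : a = 2 := by omega
        subst e
        rw [show 2 / 2 + 1 = 2 by omega, ha]
        rfl)
  rw [this, if_pos (bb_true hM2)]

theorem HHyp.chain {g : ℕ → ℕ → GS} {U : ℕ} (h : HHyp g U) (s : ℕ) : 1 ≤ U / 2 ^ (s + 1) →
    ∃ x y z, g (U - U / 2 ^ (s + 1)) (U / 2 ^ (s + 1)) =
      w0 (bb (Kp U (U / 2 ^ (s + 1)))) (bb (Ld U (U / 2 ^ (s + 1)))) (od (U / 2 ^ (s + 1))) x y z := by
  induction s with
  | zero =>
    intro h1
    simp only [zero_add, pow_one] at h1 ⊢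
    exact h.R (by omega)
  | succ s ih =>
    intro h1
    have e : U / 2 ^ (s + 1 + 1) = U / 2 ^ (s + 1) / 2 := by
      rw [pow_succ 2 (s + 1), ← Nat.div_div_eq_div_mul]
    rw [e] at h1 ⊢
    have := h.seg_end ⟨s, rfl⟩ (ih (by omega)) (by omega)
    exact ⟨_, _, _, this⟩

theorem HHyp.chain' {g : ℕ → ℕ → GS} {U a : ℕ} (h : HHyp g U) (hM : Mk U a) (h1 : 1 ≤ a) :
    ∃ x y z, g (U - a) a = w0 (bb (Kp U a)) (bb (Ld U a)) (od a) x y z := by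
  obtain ⟨s, rfl⟩ := hM
  exact h.chain s h1

/-- the mirrored sub-diagram -/
def sub (g : ℕ → ℕ → GS) (U a : ℕ) (t d : ℕ) : GS := mir (g (t + (U - a)) (a - d))

theorem sub_run {g : ℕ → ℕ → GS} {U a : ℕ} (h : GRun g (U / 2)) (ha : a ≤ U / 2) :
    GRun (sub g U a) (a / 2) where
  step t d hd := by
    unfold sub
    have := h.step (t + (U - a)) (a - (d + 2)) (by omega)
    rw [show a - (d + 2) + 1 = a - (d + 1) by omega, show a - (d + 2) + 2 = a - d by omega] at this
    rw [show t + 1 + (U - a) = t + (U - a) + 1 by omega, this, gstep_mir]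
  wall t d hd hw := by
    unfold sub at hw ⊢
    rw [isW_mir] at hw
    rw [show t + 1 + (U - a) = t + (U - a) + 1 by omega, h.wall _ _ (by omega) hw]
    rfl

theorem cellP_odd (d : ℕ) : cellP (2 * d + 1) d = cell false (od d) true false false false false false false := by
  unfold cellP
  rw [bb_true (Mk_half' d), bb_false (Ld_odd (by omega) d), bb_false (Kp_odd (by omega) d)]

theorem HHyp.sub {g : ℕ → ℕ → GS} {U a : ℕ} (h : HHyp g U) (hM : Mk U a) (h1 : 1 ≤ a) :
    HHyp (sub g U a) a := by
  have hle := Mk_le hM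
  have hch := h.chain' hM h1
  have hseg := h.seg hM hch
  have hW : isW (_root_.sub g U a 0 0) = true := by
    obtain ⟨x, y, z, hh⟩ := hch
    unfold _root_.sub
    rw [isW_mir]; simp [hh, isW]
  have hrun := sub_run h.run hle
  have F1 : ∀ d, 1 ≤ d → 2 * d < a → ∃ ok ol, _root_.sub g U a d d =
      cell false (od d) true true (!od d) true (od a) ok ol := by
    intro d hd h2
    have := hseg (d - 1) (by omega)
    rw [show d - 1 + 1 = d by omega] at this
    unfold _root_.sub
    rw [show d + (U - a) = U - (a - d) by omega, this]
    exact ⟨_, _, rfl⟩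
  -- the step after a fresh cell
  have key : ∀ d, 1 ≤ d → 2 * d < a →
      (∀ d, 1 ≤ d → d ≤ d - 1 → True) →
      (2 ≤ d → _root_.sub g U a d (d - 1) = cellP (2 * (d - 1) + 1) (d - 1)) →
      _root_.sub g U a (d + 1) d = if (od a && bb (Mk (U - 1) (a - (d + 1)))) = true
        then w0 false false (od d) false false false
        else cell false (od d) true false false false false false false := by
    intro d hd h2 _ hprev
    have hs := h.run.step (d + (U - a)) (a - (d + 1)) (by omega)
    rw [show a - (d + 1) + 1 = a - d by omega, show a - (d + 1) + 2 = a - (d - 1) by omega] at hs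
    have e : _root_.sub g U a (d + 1) d = gstep (_root_.sub g U a d (d - 1)) (_root_.sub g U a d d)
        (_root_.sub g U a d (d + 1)) := by
      unfold _root_.sub
      rw [gstep_mir, ← hs]
      congr 2; omega
    obtain ⟨ok, ol, hc⟩ := F1 d hd h2
    have hl : frontR (_root_.sub g U a d (d - 1)) = none := by
      rcases Nat.lt_or_ge d 2 with h3 | h3
      · have : d = 1 := by omega
        subst this
        rw [show 1 - 1 = 0 by omega, hrun.wall_lt (by omega) hW 1 (by omega)]; rfl
      · rw [hprev h3]; rfl
    have hr : _root_.sub g U a d (d + 1) = mir (cellP (U - 1) (a - (d + 1))) := by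
      unfold _root_.sub
      rw [h.P _ _ (by omega) (by omega) (by omega)]
      congr 2; omega
    rw [e, gstep_stay (by rw [hc]; rfl) hl (by rw [hr]; rfl), hc, hr]
    show (if _ then _ else _) = _
    simp only [cellP, mir, mark1, kap0, land0, Bool.not_false, Bool.true_and, Bool.false_and]
    rfl
  have F2 : ∀ d, 1 ≤ d → 2 * d + 1 < a → _root_.sub g U a (d + 1) d = cellP (2 * d + 1) d := by
    intro d hd
    induction d with
    | zero => omega
    | succ d ih =>
      intro h2
      rw [key (d + 1) hd (by omega) (by simp) (by
        intro h3
        exact ih (by omega) (by omega)), if_neg, cellP_odd]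
      rw [Bool.and_eq_true, bb_iff, od_iff]
      rintro ⟨h3, h4⟩
      have := Mk_odd_gap hM h3 h4 (by omega)
      omega
  refine ⟨hrun, hW, ?_, F2, ?_⟩
  · intro d hd h2
    obtain ⟨ok, ol, hh⟩ := F1 d hd h2
    exact ⟨_, _, _, hh⟩
  · intro h2
    rcases Nat.mod_two_eq_zero_or_one a with h3 | h3
    · have := h.seg_end hM hch h2
      unfold _root_.sub
      rw [show a - a / 2 + (U - a) = U - a / 2 by omega, show a - a / 2 = a / 2 by omega, this,
        show a - a / 2 = a / 2 by omega]
      have e1 : bb (Kp a (a / 2)) = !od (a / 2) := by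
        apply bb_eq
        rw [not_od_iff]
        conv_lhs => rw [show a = 2 * (a / 2) by omega]
        rw [show 2 * (a / 2) / 2 = a / 2 by omega]
        exact Kp_half (by omega)
      have e2 : bb (Ld a (a / 2)) = true := by
        apply bb_true
        rw [Ld_rec]; exact ⟨h3, Or.inl rfl⟩
      rw [e1, e2]
      exact ⟨_, _, _, rfl⟩
    · have := key (a / 2) (by omega) (by omega) (by simp) (by
        intro h4
        have := F2 (a / 2 - 1) (by omega) (by omega)
        rwa [show a / 2 - 1 + 1 = a / 2 by omega] at this)
      rw [show a - a / 2 = a / 2 + 1 by omega, this, if_pos]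
      · rw [bb_false (Kp_odd h3 _), bb_false (Ld_odd h3 _)]
        exact ⟨_, _, _, rfl⟩
      · rw [Bool.and_eq_true, bb_iff, od_iff]
        refine ⟨h3, ?_⟩
        rw [show a - (a / 2 + 1) = a / 2 by omega]
        exact Mk_odd_half hM h3

theorem HHyp.not_w {g : ℕ → ℕ → GS} {U y : ℕ} (h : HHyp g U) (h1 : 1 ≤ y) (h2 : y ≤ U / 2) :
    g (U - y) y ≠ w := by
  obtain ⟨a, hM, h3, h4⟩ := Mk_exists U y h1 h2
  have hch := h.chain' hM (by omega)
  rcases Nat.lt_or_ge y a with h5 | h5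
  · have := h.seg hM hch (a - y - 1)
    rw [show a - (a - y - 1 + 1) = y by omega] at this
    rw [this h3]
    simp
  · have : y = a := by omega
    subst this
    obtain ⟨_, _, _, hh⟩ := hch
    rw [hh]; simp

theorem HHyp.not_wall {g : ℕ → ℕ → GS} {U y : ℕ} (h : HHyp g U) (h1 : 1 ≤ y) (h2 : y ≤ U / 2) {t : ℕ}
    (ht : t + y < U) : isW (g t y) = false := by
  by_contra hc
  exact h.not_w h1 h2 (h.run.wall_lt h2 (by simpa using hc) _ (by omega))

theorem HHyp.C1 (U : ℕ) : ∀ g, HHyp g U → ∀ y, y ≤ U / 2 → isW (g (U - 1) y) = true := by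
  induction U using Nat.strong_induction_on with
  | _ U ih =>
  intro g h y hy
  rcases Nat.eq_zero_or_pos y with rfl | h1
  · rcases Nat.lt_or_ge U 2 with h2 | h2
    · rw [show U - 1 = 0 by omega]; exact h.W
    · rw [h.w_zero (by omega)]; rfl
  · obtain ⟨a, hM, h3, h4⟩ := Mk_exists U y h1 hy
    have hle := Mk_le hM
    have := ih a (by omega) _ (h.sub hM (by omega)) (a - y) (by omega)
    unfold _root_.sub at this
    rwa [isW_mir, show a - 1 + (U - a) = U - 1 by omega, show a - (a - y) = y by omega] at this

theorem HHyp.C2 (U : ℕ) : ∀ g, HHyp g U → ∀ t y, t + 1 < U → y ≤ U / 2 → isW (g t y) = true →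
    ∃ z, z ≤ U / 2 ∧ (z + 1 = y ∨ z = y + 1) ∧ isW (g t z) = false := by
  induction U using Nat.strong_induction_on with
  | _ U ih =>
  intro g h t y ht hy hw
  rcases Nat.eq_zero_or_pos y with rfl | h1
  · exact ⟨1, by omega, by omega, h.not_wall (by omega) (by omega) (by omega)⟩
  · have ht2 : U ≤ t + y := by
      by_contra hc
      rw [h.not_wall h1 hy (by omega)] at hw
      simp at hw
    obtain ⟨a, hM, h3, h4⟩ := Mk_exists U y h1 hy
    have hle := Mk_le hM
    obtain ⟨z, z1, z2, z3⟩ := ih a (by omega) _ (h.sub hM (by omega)) (t - (U - a)) (a - y)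
      (by omega) (by omega) (by
        unfold _root_.sub
        rwa [isW_mir, show t - (U - a) + (U - a) = t by omega, show a - (a - y) = y by omega])
    unfold _root_.sub at z3
    rw [isW_mir, show t - (U - a) + (U - a) = t by omega] at z3
    exact ⟨a - z, by omega, by omega, z3⟩


set_option linter.unusedVariables false

open GS

/-- the run of the firing squad layer on the segment `[0, N)` -/
def grun (N : ℤ) : ℕ → ℤ → GS
  | 0 => fun x => if x = 0 ∨ x = N - 1 then w0 false false false false false false
      else if 0 < x ∧ x < N - 1 then sleep else w
  | t + 1 => fun x => gstep (grun N t (x - 1)) (grun N t x) (grun N t (x + 1))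

theorem grun_out {N x : ℤ} (h : x < 0 ∨ N ≤ x) (h1 : 1 ≤ N) (t : ℕ) : grun N t x = w := by
  induction t with
  | zero => simp only [grun]; rw [if_neg (by omega), if_neg (by omega)]
  | succ t ih => simp only [grun]; rw [ih]; rfl

theorem grun_sym (N : ℤ) (t : ℕ) : ∀ x, grun N t (N - 1 - x) = mir (grun N t x) := by
  induction t with
  | zero =>
    intro x
    simp only [grun]
    by_cases h : x = 0 ∨ x = N - 1
    · rw [if_pos h, if_pos (by omega)]; rfl
    · rw [if_neg h, if_neg (by omega)]
      by_cases h : 0 < x ∧ x < N - 1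
      · rw [if_pos h, if_pos (by omega)]; rfl
      · rw [if_neg h, if_neg (by omega)]; rfl
  | succ t ih =>
    intro x
    simp only [grun]
    rw [← gstep_mir, ← ih, ← ih, ← ih]
    congr 2 <;> ring

def gl (U : ℕ) (t y : ℕ) : GS := grun (U + 1) t y

theorem gl_succ (U t y : ℕ) : gl U (t + 1) (y + 1) = gstep (gl U t y) (gl U t (y + 1)) (gl U t (y + 2)) := by
  unfold gl
  simp only [grun]
  congr 2 <;> push_cast <;> ring

theorem gl_wall {U t y : ℕ} (h : isW (gl U t y) = true) : gl U (t + 1) y = w := gstep_w h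

theorem gl_sym {U t y z : ℕ} (h : y + z = U) : gl U t y = mir (gl U t z) := by
  unfold gl
  rw [← grun_sym]
  congr 1; omega

theorem gl_zero (U : ℕ) : gl U 0 0 = w0 false false false false false false := by
  simp [gl, grun]

theorem gl_w {U t : ℕ} (h : 1 ≤ t) : gl U t 0 = w := by
  induction t with
  | zero => omega
  | succ t ih =>
    rcases Nat.eq_zero_or_pos t with rfl | h1
    · apply gl_wall; rw [gl_zero]; rfl
    · apply gl_wall; rw [ih h1]; rfl

theorem gl_top (U t : ℕ) : 2 * t < U → (∀ y, t < y → y + t < U → gl U t y = sleep) ∧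
    frontR (gl U t t) = some ⟨!od t, false, false, false⟩ ∧
    (1 ≤ t → gl U t t = cell false (od t) true true (!od t) true false false false) := by
  induction t with
  | zero =>
    intro h
    refine ⟨?_, ?_, by omega⟩
    · intro y h1 h2
      simp only [gl, grun]
      rw [if_neg (by omega), if_pos (by omega)]
    · rw [gl_zero]; rfl
  | succ t ih =>
    intro h
    obtain ⟨i1, i2, i3⟩ := ih (by omega)
    have hc : gl U (t + 1) (t + 1) =
        cell false (od (t + 1)) true true (!od (t + 1)) true false false false := by
      rw [gl_succ, i1 (t + 1) (by omega) (by omega), i1 (t + 2) (by omega) (by omega)]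
      unfold gstep
      rw [i2, od_succ]
      rfl
    refine ⟨?_, ?_, fun _ => hc⟩
    · intro y h1 h2
      obtain ⟨y, rfl⟩ : ∃ z, y = z + 1 := ⟨y - 1, by omega⟩
      rw [gl_succ, i1 y (by omega) (by omega), i1 (y + 1) (by omega) (by omega),
        i1 (y + 2) (by omega) (by omega)]
      rfl
    · rw [hc]; rfl

theorem gl_F2 (U d : ℕ) : 1 ≤ d → 2 * d + 1 < U → gl U (d + 1) d = cellP (2 * d + 1) d := by
  induction d with
  | zero => omega
  | succ d ih =>
    intro _ h
    have h1 := gl_top U (d + 1) (by omega)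
    have hl : frontR (gl U (d + 1) d) = none := by
      rcases Nat.eq_zero_or_pos d with rfl | h2
      · rw [gl_w (by omega)]; rfl
      · rw [ih h2 (by omega)]; rfl
    rw [gl_succ, h1.2.2 (by omega), h1.1 (d + 2) (by omega) (by omega), cellP_odd, gstep_stay rfl hl rfl]
    rfl

theorem gl_HHyp (U : ℕ) (hU : 1 ≤ U) : HHyp (gl U) U where
  run := ⟨fun t y _ => gl_succ U t y, fun t y _ h => gl_wall h⟩
  W := by rw [gl_zero]; rfl
  F1 d h1 h2 := ⟨_, _, _, (gl_top U d h2).2.2 h1⟩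
  F2 := gl_F2 U
  R := by
    intro h2
    obtain ⟨x, hx⟩ : ∃ x, U / 2 = x + 1 := ⟨U / 2 - 1, by omega⟩
    rw [hx]
    rcases Nat.mod_two_eq_zero_or_one U with h3 | h3
    · have ht := gl_top U x (by omega)
      rw [show U - (x + 1) = x + 1 by omega, gl_succ, ht.1 (x + 1) (by omega) (by omega),
        gl_sym (y := x + 2) (z := x) (by omega)]
      have e1 : bb (Kp U (x + 1)) = !od (x + 1) := by
        apply bb_eq
        rw [not_od_iff, show U = 2 * (x + 1) by omega]
        exact Kp_half (by omega)
      have e2 : bb (Ld U (x + 1)) = true := by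
        apply bb_true
        rw [Ld_rec]; exact ⟨h3, Or.inl hx⟩
      rw [e1, e2, od_succ]
      unfold gstep frontL
      rw [mir_mir, ht.2.1]
      exact ⟨_, _, _, rfl⟩
    · have ht := gl_top U (x + 1) (by omega)
      rw [show U - (x + 1) = x + 1 + 1 by omega, gl_succ, ht.2.2 (by omega),
        gl_sym (y := x + 2) (z := x + 1) (by omega), ht.2.2 (by omega),
        bb_false (Kp_odd h3 _), bb_false (Ld_odd h3 _)]
      have hl : frontR (gl U (x + 1) x) = none := by
        rcases Nat.eq_zero_or_pos x with rfl | h2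
        · rw [gl_w (by omega)]; rfl
        · rw [gl_F2 U x h2 (by omega)]; rfl
      rw [gstep_hitL rfl hl rfl]
      exact ⟨_, _, _, rfl⟩

theorem grun_fire (N : ℤ) (hN : 2 ≤ N) (x : ℤ) (hx : 0 ≤ x) (hxN : x < N) (t : ℕ) (ht : (t : ℤ) = N - 2) :
    isW (grun N t x) = true := by
  obtain ⟨U, rfl⟩ : ∃ U : ℕ, N = U + 1 := ⟨(N - 1).toNat, by omega⟩
  obtain ⟨x, rfl⟩ : ∃ z : ℕ, x = z := ⟨x.toNat, by omega⟩
  have h := HHyp.C1 U _ (gl_HHyp U (by omega))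
  have et : t = U - 1 := by omega
  subst et
  show isW (gl U (U - 1) x) = true
  rcases Nat.lt_or_ge (U / 2) x with h1 | h1
  · rw [gl_sym (z := U - x) (by omega), isW_mir]
    exact h _ (by omega)
  · exact h _ h1

theorem grun_wait (N : ℤ) (hN : 2 ≤ N) (x : ℤ) (hx : 0 ≤ x) (hxN : x < N) (t : ℕ) (ht : (t : ℤ) < N - 2) :
    (isW (grun N t (x - 1)) && isW (grun N t x) && isW (grun N t (x + 1))) = false := by
  obtain ⟨U, rfl⟩ : ∃ U : ℕ, N = U + 1 := ⟨(N - 1).toNat, by omega⟩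
  obtain ⟨x, rfl⟩ : ∃ z : ℕ, x = z := ⟨x.toNat, by omega⟩
  have h := HHyp.C2 U _ (gl_HHyp U (by omega))
  by_cases hw : isW (grun (U + 1) t x) = true
  · have key : ∃ z : ℕ, (z + 1 = x ∨ z = x + 1) ∧ isW (gl U t z) = false := by
      change isW (gl U t x) = true at hw
      rcases Nat.lt_or_ge (U / 2) x with h1 | h1
      · rw [gl_sym (z := U - x) (by omega), isW_mir] at hw
        obtain ⟨z, z1, z2, z3⟩ := h t _ (by omega) (by omega) hw
        refine ⟨U - z, by omega, ?_⟩
        rw [gl_sym (z := z) (by omega), isW_mir]; exact z3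
      · obtain ⟨z, z1, z2, z3⟩ := h t _ (by omega) h1 hw
        exact ⟨z, z2, z3⟩
    obtain ⟨z, rfl | rfl, hz⟩ := key
    · have : isW (grun (U + 1) t (((z + 1 : ℕ) : ℤ) - 1)) = false := by
        rw [show ((z + 1 : ℕ) : ℤ) - 1 = z by push_cast; ring]; exact hz
      rw [this]; simp
    · have : isW (grun (U + 1) t ((x : ℤ) + 1)) = false := hz
      rw [this]; simp
  · simp [hw]


set_option linter.unusedVariables false

open GS

/-! ### Normalised data -/

/-- forget the comparison results which are not in use -/
def nm (c : Ctl) (d : Dat) : Dat where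
  reg := d.reg
  R := d.R
  L := d.L
  Ksa := if c.Ka then d.Ksa else .eq
  Ksw := if c.Kw then d.Ksw else .eq
  Ts := fun b => if c.T b then d.Ts b else .eq
  Js0 := fun b => if c.J0 b then d.Js0 b else .eq
  Js1 := fun b => if c.J1 b then d.Js1 b else .eq
  Js2 := fun b => if c.J2 b then d.Js2 b else .eq

theorem nm_s1 {c : Ctl} (d : Dat) (h : c.Ka = true) : s1 (nm c d) = s1 d := by
  simp [s1, nm, h]

theorem nm_reg1 (c : Ctl) (d : Dat) : reg1 c (nm c d) = reg1 c d := by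
  unfold reg1
  by_cases h : c.Ka = true
  · rw [nm_s1 d h]; rfl
  · simp [h, nm]

theorem nm_R1 (c : Ctl) (d : Dat) : R1 c (nm c d) = R1 c d := by
  unfold R1
  by_cases h : c.Ka = true
  · rw [nm_s1 d h]; rfl
  · simp [h, nm]

theorem nm_sI {c : Ctl} (d : Dat) {b : Bool} (h : jinc c b = true) : sI c (nm c d) b = sI c d b := by
  unfold sI
  rw [nm_R1]
  unfold jinc at h
  by_cases h1 : c.Rm = true
  · simp [h1, nm]
  · have : c.J0 b = true := by simpa [h1] using h
    simp [nm, this]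

theorem nm_R2 (c : Ctl) (d : Dat) : R2 c (nm c d) = R2 c d := by
  unfold R2
  split_ifs with h1 h2
  · rw [nm_sI d h1, nm_R1]; rfl
  · rw [nm_sI d h2, nm_R1]; rfl
  · exact nm_R1 c d

theorem nm_L2 (c : Ctl) (d : Dat) (b : Bool) : L2 c (nm c d) b = L2 c d b := by
  unfold L2
  split_ifs with h1
  · rw [nm_sI d h1, nm_R1]; rfl
  · rfl

theorem nm_s3 {c : Ctl} (d : Dat) {b : Bool} (h : c.T b = true) : s3 c (nm c d) b = s3 c d b := by
  unfold s3
  rw [nm_reg1, nm_L2]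
  simp [nm, h]

theorem nm_reg3 (c : Ctl) (d : Dat) : reg3 c (nm c d) = reg3 c d := by
  unfold reg3
  rw [nm_reg1, nm_L2, nm_L2]
  split_ifs with h1 h2
  · rw [nm_s3 d (by simp at h1; exact h1.1.2)]
  · rw [nm_s3 d (by simp at h2; exact h2.1.2)]
  · rfl

theorem nm_L3 (c : Ctl) (d : Dat) (b : Bool) : L3 c (nm c d) b = L3 c d b := by
  unfold L3
  rw [nm_reg1, nm_L2]
  by_cases h : c.T b = true
  · rw [nm_s3 d h]
  · simp [h]

theorem nm_sE {l z : Ctl} (dl dz : Dat) {b : Bool} (h : jedge l z b = true) :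
    sE l (nm l dl) z (nm z dz) b = sE l dl z dz b := by
  unfold sE
  rw [nm_R2, nm_L3]
  unfold jedge at h
  by_cases h1 : l.Rm = true
  · simp [h1]
  · have : z.J2 b = true := by simpa [h1] using h
    simp [nm, this]

theorem nm_R4 (l z : Ctl) (dl dz : Dat) : R4 l (nm l dl) z (nm z dz) = R4 l dl z dz := by
  unfold R4
  rw [nm_R2, nm_L3, nm_L3]
  split_ifs with h1 h2
  · rw [nm_sE _ _ h1]
  · rw [nm_sE _ _ h2]
  · rfl

theorem nm_L4 (l z : Ctl) (dl dz : Dat) (b : Bool) : L4 l (nm l dl) z (nm z dz) b = L4 l dl z dz b := by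
  unfold L4
  rw [nm_R2, nm_L3]
  split_ifs with h1
  · rw [nm_sE _ _ h1]
  · rfl

theorem nm_readout (c : Ctl) (d : Dat) : readout c (nm c d) = readout c d := by
  unfold readout
  rw [nm_reg1]; rfl

theorem nm_dstep (l c r : Ctl) (dl d dr : Dat) :
    nm (cstep l c r) (dstep l (nm l dl) c (nm c d) r (nm r dr)) =
      nm (cstep l c r) (dstep l dl c d r dr) := by
  have e1 : reg3 c (nm c d) = reg3 c d := nm_reg3 c d
  unfold nm
  congr 1
  · show (if launchR l c then reg3 c (nm c d) else R4 l (nm l dl) c (nm c d)) = _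
    rw [nm_reg3, nm_R4]; rfl
  · funext b
    exact nm_L4 c r d dr b
  · show (if (if c.kd = .ms then nRm l c else l.Kw) = true then
        (if c.kd = .ms then _ else if l.Kw = true then dl.Ksw else .eq) else _) =
        (if (if c.kd = .ms then nRm l c else l.Kw) = true then (if c.kd = .ms then _ else dl.Ksw) else _)
    split_ifs <;> rfl
  · show (if (c.Ka && !decide (c.kd = .ls)) = true then s1 (nm c d) else _) =
      (if (c.Ka && !decide (c.kd = .ls)) = true then s1 d else _)
    split_ifs with h
    · exact nm_s1 d (by simp at h; exact h.1)
    · rfl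
  · funext b
    show (if (if c.kd = .ms then _ else l.T b) = true then
        (if c.kd = .ms then _ else s3 l (nm l dl) b) else _) =
        (if (if c.kd = .ms then _ else l.T b) = true then (if c.kd = .ms then _ else s3 l dl b) else _)
    by_cases h : c.kd = .ms
    · simp [h]
    · simp only [h, if_false]
      split_ifs with h2
      · exact nm_s3 dl h2
      · rfl
  · funext b
    show (if c.J1 b = true then (if c.J1 b = true then d.Js1 b else _) else _) =
      (if c.J1 b = true then d.Js1 b else _)
    split_ifs <;> rfl
  · funext b
    show (if (jedge l c b && !l.Rl) = true then sE l (nm l dl) c (nm c d) b else _) =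
      (if (jedge l c b && !l.Rl) = true then sE l dl c d b else _)
    split_ifs with h
    · exact nm_sE dl d (by simp at h; exact h.1)
    · rfl
  · funext b
    show (if (jinc l b && !l.Rl) = true then sI l (nm l dl) b else _) =
      (if (jinc l b && !l.Rl) = true then sI l dl b else _)
    split_ifs with h
    · exact nm_sI dl (by simp at h; exact h.1)
    · rfl

theorem cstep_init (κl κ κr : Kd) : cstep (.init κl) (.init κ) (.init κr) = .init κ := by
  simp [cstep, Ctl.init, nRm, nLm, nS0, lau, launchR, jinc, jedge, lmE]
  refine ⟨?_, ?_, ?_⟩ <;> funext b <;> cases κr <;> simp [nLm, nS0, lau]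

theorem dstep_init (κl κ κr : Kd) (bl b br : Bool) :
    nm (.init κ) (dstep (.init κl) (.init bl) (.init κ) (.init b) (.init κr) (.init br)) = .init b := by
  simp [nm, dstep, Ctl.init, Dat.init, reg3, reg1, launchR, R4, R2, R1, jinc, jedge, lmE, lau, L4, L3, L2]

/-! ### Finiteness -/

instance : Finite Kd := Finite.of_injective (fun κ : Kd => (decide (κ = .ms), decide (κ = .ls))) (by
  intro a b; cases a <;> cases b <;> simp)

instance : Finite Ctl := Finite.of_injective
  (fun c : Ctl => ((c.kd, c.Rp, c.Rm, c.Rl, c.dR, c.dL), (c.Lp, c.Lm, c.T, c.Ka, c.Kw),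
    (c.J0, c.J1, c.J2, c.WL, c.S0, c.S1))) (by
  rintro ⟨⟩ ⟨⟩ h
  simp only [Prod.mk.injEq] at h
  obtain ⟨⟨rfl, rfl, rfl, rfl, rfl, rfl⟩, ⟨rfl, rfl, rfl, rfl, rfl⟩, ⟨rfl, rfl, rfl, rfl, rfl, rfl⟩⟩ := h
  rfl)

instance : Finite Ordering := Finite.of_injective
  (fun o : Ordering => (decide (o = .lt), decide (o = .eq))) (by
  intro a b; cases a <;> cases b <;> simp)

instance : Finite Dat := Finite.of_injective
  (fun d : Dat => ((d.reg, d.R, d.L, d.Ksa, d.Ksw), (d.Ts, d.Js0, d.Js1, d.Js2))) (by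
  rintro ⟨⟩ ⟨⟩ h
  simp only [Prod.mk.injEq] at h
  obtain ⟨⟨rfl, rfl, rfl, rfl, rfl⟩, ⟨rfl, rfl, rfl, rfl⟩⟩ := h
  rfl)

instance : Finite GS := Finite.of_surjective
  (fun p : (Unit ⊕ Unit) ⊕ ((Fin 6 → Bool) ⊕ (Fin 9 → Bool)) => match p with
    | .inl (.inl _) => GS.sleep
    | .inl (.inr _) => GS.w
    | .inr (.inl a) => GS.w0 (a 0) (a 1) (a 2) (a 3) (a 4) (a 5)
    | .inr (.inr a) => GS.cell (a 0) (a 1) (a 2) (a 3) (a 4) (a 5) (a 6) (a 7) (a 8)) (by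
  rintro (_ | _ | ⟨a, b, c, d, e, f⟩ | ⟨a, b, c, d, e, f, g, h, i⟩)
  · exact ⟨.inl (.inl ()), rfl⟩
  · exact ⟨.inl (.inr ()), rfl⟩
  · exact ⟨.inr (.inl ![a, b, c, d, e, f]), rfl⟩
  · exact ⟨.inr (.inr ![a, b, c, d, e, f, g, h, i]), rfl⟩)

/-! ### The automaton -/

inductive QQ
  | q
  | E
  | act (C : Ctl) (D : Dat) (G : GS)
  | fin (C : Ctl) (D : Dat) (a b : Bool) (o : Option Bool) (sb : Bool)

instance : Finite QQ := Finite.of_surjective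
  (fun p : (Unit ⊕ Unit) ⊕ ((Ctl × Dat × GS) ⊕ (Ctl × Dat × Bool × Bool × Option Bool × Bool)) =>
    match p with
    | .inl (.inl _) => QQ.q
    | .inl (.inr _) => QQ.E
    | .inr (.inl (C, D, G)) => QQ.act C D G
    | .inr (.inr (C, D, a, b, o, sb)) => QQ.fin C D a b o sb) (by
  rintro (_ | _ | ⟨C, D, G⟩ | ⟨C, D, a, b, o, sb⟩)
  · exact ⟨.inl (.inl ()), rfl⟩
  · exact ⟨.inl (.inr ()), rfl⟩
  · exact ⟨.inr (.inl (C, D, G)), rfl⟩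
  · exact ⟨.inr (.inr (C, D, a, b, o, sb)), rfl⟩)

namespace QQ

def vC : QQ → Ctl
  | act C _ _ => C
  | fin C _ _ _ _ _ => C
  | _ => Ctl.init .pl

def vD : QQ → Dat
  | act _ D _ => D
  | fin _ D _ _ _ _ => D
  | _ => Dat.init false

def vG : QQ → GS
  | act _ _ G => G
  | _ => GS.w

def tokA : QQ → Bool
  | fin _ _ a _ _ _ => a
  | _ => false

def tokB : QQ → Bool
  | fin _ _ _ b _ _ => b
  | _ => false

def isq : QQ → Bool
  | q => true
  | _ => false

def isfin : QQ → Bool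
  | fin .. => true
  | _ => false

def isbody : QQ → Bool
  | act .. => true
  | fin .. => true
  | _ => false

def nC (l c r : QQ) : Ctl := cstep (vC l) (vC c) (vC r)
def nD (l c r : QQ) : Dat := nm (nC l c r) (dstep (vC l) (vD l) (vC c) (vD c) (vC r) (vD r))

def finish (l c r : QQ) (C : Ctl) : Option Bool → Bool → QQ
  | some x, true => act (.init C.kd) (.init x) sleep
  | o, sb => fin (nC l c r) (nD l c r) (!decide (C.kd = .ms) && tokA l) (!decide (C.kd = .ls) && tokB r) o sb

def rule (l c r : QQ) : QQ :=
  match c with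
  | q => if isbody l || isbody r then E else q
  | E => E
  | act C D G =>
    if isfin l || isfin r then c
    else if isq l || isq r then
      act (start (isq l) (isq r) C) (startD (isq l) D) (w0 false false false false false false)
    else if isW (vG l) && isW G && isW (vG r) then
      fin (nC l c r) (nD l c r) (decide (C.kd = .ms)) (decide (C.kd = .ls)) none false
    else act (nC l c r) (nD l c r) (gstep (vG l) G (vG r))
  | fin C D a b o sb =>
    finish l c r C (if a then some (readout C D) else o) (sb || b)

end QQ


set_option linter.unusedVariables false

open GS QQ

/-! ### The complete run -/

/-- last time of the cell `x` -/
def lastT (n k x : ℤ) : ℤ := n * k - 1 + max (x % k) (k - 1 - x % k)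

/-- final bit of cell `x` -/
noncomputable def outB (n k : ℤ) (v : ℤ → ℕ) (x : ℤ) : Bool := bt k (Fin_ n v (n - 1 - x / k)) (x % k)

open Classical in
noncomputable def cfg (n k : ℤ) (v : ℤ → ℕ) (wd : ℤ → Bool) (s : ℕ) (x : ℤ) : QQ :=
  if 0 ≤ x ∧ x < n * k then
    if (s : ℤ) ≤ n * k - 2 then
      act (crun n k s x) (nm (crun n k s x) (drun n k wd s x)) (grun (n * k) s x)
    else if (s : ℤ) ≤ lastT n k x then
      fin (crun n k s x) (nm (crun n k s x) (drun n k wd s x)) (decide ((s : ℤ) = n * k - 1 + x % k))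
        (decide ((s : ℤ) = n * k - 1 + (k - 1 - x % k)))
        (if (s : ℤ) > n * k - 1 + x % k then some (outB n k v x) else none)
        (decide ((s : ℤ) > n * k - 1 + (k - 1 - x % k)))
    else act (.init (kdAt k x)) (.init (outB n k v x)) sleep
  else if x = -1 ∨ x = n * k then E else q

section
variable {n k : ℤ} {v : ℤ → ℕ} {wd : ℤ → Bool}

theorem cfg_out {s : ℕ} {x : ℤ} (h : ¬ (0 ≤ x ∧ x < n * k)) :
    cfg n k v wd s x = if x = -1 ∨ x = n * k then E else q := by
  unfold cfg; rw [if_neg h]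

theorem cfg_act {s : ℕ} {x : ℤ} (h : 0 ≤ x ∧ x < n * k) (hs : (s : ℤ) ≤ n * k - 2) :
    cfg n k v wd s x =
      act (crun n k s x) (nm (crun n k s x) (drun n k wd s x)) (grun (n * k) s x) := by
  unfold cfg; rw [if_pos h, if_pos hs]

open Classical in
theorem cfg_fin {s : ℕ} {x : ℤ} (h : 0 ≤ x ∧ x < n * k) (hs : n * k - 1 ≤ (s : ℤ))
    (hs' : (s : ℤ) ≤ lastT n k x) :
    cfg n k v wd s x = fin (crun n k s x) (nm (crun n k s x) (drun n k wd s x)) (decide ((s : ℤ) = n * k - 1 + x % k))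
        (decide ((s : ℤ) = n * k - 1 + (k - 1 - x % k)))
        (if (s : ℤ) > n * k - 1 + x % k then some (outB n k v x) else none)
        (decide ((s : ℤ) > n * k - 1 + (k - 1 - x % k))) := by
  unfold cfg; rw [if_pos h, if_neg (by omega), if_pos hs']

theorem cfg_end {s : ℕ} {x : ℤ} (h : 0 ≤ x ∧ x < n * k) (hs : n * k - 1 ≤ (s : ℤ))
    (hs' : lastT n k x < (s : ℤ)) :
    cfg n k v wd s x = act (.init (kdAt k x)) (.init (outB n k v x)) sleep := by
  unfold cfg; rw [if_pos h, if_neg (by omega), if_neg (by omega)]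

theorem drun_out {t : ℕ} {x : ℤ} (h : ¬ (0 ≤ x ∧ x < n * k)) : drun n k wd t x = Dat.init false := by
  cases t <;> simp only [drun, h, if_false]

theorem nm_init (κ : Kd) (b : Bool) : nm (.init κ) (.init b) = .init b := rfl

/-- what a cell needs to know of its alive neighbour -/
theorem cfg_view {s : ℕ} {x : ℤ} (hN : 2 ≤ n * k) (h1 : -1 ≤ x) (h2 : x ≤ n * k)
    (hs : 0 ≤ x → x < n * k → (s : ℤ) ≤ n * k - 2 ∨ (s : ℤ) ≤ lastT n k x) :
    vC (cfg n k v wd s x) = crun n k s x ∧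
    vD (cfg n k v wd s x) = nm (crun n k s x) (drun n k wd s x) ∧
    isq (cfg n k v wd s x) = false ∧
    ((s : ℤ) ≤ n * k - 2 → isfin (cfg n k v wd s x) = false ∧ vG (cfg n k v wd s x) = grun (n * k) s x) := by
  by_cases h : 0 ≤ x ∧ x < n * k
  · by_cases h3 : (s : ℤ) ≤ n * k - 2
    · rw [cfg_act h h3]
      exact ⟨rfl, rfl, rfl, fun _ => ⟨rfl, rfl⟩⟩
    · rw [cfg_fin h (by omega) (by have := hs h.1 h.2; omega)]
      exact ⟨rfl, rfl, rfl, fun h => absurd h h3⟩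
  · rw [cfg_out h, if_pos (by omega), crun_out h, drun_out h, grun_out (by omega) (by omega)]
    exact ⟨rfl, rfl, rfl, fun _ => ⟨rfl, rfl⟩⟩

theorem kd_iff (hk : 2 ≤ k) (x : ℤ) : (kdAt k x = .ms ↔ x % k = 0) ∧ (kdAt k x = .ls ↔ x % k = k - 1) := by
  have h0 := Int.emod_nonneg x (show k ≠ 0 by omega)
  have h1 := Int.emod_lt_of_pos x (show 0 < k by omega)
  have e1 : k ∣ x ↔ x % k = 0 := Int.dvd_iff_emod_eq_zero
  have e2 : k ∣ x + 1 ↔ x % k = k - 1 := by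
    constructor
    · intro h
      by_contra hc
      have h2 : (x % k + 1) % k = 0 := by
        rw [Int.emod_add_emod]; exact Int.emod_eq_zero_of_dvd h
      rw [Int.emod_eq_of_lt (by omega) (by omega)] at h2
      omega
    · intro h
      rw [Int.dvd_iff_emod_eq_zero, ← Int.emod_add_emod, h]
      simp
  unfold kdAt
  simp only [e1, e2]
  constructor
  · split_ifs with a b <;> simp [a]
  · split_ifs with a b
    · simp; omega
    · simp [b]
    · simp [b]

theorem mod_pred (hk : 2 ≤ k) (x : ℤ) : (x - 1) % k = if x % k = 0 then k - 1 else x % k - 1 := by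
  have h0 := Int.emod_nonneg x (show k ≠ 0 by omega)
  have h1 := Int.emod_lt_of_pos x (show 0 < k by omega)
  split_ifs with h
  · rw [← Int.emod_sub_emod, h, ← Int.add_emod_right, Int.emod_eq_of_lt] <;> omega
  · rw [← Int.emod_sub_emod, Int.emod_eq_of_lt] <;> omega

theorem mod_succ (hk : 2 ≤ k) (x : ℤ) : (x + 1) % k = if x % k = k - 1 then 0 else x % k + 1 := by
  have h0 := Int.emod_nonneg x (show k ≠ 0 by omega)
  have h1 := Int.emod_lt_of_pos x (show 0 < k by omega)
  split_ifs with h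
  · rw [← Int.emod_add_emod, h]; simp
  · rw [← Int.emod_add_emod, Int.emod_eq_of_lt] <;> omega

theorem lastT_near (hk : 2 ≤ k) (x : ℤ) :
    lastT n k x ≤ lastT n k (x - 1) + 1 ∧ lastT n k x ≤ lastT n k (x + 1) + 1 := by
  have h0 := Int.emod_nonneg x (show k ≠ 0 by omega)
  have h1 := Int.emod_lt_of_pos x (show 0 < k by omega)
  unfold lastT
  rw [mod_pred hk, mod_succ hk]
  split_ifs <;> omega

/-- one step of the complete automaton -/
theorem cfg_step (hk : 2 ≤ k) (hN : 2 ≤ n * k)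
    (hro : ∀ (x : ℤ), 0 ≤ x → x < n * k → ∀ t : ℕ, (t : ℤ) = n * k - 1 + x % k →
      readout (crun n k t x) (drun n k wd t x) = outB n k v x) (s : ℕ) (x : ℤ) :
    rule (cfg n k v wd s (x - 1)) (cfg n k v wd s x) (cfg n k v wd s (x + 1)) = cfg n k v wd (s + 1) x := by
  have hm0 := Int.emod_nonneg x (show k ≠ 0 by omega)
  have hm1 := Int.emod_lt_of_pos x (show 0 < k by omega)
  have hkd := kd_iff hk x
  by_cases h : 0 ≤ x ∧ x < n * k
  · by_cases hA : (s : ℤ) ≤ n * k - 2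
    · -- first phase
      have hl := cfg_view (v := v) (wd := wd) (s := s) (x := x - 1) hN (by omega) (by omega) (fun _ _ => Or.inl hA)
      have hr := cfg_view (v := v) (wd := wd) (s := s) (x := x + 1) hN (by omega) (by omega) (fun _ _ => Or.inl hA)
      have hc := cfg_view (v := v) (wd := wd) (s := s) (x := x) hN (by omega) (by omega) (fun _ _ => Or.inl hA)
      have hnC : nC (cfg n k v wd s (x - 1)) (cfg n k v wd s x) (cfg n k v wd s (x + 1)) = crun n k (s + 1) x := by
        unfold nC; rw [hl.1, hr.1, hc.1, crun_succ h.1 h.2]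
      have hnD : nD (cfg n k v wd s (x - 1)) (cfg n k v wd s x) (cfg n k v wd s (x + 1)) =
          nm (crun n k (s + 1) x) (drun n k wd (s + 1) x) := by
        unfold nD
        rw [hnC, hl.1, hr.1, hc.1, hl.2.1, hr.2.1, hc.2.1, crun_succ h.1 h.2, nm_dstep, ← drun_succ h.1 h.2]
      rw [cfg_act h hA] at hnC hnD ⊢
      unfold rule
      simp only [hl.2.2.1, hr.2.2.1, (hl.2.2.2 hA).1, (hr.2.2.2 hA).1, Bool.or_false, hnC, hnD,
        (hl.2.2.2 hA).2, (hr.2.2.2 hA).2]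
      rw [if_neg (by simp), if_neg (by simp)]
      rcases hA.lt_or_eq with hlt | heq
      · rw [grun_wait (n * k) hN x h.1 h.2 s hlt, if_neg (by simp), cfg_act h (by push_cast; omega)]
        rfl
      · have f : ∀ y, isW (grun (n * k) s y) = true := by
          intro y
          by_cases hy : 0 ≤ y ∧ y < n * k
          · exact grun_fire (n * k) hN y hy.1 hy.2 s heq
          · rw [grun_out (by omega) (by omega)]; rfl
        rw [f, f, f, if_pos (by simp), cfg_fin h (by push_cast; omega) (by unfold lastT; push_cast; omega),
          c_kd s h.1 h.2]
        congr 1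
        · rw [decide_eq_decide, hkd.1]; push_cast; omega
        · rw [decide_eq_decide, hkd.2]; push_cast; omega
        · rw [if_neg (by push_cast; omega)]
        · symm; rw [decide_eq_false_iff_not]; push_cast; omega
    · by_cases hB : (s : ℤ) ≤ lastT n k x
      · rw [cfg_fin h (by omega) hB]
        have hout : (if decide ((s : ℤ) = n * k - 1 + x % k) = true then
            some (readout (crun n k s x) (nm (crun n k s x) (drun n k wd s x)))
            else if (s : ℤ) > n * k - 1 + x % k then some (outB n k v x) else none) =
            if (s : ℤ) + 1 > n * k - 1 + x % k then some (outB n k v x) else none := by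
          by_cases h1 : (s : ℤ) = n * k - 1 + x % k
          · rw [if_pos (by simpa using h1), nm_readout, hro x h.1 h.2 s h1, if_pos (by omega)]
          · rw [if_neg (by simpa using h1)]
            by_cases h2 : (s : ℤ) > n * k - 1 + x % k
            · rw [if_pos h2, if_pos (by omega)]
            · rw [if_neg h2, if_neg (by omega)]
        have hsb : (decide ((s : ℤ) > n * k - 1 + (k - 1 - x % k)) || decide ((s : ℤ) = n * k - 1 + (k - 1 - x % k))) =
            decide ((s : ℤ) + 1 > n * k - 1 + (k - 1 - x % k)) := by
          rw [Bool.eq_iff_iff]; simp; omega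
        unfold rule
        simp only []
        rw [hout, hsb]
        rcases hB.lt_or_eq with hlt | heq
        · -- still finishing
          have hnear := lastT_near (n := n) hk x
          have hl := cfg_view (v := v) (wd := wd) (s := s) (x := x - 1) hN (by omega) (by omega)
            (fun _ _ => Or.inr (by omega))
          have hr := cfg_view (v := v) (wd := wd) (s := s) (x := x + 1) hN (by omega) (by omega)
            (fun _ _ => Or.inr (by omega))
          have hfin : ∀ l c r C o sb, ¬ (o ≠ none ∧ sb = true) → finish l c r C o sb =
              fin (nC l c r) (nD l c r) (!decide (C.kd = .ms) && tokA l) (!decide (C.kd = .ls) && tokB r) o sb := by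
            intro l c r C o sb hh
            cases o <;> cases sb <;> first | rfl | (exfalso; apply hh; simp)
          have hlast : (s : ℤ) < n * k - 1 + x % k ∨ (s : ℤ) < n * k - 1 + (k - 1 - x % k) := by
            unfold lastT at hlt; omega
          rw [hfin _ _ _ _ _ _ (by
            rintro ⟨h1, h2⟩
            rw [decide_eq_true_iff] at h2
            apply h1
            rw [if_neg (by omega)])]
          rw [cfg_fin h (by push_cast; omega) (by push_cast; omega), c_kd s h.1 h.2]
          have hnC : ∀ C' D' a b o sb, C' = crun n k s x →
              nC (cfg n k v wd s (x - 1)) (fin C' D' a b o sb) (cfg n k v wd s (x + 1)) = crun n k (s + 1) x := by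
            intro C' D' a b o sb hC
            unfold nC; rw [hl.1, hr.1, crun_succ h.1 h.2]
            simp only [vC, hC]
          congr 1
          · exact hnC _ _ _ _ _ _ rfl
          · unfold nD
            rw [hnC _ _ _ _ _ _ rfl, hl.1, hr.1, hl.2.1, hr.2.1, drun_succ h.1 h.2, crun_succ h.1 h.2]
            exact nm_dstep _ _ _ _ _ _
          · by_cases h0 : x % k = 0
            · have e : kdAt k x = .ms := hkd.1.2 h0
              symm
              simp only [e, decide_true, Bool.not_true, Bool.false_and, decide_eq_false_iff_not]
              push_cast; omega
            · have e : kdAt k x ≠ .ms := fun hh => h0 (hkd.1.1 hh)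
              have hx : 0 ≤ x - 1 := by
                by_contra hc
                have : x = 0 := by omega
                rw [this] at h0; simp at h0
              rw [cfg_fin ⟨hx, by omega⟩ (by omega) (by omega)]
              simp only [e, tokA, decide_false, Bool.not_false, Bool.true_and, decide_eq_decide]
              rw [mod_pred hk, if_neg h0]
              push_cast; omega
          · by_cases h0 : x % k = k - 1
            · have e : kdAt k x = .ls := hkd.2.2 h0
              symm
              simp only [e, decide_true, Bool.not_true, Bool.false_and, decide_eq_false_iff_not]
              push_cast; omega
            · have e : kdAt k x ≠ .ls := fun hh => h0 (hkd.2.1 hh)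
              have hx : x + 1 < n * k := by
                by_contra hc
                have : x = n * k - 1 := by omega
                apply h0
                rw [this, mod_pred hk]
                simp
              rw [cfg_fin ⟨by omega, hx⟩ (by omega) (by omega)]
              simp only [e, tokB, decide_false, Bool.not_false, Bool.true_and, decide_eq_decide]
              rw [mod_succ hk, if_neg h0]
              push_cast; omega
        · have : (s : ℤ) ≥ n * k - 1 + x % k ∧ (s : ℤ) ≥ n * k - 1 + (k - 1 - x % k) := by
            unfold lastT at heq; omega
          rw [if_pos (show (s : ℤ) + 1 > n * k - 1 + x % k by omega),
            decide_eq_true (show (s : ℤ) + 1 > n * k - 1 + (k - 1 - x % k) by omega), cfg_end h (by push_cast; omega) (by push_cast; omega)]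
          show act _ _ _ = _
          rw [c_kd s h.1 h.2]
      · rw [cfg_end h (by omega) (by omega), cfg_end (s := s + 1) h (by push_cast; omega) (by push_cast; omega)]
        have near : ∀ y, -1 ≤ y → y ≤ n * k → isq (cfg n k v wd s y) = false ∧
            (isfin (cfg n k v wd s y) = false → ∃ κ b, vC (cfg n k v wd s y) = .init κ ∧
              vD (cfg n k v wd s y) = .init b ∧ frontR (vG (cfg n k v wd s y)) = none ∧
              frontL (vG (cfg n k v wd s y)) = none) := by
          intro y y1 y2
          by_cases hy : 0 ≤ y ∧ y < n * k
          · by_cases hy2 : (s : ℤ) ≤ lastT n k y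
            · rw [cfg_fin hy (by omega) hy2]
              exact ⟨rfl, fun h => absurd h (by simp [isfin])⟩
            · rw [cfg_end hy (by omega) (by omega)]
              exact ⟨rfl, fun _ => ⟨_, _, rfl, rfl, rfl, rfl⟩⟩
          · rw [cfg_out hy, if_pos (by omega)]
            exact ⟨rfl, fun _ => ⟨_, _, rfl, rfl, rfl, rfl⟩⟩
        have hl := near (x - 1) (by omega) (by omega)
        have hr := near (x + 1) (by omega) (by omega)
        unfold rule
        simp only [hl.1, hr.1, Bool.or_false]
        by_cases hf : (isfin (cfg n k v wd s (x - 1)) || isfin (cfg n k v wd s (x + 1))) = true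
        · rw [if_pos hf]
        · rw [if_neg hf]
          simp only [Bool.or_eq_true, not_or, Bool.not_eq_true] at hf
          obtain ⟨κ, b, a1, a2, a3, a4⟩ := hl.2 hf.1
          obtain ⟨κ', b', c1, c2, c3, c4⟩ := hr.2 hf.2
          rw [if_neg (by simp), if_neg (by simp [isW])]
          congr 1
          · unfold nC; rw [a1, c1]; exact cstep_init _ _ _
          · unfold nD nC; rw [a1, c1, a2, c2]
            simp only [vC, vD]
            rw [cstep_init]
            exact dstep_init _ _ _ _ _ _
          · rw [gstep_stay rfl a3 c4]; rfl
  · rw [cfg_out h, cfg_out (s := s + 1) h]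
    by_cases h1 : x = -1 ∨ x = n * k
    · rw [if_pos h1]; rfl
    · rw [if_neg h1]
      have hl : isbody (cfg n k v wd s (x - 1)) = false := by
        rw [cfg_out (by omega)]; split_ifs <;> rfl
      have hr : isbody (cfg n k v wd s (x + 1)) = false := by
        rw [cfg_out (by omega)]; split_ifs <;> rfl
      simp [rule, hl, hr]

end


set_option linter.unusedVariables false

open GS QQ

/-! ### Encoding of the input and final assembly -/

def skd : CASym → Kd
  | .plain _ => .pl
  | .msb _ => .ms
  | .lsb _ => .ls

def sbit : CASym → Bool
  | .plain b => b
  | .msb b => b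
  | .lsb b => b

def emb (s : CASym) : QQ := act (.init (skd s)) (.init (sbit s)) sleep

theorem emb_eq {s s' : CASym} (h1 : skd s = skd s') (h2 : sbit s = sbit s') : s = s' := by
  cases s <;> cases s' <;> simp_all [skd, sbit]

theorem emb_inj : Function.Injective emb := by
  intro s s' h
  simp only [emb, QQ.act.injEq] at h
  exact emb_eq (congrArg Ctl.kd h.1) (congrArg Dat.reg h.2.1)

theorem blockValue_succ (k : ℕ) (b : Fin (k + 1) → Bool) :
    blockValue (k + 1) b = (if b 0 then 2 ^ k else 0) + blockValue k (fun j => b j.succ) := by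
  unfold blockValue
  rw [Fin.sum_univ_succ]
  congr 1
  apply Finset.sum_congr rfl
  intro j _
  have : k + 1 - 1 - (j.succ : Fin (k + 1)).val = k - 1 - j.val := by simp; omega
  rw [this]

theorem blockValue_lt (k : ℕ) (b : Fin k → Bool) : blockValue k b < 2 ^ k := by
  induction k with
  | zero => simp [blockValue]
  | succ k ih =>
    rw [blockValue_succ, pow_succ]
    have := ih (fun j => b j.succ)
    split_ifs <;> omega

theorem blockValue_testBit (k : ℕ) (b : Fin k → Bool) (j : Fin k) :
    (blockValue k b).testBit (k - 1 - j.val) = b j := by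
  induction k with
  | zero => exact j.elim0
  | succ k ih =>
    rw [blockValue_succ]
    have hlt := blockValue_lt k (fun j => b j.succ)
    refine Fin.cases ?_ (fun i => ?_) j
    · simp only [Fin.val_zero, Nat.add_sub_cancel, Nat.sub_zero]
      cases hb : b 0
      · simp [Nat.testBit_lt_two_pow hlt]
      · simp [Nat.testBit_two_pow_add_eq, Nat.testBit_lt_two_pow hlt]
    · have e : k + 1 - 1 - (i.succ : Fin (k + 1)).val = k - 1 - i.val := by simp; omega
      have hi := i.isLt
      have hh := ih (fun j => b j.succ) i
      rw [e]
      cases hb : b 0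
      · simpa using hh
      · rw [if_pos rfl, Nat.testBit_two_pow_add_gt (by omega)]
        exact hh

theorem wordSym_eq {n k : ℕ} (hk : 2 ≤ k) (w : Fin n → Fin k → Bool) {p : ℕ} (hp : p < n * k) :
    ∃ (h1 : p / k < n) (h2 : p % k < k),
      wordSym n k w p = blockSym k (w ⟨p / k, h1⟩) ⟨p % k, h2⟩ := by
  have h1 : p / k < n := Nat.div_lt_of_lt_mul (by rw [mul_comm]; exact hp)
  have h2 : p % k < k := Nat.mod_lt _ (by omega)
  refine ⟨h1, h2, ?_⟩
  unfold wordSym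
  rw [dif_pos ⟨h1, h2⟩]

theorem skd_blockSym {k : ℕ} (hk : 2 ≤ k) (b : Fin k → Bool) (p : ℕ) (h : p % k < k) :
    skd (blockSym k b ⟨p % k, h⟩) = kdAt k p := by
  have hd := kd_iff (k := (k : ℤ)) (by omega) (p : ℤ)
  have e : ((p : ℤ) % (k : ℤ)) = ((p % k : ℕ) : ℤ) := by push_cast; rfl
  rw [e] at hd
  unfold blockSym
  simp only
  split_ifs with h1 h2
  · exact (hd.1.2 (by omega)).symm
  · exact (hd.2.2 (by omega)).symm
  · have a : kdAt k p ≠ .ms := fun hh => h1 (by have := hd.1.1 hh; omega)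
    have c : kdAt k p ≠ .ls := fun hh => h2 (by have := hd.2.1 hh; omega)
    cases hh : kdAt k p
    all_goals first | rfl | exact absurd hh a | exact absurd hh c

theorem sbit_blockSym {k : ℕ} (b : Fin k → Bool) (j : Fin k) : sbit (blockSym k b j) = b j := by
  unfold blockSym; split_ifs <;> rfl

/-- the input bits and values as functions on `ℤ` -/
def wdZ (n k : ℕ) (w : Fin n → Fin k → Bool) (x : ℤ) : Bool := sbit (wordSym n k w x.toNat)

def valZ (n k : ℕ) (w : Fin n → Fin k → Bool) (s : ℤ) : ℕ :=
  if h : s.toNat < n then blockValue k (w ⟨s.toNat, h⟩) else 0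

theorem valZ_cast {n k : ℕ} (w : Fin n → Fin k → Bool) (i : Fin n) :
    valZ n k w ((i : ℕ) : ℤ) = blockValue k (w i) := by
  unfold valZ; simp

theorem bt_block {k : ℕ} (b : Fin k → Bool) (j : Fin k) :
    bt (k : ℤ) (blockValue k b) ((j : ℕ) : ℤ) = b j := by
  have : ((k : ℤ) - 1 - ((j : ℕ) : ℤ)).toNat = k - 1 - j.val := by have := j.isLt; omega
  unfold bt
  rw [this, blockValue_testBit]

section
variable {n k : ℕ} (hn : 1 ≤ n) (hk : 2 ≤ k) (w : Fin n → Fin k → Bool)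

theorem init_in {x : ℤ} (h : 0 ≤ x ∧ x < (n : ℤ) * k) (hk : 2 ≤ k) :
    initConfig emb q n k w x = act (.init (kdAt k x)) (.init (wdZ n k w x)) sleep := by
  obtain ⟨p, rfl⟩ := Int.eq_ofNat_of_zero_le h.1
  have hp : p < n * k := by exact_mod_cast h.2
  unfold initConfig wdZ
  rw [if_pos ⟨h.1, by exact_mod_cast hp⟩]
  obtain ⟨h1, h2, e⟩ := wordSym_eq hk w hp
  unfold emb
  rw [Int.toNat_natCast, e, skd_blockSym hk]

theorem init_out {x : ℤ} (h : ¬ (0 ≤ x ∧ x < (n : ℤ) * k)) :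
    initConfig emb q n k w x = q := by
  unfold initConfig
  rw [if_neg (by push_cast; exact h)]

theorem isq_init (hk : 2 ≤ k) (x : ℤ) :
    isq (initConfig emb q n k w x) = decide (¬ (0 ≤ x ∧ x < (n : ℤ) * k)) := by
  by_cases h : 0 ≤ x ∧ x < (n : ℤ) * k
  · rw [init_in w h hk]; simp [isq, h]
  · rw [init_out w h]; exact (decide_eq_true h).symm

theorem isfin_init (hk : 2 ≤ k) (x : ℤ) : isfin (initConfig emb q n k w x) = false := by
  by_cases h : 0 ≤ x ∧ x < (n : ℤ) * k
  · rw [init_in w h hk]; rfl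
  · rw [init_out w h]; rfl

theorem isbody_init (hk : 2 ≤ k) (x : ℤ) :
    isbody (initConfig emb q n k w x) = decide (0 ≤ x ∧ x < (n : ℤ) * k) := by
  by_cases h : 0 ≤ x ∧ x < (n : ℤ) * k
  · rw [init_in w h hk]; exact (decide_eq_true h).symm
  · rw [init_out w h]; exact (decide_eq_false h).symm

theorem nm_start (κ : Kd) (b l r : Bool) :
    nm (start l r (.init κ)) (startD l (.init b)) = startD l (.init b) := by
  simp [nm, start, startD, Dat.init, Ctl.init]

theorem first_step (hn : 1 ≤ n) (hk : 2 ≤ k) (v : ℤ → ℕ) :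
    glob rule (initConfig emb q n k w) = cfg n k v (wdZ n k w) 0 := by
  have hN : 2 ≤ (n : ℤ) * k := by exact_mod_cast (show 2 ≤ n * k by nlinarith)
  funext x
  show rule (initConfig emb q n k w (x - 1)) (initConfig emb q n k w x) (initConfig emb q n k w (x + 1)) = _
  by_cases h : 0 ≤ x ∧ x < (n : ℤ) * k
  · rw [cfg_act h (by push_cast; omega), init_in w h hk]
    unfold rule
    simp only [isfin_init w hk, isq_init w hk, Bool.or_false]
    have el : decide (¬ (0 ≤ x - 1 ∧ x - 1 < (n : ℤ) * k)) = decide (x = 0) := by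
      rw [decide_eq_decide]; omega
    have er : decide (¬ (0 ≤ x + 1 ∧ x + 1 < (n : ℤ) * k)) = decide (x = (n : ℤ) * k - 1) := by
      rw [decide_eq_decide]; omega
    rw [if_neg (by simp), el, er, crun_zero h.1 h.2]
    have ed : drun n k (wdZ n k w) 0 x = startD (decide (x = 0)) (Dat.init (wdZ n k w x)) := by
      simp only [drun]; rw [if_pos h]
    rw [ed, nm_start]
    by_cases h1 : x = 0 ∨ x = (n : ℤ) * k - 1
    · rw [if_pos (by simpa using h1)]
      congr 1
      simp only [grun]; rw [if_pos h1]
    · rw [if_neg (by simpa using h1)]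
      push Not at h1
      rw [init_in w (x := x - 1) (by omega) hk, init_in w (x := x + 1) (by omega) hk]
      rw [if_neg (by simp [isW])]
      have e1 : start (decide (x = 0)) (decide (x = (n : ℤ) * k - 1)) (Ctl.init (kdAt k x)) = Ctl.init (kdAt k x) := by
        rw [decide_eq_false h1.1, decide_eq_false h1.2]; rfl
      have e2 : startD (decide (x = 0)) (Dat.init (wdZ n k w x)) = Dat.init (wdZ n k w x) := by
        rw [decide_eq_false h1.1]; rfl
      rw [e1, e2]
      congr 1
      · exact cstep_init _ _ _
      · unfold nD nC
        simp only [vC, vD]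
        rw [cstep_init]
        exact dstep_init _ _ _ _ _ _
      · simp only [grun]
        rw [if_neg (by omega), if_pos (by omega)]
        rfl
  · rw [cfg_out h, init_out w h]
    unfold rule
    simp only [isbody_init w hk]
    by_cases h1 : x = -1 ∨ x = (n : ℤ) * k
    · rw [if_pos h1, if_pos]
      simp only [Bool.or_eq_true, decide_eq_true_iff]
      omega
    · rw [if_neg h1, if_neg]
      simp only [Bool.or_eq_true, decide_eq_true_iff]
      omega

theorem wdZ_eq (hk : 2 ≤ k) (i : Fin n) (j : Fin k) :
    wdZ n k w (((i : ℕ) : ℤ) * k + ((j : ℕ) : ℤ)) = w i j := by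
  have hp : (i : ℕ) * k + j < n * k := by
    have h1 := i.isLt; have h2 := j.isLt
    calc (i : ℕ) * k + j < i * k + k := by omega
      _ = (i + 1) * k := by ring
      _ ≤ n * k := Nat.mul_le_mul_right _ h1
  have e : (((i : ℕ) : ℤ) * k + ((j : ℕ) : ℤ)).toNat = (i : ℕ) * k + j := by
    rw [← Int.toNat_natCast ((i : ℕ) * k + j)]; push_cast; rfl
  obtain ⟨h1, h2, e'⟩ := wordSym_eq hk w hp
  unfold wdZ
  rw [e, e', sbit_blockSym]
  congr 1
  · congr 1
    show ((i : ℕ) * k + j) / k = i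
    rw [mul_comm, Nat.mul_add_div (by omega), Nat.div_eq_of_lt j.isLt, add_zero]
  · apply Fin.ext
    show ((i : ℕ) * k + j) % k = j
    rw [mul_comm, Nat.mul_add_mod, Nat.mod_eq_of_lt j.isLt]

theorem run_eq (hn : 1 ≤ n) (hk : 2 ≤ k) (s : ℕ) :
    (glob rule)^[s + 1] (initConfig emb q n k w) = cfg n k (valZ n k w) (wdZ n k w) s := by
  have hN : 2 ≤ (n : ℤ) * k := by exact_mod_cast (show 2 ≤ n * k by nlinarith)
  have hk' : (2 : ℤ) ≤ k := by omega
  induction s with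
  | zero => exact first_step w hn hk _
  | succ s ih =>
    rw [Function.iterate_succ_apply', ih]
    funext x
    refine cfg_step hk' hN ?_ s x
    intro x h0 h1 t ht
    have hx : x / (k : ℤ) * k + x % k = x := by rw [mul_comm]; exact Int.mul_ediv_add_emod x k
    have h2 : 0 ≤ x / (k : ℤ) := Int.ediv_nonneg h0 (by omega)
    have h3 : x / (k : ℤ) < n := Int.ediv_lt_of_lt_mul (by omega) h1
    have h4 : 0 ≤ x % (k : ℤ) := Int.emod_nonneg _ (by omega)
    have h5 : x % (k : ℤ) < k := Int.emod_lt_of_pos _ (by omega)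
    have := readout_final (n := n) (k := k) (v := valZ n k w) (w := wdZ n k w) (by omega) hk' ?_ ?_ h2 h3 h4 h5 t ht
    · rw [hx] at this; exact this
    · intro s
      rw [Int.toNat_natCast]
      unfold valZ
      split_ifs
      · exact blockValue_lt _ _
      · positivity
    · intro s j s0 s1 j0 j1
      obtain ⟨s, rfl⟩ := Int.eq_ofNat_of_zero_le s0
      obtain ⟨j, rfl⟩ := Int.eq_ofNat_of_zero_le j0
      have a := wdZ_eq w hk ⟨s, by omega⟩ ⟨j, by omega⟩
      have b := valZ_cast w ⟨s, by omega⟩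
      have c := bt_block (w ⟨s, by omega⟩) ⟨j, by omega⟩
      simp only at a b c
      rw [a, b, c]

theorem solves (hn : 1 ≤ n) (hk : 2 ≤ k) :
    glob rule ((glob rule)^[k + n * k] (initConfig emb q n k w)) =
          (glob rule)^[k + n * k] (initConfig emb q n k w) ∧
        IsSortedOutput emb n k w
          ((glob rule)^[k + n * k] (initConfig emb q n k w)) := by
  have hN : 2 ≤ (n : ℤ) * k := by exact_mod_cast (show 2 ≤ n * k by nlinarith)
  have hk' : (2 : ℤ) ≤ k := by omega
  have et : k + n * k = (k + n * k - 1) + 1 := by omega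
  have hs : ((k + n * k - 1 : ℕ) : ℤ) = n * k + k - 1 := by
    rw [Nat.cast_sub (by omega)]; push_cast; ring
  have hlast : ∀ x : ℤ, lastT n k x < ((k + n * k - 1 : ℕ) : ℤ) := by
    intro x
    have h4 : 0 ≤ x % (k : ℤ) := Int.emod_nonneg _ (by omega)
    have h5 : x % (k : ℤ) < k := Int.emod_lt_of_pos _ (by omega)
    rw [hs]; unfold lastT; omega
  constructor
  · rw [← Function.iterate_succ_apply' (glob rule), et, run_eq w hn hk, run_eq w hn hk]
    funext x
    by_cases h : 0 ≤ x ∧ x < (n : ℤ) * k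
    · have := hlast x
      rw [cfg_end h (by rw [hs]; omega) this,
        cfg_end h (by push_cast; rw [hs]; omega) (by push_cast; omega)]
    · rw [cfg_out h, cfg_out h]
  · obtain ⟨σ, hσ⟩ := VV_perm n (valZ n k w) (12 * (n : ℤ)).toNat
    have hF : ∀ i : Fin n, Fin_ n (valZ n k w) ((i : ℕ) : ℤ) = blockValue k (w (σ i)) := by
      intro i
      unfold Fin_
      rw [hσ i, valZ_cast]
    refine ⟨Fin.revPerm.trans σ, ?_, ?_⟩
    · intro i j hij
      show blockValue k (w (σ (Fin.rev i))) ≤ blockValue k (w (σ (Fin.rev j)))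
      rw [← hF, ← hF]
      have h1 : (Fin.rev j : ℕ) ≤ (Fin.rev i : ℕ) := Fin.rev_le_rev.2 hij
      exact Fin_sorted _ _ (by omega) (by omega) (by have := (Fin.rev i).isLt; omega)
    · intro p hp
      have h : 0 ≤ (p : ℤ) ∧ (p : ℤ) < (n : ℤ) * k := ⟨by omega, by exact_mod_cast hp⟩
      rw [et, run_eq w hn hk, cfg_end h (by rw [hs]; omega) (hlast p)]
      obtain ⟨h1, h2, e⟩ := wordSym_eq hk (fun i => w (Fin.revPerm.trans σ i)) hp
      rw [e]
      unfold emb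
      rw [skd_blockSym hk, sbit_blockSym]
      congr 2
      unfold outB
      have e1 : ((n : ℤ) - 1 - (p : ℤ) / k) = (((Fin.rev ⟨p / k, h1⟩ : Fin n) : ℕ) : ℤ) := by
        rw [Fin.val_rev]
        show _ = ((n - (p / k + 1) : ℕ) : ℤ)
        rw [Nat.cast_sub (by omega)]; push_cast; ring
      have e2 : (p : ℤ) % (k : ℤ) = (((⟨p % k, h2⟩ : Fin k) : ℕ) : ℤ) := by
        push_cast; rfl
      rw [e1, e2, hF, bt_block]
      rfl

end

/-- There is a CA (a finite state set `Q` containing the input alphabet, a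
quiescent state `q` and a local rule `f`, none depending on `n` or `k`) with
von Neumann neighborhood of radius 1 solving the sorting problem in exactly
`k + n*k` steps: for all `n ≥ 1`, `k ≥ 2` and every input word, the
configuration after `k + n*k` steps is stable and its restriction to cells
`0, …, n*k - 1` is the sorted output word. -/
theorem sorting_in_k_plus_nk_steps :
    ∃ (Q : Type) (_ : Fintype Q) (f : Q → Q → Q → Q) (q : Q) (embed : CASym → Q),
      Function.Injective embed ∧ f q q q = q ∧
      ∀ n k : ℕ, 1 ≤ n → 2 ≤ k → ∀ w : Fin n → Fin k → Bool,
        glob f ((glob f)^[k + n * k] (initConfig embed q n k w)) =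
          (glob f)^[k + n * k] (initConfig embed q n k w) ∧
        IsSortedOutput embed n k w
          ((glob f)^[k + n * k] (initConfig embed q n k w)) := by
  exact ⟨QQ, Fintype.ofFinite QQ, QQ.rule, QQ.q, emb, emb_inj, rfl,
    fun n k hn hk w => solves w hn hk⟩
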